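/- Let ℓ ≥ 2 and w ≥ 0 be integers, let ρ be an ℓ-core partition, and set n = |ρ| + ℓw. Then the Cartan matrix Cart_ℓ(n, ρ) is equivalent over ℤ to the diagonal matrix whose diagonal entries are ϑ_λ(ℓ), each repeated k(ℓ−2, w−|λ|) times, where λ runs over all partitions with |λ| ≤ w. (In particular this diagonal matrix has size k(ℓ−1, w).) -/

import Mathlib

open scoped BigOperators
open Classical

noncomputable section

/-- The number of maps `f` from the (indexed) parts of `mu` to the parts of `lam` such that for
every part `lam_i` of `lam`, the sum of the parts of `mu` in the fibre `f⁻¹(i)` equals `lam_i`.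
This is `|𝓜_{λμ}|` and also the value of the permutation character `h_λ` on the class of cycle
type `μ`. -/
def Mcount (lam mu : Multiset ℕ) : ℕ :=
  Fintype.card {f : Fin (Multiset.card mu) → Fin (Multiset.card lam) //
    ∀ i : Fin (Multiset.card lam),
      (∑ j ∈ Finset.univ.filter (fun j => f j = i), (mu.sort (· ≤ ·)).getD j 0)
        = (lam.sort (· ≤ ·)).getD i 0}

/-- `z_λ = ∏_i i^{m_i(λ)} m_i(λ)!`. -/
def zMult (lam : Multiset ℕ) : ℕ :=
  ∏ i ∈ lam.toFinset, i ^ lam.count i * (lam.count i).factorial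

/-- The cycle type of a permutation of `Fin n`, as the multiset of parts of a partition of `n`
(including the parts equal to `1` corresponding to fixed points). -/
def cycM {n : ℕ} (g : Equiv.Perm (Fin n)) : Multiset ℕ :=
  g.cycleType + Multiset.replicate (n - g.support.card) 1

/-- The value of the irreducible character `s_λ` of the symmetric group on the conjugacy class
of cycle type `nu`, given by the Jacobi–Trudi determinant `s_λ = det(h_{λ_i - i + j})_{i,j}`,
where `h_α` has value `Mcount α ν` on the class of cycle type `ν`. -/
def sval (lam nu : Multiset ℕ) : ℚ :=
  let L := (lam.sort (· ≤ ·)).reverse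
  let l := Multiset.card lam
  ∑ σ : Equiv.Perm (Fin l),
    ((Equiv.Perm.sign σ : ℤ) : ℚ) *
      (if ∀ i : Fin l, (i : ℕ) ≤ L.getD i 0 + (σ i : ℕ) then
        (Mcount ((Multiset.map (fun i : Fin l => L.getD i 0 + (σ i : ℕ) - (i : ℕ))
            (Finset.univ.val : Multiset (Fin l))).filter (fun x => x ≠ 0)) nu : ℚ)
       else 0)

/-- The irreducible character of `S_n` labelled by the partition `lam`, as a class function on
the symmetric group `S_n = Perm (Fin n)`. -/
def sFun {n : ℕ} (lam : Nat.Partition n) : Equiv.Perm (Fin n) → ℚ :=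
  fun g => sval lam.parts (cycM g)

/-- The usual scalar product of class functions on a finite group:
`⟨f, h⟩ = |G|⁻¹ ∑_{g ∈ G} f(g) h(g⁻¹)`. -/
def sp {G : Type*} [Group G] [Fintype G] (f h : G → ℚ) : ℚ :=
  (Fintype.card G : ℚ)⁻¹ * ∑ g : G, f g * h g⁻¹

/-- `d_p(k) = v_p(k!)`. -/
def dval (p k : ℕ) : ℕ := padicValNat p (Nat.factorial k)

/-- `c_{p,r}(λ) = ∑_{j ≥ 1, v_p(j) < r} ((r - v_p(j)) m_j(λ) + d_p(m_j(λ)))`. -/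
def cpr (p r : ℕ) (lam : Multiset ℕ) : ℕ :=
  ∑ j ∈ lam.toFinset.filter (fun j => padicValNat p j < r),
    ((r - padicValNat p j) * lam.count j + dval p (lam.count j))

/-- `ϑ_λ(ℓ) = ∏_{p^r ∥ ℓ} p^{c_{p,r}(λ)}`, with `ϑ_λ(0) = 0`. -/
def theta (lam : Multiset ℕ) (l : ℕ) : ℚ :=
  if l = 0 then 0 else ∏ q ∈ l.primeFactors, (q : ℚ) ^ cpr q (padicValNat q l) lam

/-- Two square matrices over `ℚ` (with possibly differently labelled index sets) are equivalent
over `ℤ` if one is obtained from the other by left and right multiplication by matrices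
invertible over `ℤ`. -/
def IntEquiv {T D : Type*} [Fintype T] [Fintype D] [DecidableEq T] [DecidableEq D]
    (A : Matrix T T ℚ) (B : Matrix D D ℚ) : Prop :=
  ∃ (e : T ≃ D) (U V : Matrix T T ℤ), IsUnit U ∧ IsUnit V ∧
    (U.map (fun x : ℤ => (x : ℚ))) * A * (V.map (fun x : ℤ => (x : ℚ))) = B.submatrix e e

/-- The type of all partitions (of arbitrary natural numbers). -/
abbrev PttAll : Type := Σ n : ℕ, Nat.Partition n

/-- Partitions of size at most `w`, with bounded first component (a finite type). -/
abbrev PBP (w : ℕ) : Type := (m : Fin (w + 1)) × Nat.Partition m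

/-- `PMap_w(T)`: the (finite) set of maps from `T` to partitions, of total size `w`. -/
abbrev PMapw (T : Type*) [Fintype T] (w : ℕ) : Type _ :=
  {lam : T → PBP w // ∑ t, ((lam t).1 : ℕ) = w}

/-- The multiset of beta-numbers of a partition, displayed with `N` beads:
`β_i = λ_i + N - i` for `1 ≤ i ≤ N` (where `λ_i = 0` for `i > l(λ)`). -/
def betaSet (lam : Multiset ℕ) (N : ℕ) : Multiset ℕ :=
  Multiset.ofList ((List.range N).map
    (fun i => ((lam.sort (· ≤ ·)).reverse).getD i 0 + N - 1 - i))

/-- Two partitions have the same `ℓ`-core if and only if their beta-sets (displayed with a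
common number of beads) have equal multisets of residues modulo `ℓ`. -/
def sameCore (l : ℕ) (lam rho : Multiset ℕ) : Prop :=
  (betaSet lam (Multiset.card lam + Multiset.card rho)).map (· % l)
    = (betaSet rho (Multiset.card lam + Multiset.card rho)).map (· % l)

/-- `ρ` is an `ℓ`-core: no rim `ℓ`-hook can be removed, i.e. for every beta-number `b ≥ ℓ` of
`ρ`, `b - ℓ` is again a beta-number. -/
def IsCore (l : ℕ) (rho : Multiset ℕ) : Prop :=
  ∀ b ∈ betaSet rho (Multiset.card rho), l ≤ b → b - l ∈ betaSet rho (Multiset.card rho)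

/-- `g ∈ S_n` is `ℓ`-singular: its cycle decomposition contains a cycle of length divisible
by `ℓ`. -/
def IsSingular (l : ℕ) {n : ℕ} (g : Equiv.Perm (Fin n)) : Prop :=
  ∃ j ∈ cycM g, l ∣ j

/-- The `ℤ`-submodule of functions on `S_n` vanishing on all `ℓ`-singular elements. -/
def VanishSub (l n : ℕ) : Submodule ℤ (Equiv.Perm (Fin n) → ℚ) where
  carrier := {f | ∀ g, IsSingular l g → f g = 0}
  add_mem' := by
    intro f g hf hg x hx
    have h1 : f x = 0 := hf x hx
    have h2 : g x = 0 := hg x hx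
    simp [Pi.add_apply, h1, h2]
  zero_mem' := by intro x _; rfl
  smul_mem' := by
    intro c f hf x hx
    have h1 : f x = 0 := hf x hx
    simp [Pi.smul_apply, h1]

/-- `𝒞(S_n) = ℤ[Irr(S_n)]`: the `ℤ`-span of the irreducible characters of `S_n`. -/
def VirtCharS (n : ℕ) : Submodule ℤ (Equiv.Perm (Fin n) → ℚ) :=
  Submodule.span ℤ (Set.range (fun lam : Nat.Partition n => sFun lam))

/-- `𝒞(S_n, ρ) = ℤ[Irr(S_n, ρ)]`: the `ℤ`-span of the irreducible characters `s_λ` with the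
`ℓ`-core of `λ` equal to `ρ`. -/
def CBlock (l n : ℕ) (rho : Multiset ℕ) : Submodule ℤ (Equiv.Perm (Fin n) → ℚ) :=
  Submodule.span ℤ ((fun lam : Nat.Partition n => sFun lam) ''
    {lam | IsCore l rho ∧ sameCore l lam.parts rho})

/-- `k(b, a)`: the number of `b`-tuples of partitions whose sizes sum to `a`. -/
def kfun (b a : ℕ) : ℕ := Fintype.card (PMapw (Fin b) a)

set_option linter.unusedSectionVars false
set_option linter.unusedSimpArgs false
namespace CBI

/-- Power-sum polynomial ring with colours `C`; `X (c, j)` is the power sum `p_{c, j+1}`. -/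
abbrev Q (C : Type*) := MvPolynomial (C × ℕ) ℚ

/-- weights -/
def wt (C : Type*) : C × ℕ → ℕ := fun i => i.2 + 1

/-- the norm of a power sum monomial -/
def zz {C : Type*} (ν : C × ℕ →₀ ℕ) : ℚ :=
  ν.prod fun i m => ((i.2 + 1 : ℕ) : ℚ) ^ m * (m.factorial : ℚ)

lemma zz_add_single {C : Type*} (ν : C × ℕ →₀ ℕ) (i : C × ℕ) :
    zz (ν + Finsupp.single i 1) = zz ν * ((i.2 + 1 : ℕ) : ℚ) * ((ν i + 1 : ℕ) : ℚ) := by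
  unfold zz
  have h0 : ∀ j : C × ℕ, ((j.2 + 1 : ℕ) : ℚ) ^ 0 * (Nat.factorial 0 : ℚ) = 1 := by simp
  rw [Finsupp.prod_of_support_subset (s := insert i ν.support) _ _ _ (fun j _ => h0 j),
    Finsupp.prod_of_support_subset (s := insert i ν.support) ν _ _ (fun j _ => h0 j)]
  · by_cases hi : i ∈ ν.support
    · rw [Finset.insert_eq_of_mem hi, ← Finset.mul_prod_erase _ _ hi, ← Finset.mul_prod_erase _ _ hi]
      rw [Finset.prod_congr rfl (g := fun j => ((j.2 + 1 : ℕ) : ℚ) ^ (ν j) * ((ν j).factorial : ℚ))]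
      · simp [Nat.factorial_succ, pow_succ]; ring
      · intro j hj
        have : i ≠ j := fun h => by simp [h] at hj
        simp [Finsupp.single_apply, this]
    · rw [Finset.prod_insert hi, Finset.prod_insert hi]
      rw [Finset.prod_congr rfl (g := fun j => ((j.2 + 1 : ℕ) : ℚ) ^ (ν j) * ((ν j).factorial : ℚ))]
      · simp [Nat.factorial_succ, pow_succ]; ring
      · intro j hj
        have : i ≠ j := fun h => by subst h; exact hi hj
        simp [Finsupp.single_apply, this]
  · exact Finset.subset_insert _ _
  · intro j hj
    simp only [Finset.mem_insert, Finsupp.mem_support_iff, Finsupp.add_apply, Finsupp.single_apply] at hj ⊢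
    by_cases h : i = j
    · left; exact h.symm
    · right; simpa [h] using hj

lemma zz_pos {C : Type*} (ν : C × ℕ →₀ ℕ) : 0 < zz ν := by
  unfold zz
  apply Finset.prod_pos
  intro i _
  positivity

/-- the scalar product -/
def ip {C : Type*} : Q C →ₗ[ℚ] Q C →ₗ[ℚ] ℚ :=
  (MvPolynomial.basisMonomials (C × ℕ) ℚ).constr ℚ (fun ν => zz ν • MvPolynomial.lcoeff ℚ ν)

lemma ip_monomial {C : Type*} (ν : C × ℕ →₀ ℕ) (a : ℚ) (g : Q C) :
    ip (MvPolynomial.monomial ν a) g = a * zz ν * MvPolynomial.coeff ν g := by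
  have : MvPolynomial.monomial ν a = a • (MvPolynomial.basisMonomials (C × ℕ) ℚ ν) := by
    simp [MvPolynomial.smul_monomial]
  rw [this, map_smul, ip, Module.Basis.constr_basis]
  simp [mul_assoc]

lemma ip_symm {C : Type*} (f g : Q C) : ip f g = ip g f := by
  induction f using MvPolynomial.induction_on' with
  | add p q hp hq => simp [hp, hq]
  | monomial ν a =>
    induction g using MvPolynomial.induction_on' with
    | add p q hp hq => simp [hp, hq]
    | monomial μ b =>
      rw [ip_monomial, ip_monomial, MvPolynomial.coeff_monomial, MvPolynomial.coeff_monomial]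
      by_cases h : μ = ν
      · subst h; simp; ring
      · have h' : ν ≠ μ := fun e => h e.symm
        simp [h, h']

/-- the adjoint of multiplication by a power sum -/
def DD {C : Type*} (i : C × ℕ) : Derivation ℚ (Q C) (Q C) :=
  ((i.2 + 1 : ℕ) : ℚ) • MvPolynomial.pderiv i

lemma DD_apply {C : Type*} (i : C × ℕ) (f : Q C) :
    DD i f = ((i.2 + 1 : ℕ) : ℚ) • MvPolynomial.pderiv i f := rfl

lemma ip_X_mul {C : Type*} (i : C × ℕ) (f g : Q C) :
    ip (MvPolynomial.X i * f) g = ip f (DD i g) := by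
  induction f using MvPolynomial.induction_on' with
  | add p q hp hq => simp [mul_add, hp, hq]
  | monomial ν a =>
    have : MvPolynomial.X i * MvPolynomial.monomial ν a = MvPolynomial.monomial (ν + Finsupp.single i 1) a := by
      rw [MvPolynomial.X, MvPolynomial.monomial_mul, one_mul, add_comm]
    rw [this, ip_monomial, ip_monomial, zz_add_single, DD_apply, MvPolynomial.coeff_smul,
      MvPolynomial.coeff_pderiv]
    push_cast
    simp only [smul_eq_mul]
    ring

lemma ip_one_left {C : Type*} (g : Q C) : ip 1 g = MvPolynomial.coeff 0 g := by
  have : (1 : Q C) = MvPolynomial.monomial 0 1 := rfl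
  rw [this, ip_monomial]; simp [zz]

lemma ip_nondeg {C : Type*} (g : Q C) (h : ∀ f, ip f g = 0) : g = 0 := by
  ext ν
  have := h (MvPolynomial.monomial ν 1)
  rw [ip_monomial] at this
  have hz := (zz_pos ν).ne'
  simpa [hz] using this

lemma ip_self_nonneg {C : Type*} (g : Q C) : 0 ≤ ip g g ∧ (ip g g = 0 → g = 0) := by
  have key : ip g g = ∑ ν ∈ g.support, zz ν * (MvPolynomial.coeff ν g)^2 := by
    conv_lhs => 
      enter [1, 2]; rw [MvPolynomial.as_sum g]
    rw [map_sum, LinearMap.sum_apply]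
    refine Finset.sum_congr rfl fun ν _ => ?_
    rw [ip_monomial]; ring
  have hp : ∀ ν ∈ g.support, 0 ≤ zz ν * (MvPolynomial.coeff ν g)^2 := fun ν _ =>
    mul_nonneg (zz_pos ν).le (sq_nonneg _)
  refine ⟨by rw [key]; exact Finset.sum_nonneg hp, fun h => ?_⟩
  rw [key, Finset.sum_eq_zero_iff_of_nonneg hp] at h
  ext ν
  by_contra hν
  have h1 := h ν (by simpa [MvPolynomial.mem_support_iff] using hν)
  have hz := (zz_pos ν).ne'
  simp [hz] at h1
  exact hν (by simpa using h1)

/-- homogeneous of weight `w` -/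
abbrev Hom {C : Type*} (f : Q C) (w : ℕ) : Prop := MvPolynomial.IsWeightedHomogeneous (wt C) f w

lemma euler {C : Type*} [Fintype C] (f : Q C) (w : ℕ) (hf : Hom f w) :
    (w : ℚ) • f = ∑ c : C, ∑ j ∈ Finset.range w, MvPolynomial.X (c, j) * DD (c, j) f := by
  have key : ∀ ν : C × ℕ →₀ ℕ, ∀ a : ℚ, Finsupp.weight (wt C) ν = w →
      (w : ℚ) • MvPolynomial.monomial ν a =
        ∑ c : C, ∑ j ∈ Finset.range w, MvPolynomial.X (c, j) * DD (c, j) (MvPolynomial.monomial ν a) := by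
    intro ν a hν
    have h1 : ∀ i : C × ℕ, MvPolynomial.X i * DD i (MvPolynomial.monomial ν a) =
        (((ν i * (i.2 + 1) : ℕ)) : ℚ) • MvPolynomial.monomial ν a := by
      intro i
      rw [DD_apply, MvPolynomial.pderiv_monomial, MvPolynomial.X, MvPolynomial.smul_monomial,
        MvPolynomial.monomial_mul, MvPolynomial.smul_monomial]
      by_cases hi : ν i = 0
      · simp [hi]
      · have : Finsupp.single i 1 + (ν - Finsupp.single i 1) = ν := by
          ext k
          by_cases hk : i = k
          · subst hk; simp; omega
          · simp [Finsupp.single_apply, hk]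
        rw [this]
        congr 1
        push_cast; simp only [smul_eq_mul]; ring
    simp only [h1]
    rw [← Finset.sum_product', ← Finset.sum_smul]
    congr 1
    rw [← hν, Finsupp.weight_apply, Finsupp.sum]
    rw [Nat.cast_sum]
    symm
    rw [← Finset.sum_subset (s₁ := ν.support)]
    · refine Finset.sum_congr rfl fun i _ => ?_
      simp [wt]
    · intro i hi
      simp only [Finset.mem_product, Finset.mem_univ, true_and, Finset.mem_range]
      have : ν i • wt C i ≤ ∑ i ∈ ν.support, ν i • wt C i :=
        Finset.single_le_sum (f := fun i => ν i • wt C i) (fun _ _ => Nat.zero_le _) hi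
      have h2 : ν i ≠ 0 := by simpa using hi
      have h3 : 1 * wt C i ≤ ν i * wt C i := Nat.mul_le_mul_right _ (Nat.one_le_iff_ne_zero.2 h2)
      simp only [wt, smul_eq_mul] at *
      omega
    · intro i _ hi
      simp at hi; simp [hi]
  conv_lhs => rw [MvPolynomial.as_sum f]
  conv_rhs => rw [MvPolynomial.as_sum f]
  simp only [map_sum, Finset.smul_sum, Finset.mul_sum]
  rw [Finset.sum_congr rfl fun ν hν => key ν _ (hf (by simpa [MvPolynomial.mem_support_iff] using hν))]
  rw [Finset.sum_comm]
  refine Finset.sum_congr rfl fun c _ => ?_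
  rw [Finset.sum_comm]

lemma euler_ip {C : Type*} [Fintype C] (f g : Q C) (w : ℕ) (hf : Hom f w) :
    (w : ℚ) * ip f g = ∑ c : C, ∑ j ∈ Finset.range w, ip (DD (c, j) f) (DD (c, j) g) := by
  have := congrArg (fun x => ip x g) (euler f w hf)
  simp only [map_smul, LinearMap.smul_apply, smul_eq_mul, map_sum, LinearMap.sum_apply, ip_X_mul] at this
  exact this

end CBI

namespace CBI

section hh
variable {R : Type*} [CommRing R] [Algebra ℚ R]

/-- complete symmetric functions from power sums -/
def hh (q : ℕ → R) : ℕ → R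
  | 0 => 1
  | (n + 1) => ((n + 1 : ℕ) : ℚ)⁻¹ • ∑ k : Fin (n + 1), q k * hh q (n - k)
termination_by n => n
decreasing_by omega

lemma hh_zero (q : ℕ → R) : hh q 0 = 1 := by rw [hh]

lemma hh_succ (q : ℕ → R) (n : ℕ) :
    ((n + 1 : ℕ) : ℚ) • hh q (n + 1) = ∑ k ∈ Finset.range (n + 1), q k * hh q (n - k) := by
  rw [hh, smul_smul, mul_inv_cancel₀ (by positivity), one_smul,
    Finset.sum_range (fun k => q k * hh q (n - k))]

lemma hh_unique (q : ℕ → R) (u : ℕ → R) (h0 : u 0 = 1)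
    (hs : ∀ n, ((n + 1 : ℕ) : ℚ) • u (n + 1) = ∑ k ∈ Finset.range (n + 1), q k * u (n - k)) :
    ∀ n, u n = hh q n := by
  intro n
  induction n using Nat.strong_induction_on with
  | _ n ih =>
    cases n with
    | zero => rw [h0, hh_zero]
    | succ n =>
      have h1 : ((n + 1 : ℕ) : ℚ) • u (n + 1) = ((n + 1 : ℕ) : ℚ) • hh q (n + 1) := by
        rw [hs, hh_succ]
        refine Finset.sum_congr rfl fun k _ => ?_
        rw [ih (n - k) (by omega)]
      have h2 : ((n + 1 : ℕ) : ℚ) ≠ 0 := by positivity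
      have := congrArg (fun x => ((n + 1 : ℕ) : ℚ)⁻¹ • x) h1
      simpa only [smul_smul, inv_mul_cancel₀ h2, one_smul] using this

/-- generating series -/
def HS (q : ℕ → R) : PowerSeries R := PowerSeries.mk (hh q)

lemma HS_deriv (q : ℕ → R) :
    PowerSeries.derivative R (HS q) = PowerSeries.mk q * HS q := by
  ext n
  rw [PowerSeries.coeff_derivative, HS, PowerSeries.coeff_mk, PowerSeries.coeff_mul,
    Finset.Nat.sum_antidiagonal_eq_sum_range_succ (fun i j => (PowerSeries.coeff i) (PowerSeries.mk q) * (PowerSeries.coeff j) (PowerSeries.mk (hh q)))]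
  simp only [PowerSeries.coeff_mk]
  rw [← hh_succ, Algebra.smul_def, mul_comm]
  simp

lemma HS_unique (q : ℕ → R) (F : PowerSeries R) (h0 : PowerSeries.coeff 0 F = 1)
    (hF : PowerSeries.derivative R F = PowerSeries.mk q * F) : F = HS q := by
  ext n
  rw [HS, PowerSeries.coeff_mk]
  refine hh_unique q (fun n => PowerSeries.coeff n F) h0 ?_ n
  intro n
  have := congrArg (PowerSeries.coeff n) hF
  rw [PowerSeries.coeff_derivative, PowerSeries.coeff_mul,
    Finset.Nat.sum_antidiagonal_eq_sum_range_succ (fun i j => (PowerSeries.coeff i) (PowerSeries.mk q) * (PowerSeries.coeff j) F)] at this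
  simp only [PowerSeries.coeff_mk] at this
  rw [← this, Algebra.smul_def, mul_comm]
  simp

lemma HS_add (q q' : ℕ → R) : HS (q + q') = HS q * HS q' := by
  symm
  apply HS_unique
  · simp [HS, PowerSeries.coeff_mul, hh_zero]
  · rw [Derivation.leibniz, HS_deriv, HS_deriv]
    have : PowerSeries.mk (q + q') = PowerSeries.mk q + PowerSeries.mk q' := by
      ext; simp
    rw [this]
    simp only [smul_eq_mul]; ring

lemma HS_zero : HS (0 : ℕ → R) = 1 := by
  symm
  apply HS_unique
  · simp
  · have : PowerSeries.mk (0 : ℕ → R) = 0 := by ext; simp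
    rw [this]; simp

lemma hh_add (q q' : ℕ → R) (n : ℕ) :
    hh (q + q') n = ∑ k ∈ Finset.range (n + 1), hh q k * hh q' (n - k) := by
  have := congrArg (PowerSeries.coeff n) (HS_add q q')
  rw [PowerSeries.coeff_mul, Finset.Nat.sum_antidiagonal_eq_sum_range_succ (fun i j => (PowerSeries.coeff i) (HS q) * (PowerSeries.coeff j) (HS q'))] at this
  simpa [HS] using this

lemma hh_of_zero (n : ℕ) : hh (0 : ℕ → R) n = if n = 0 then 1 else 0 := by
  have := congrArg (PowerSeries.coeff n) (HS_zero (R := R))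
  simpa [HS, PowerSeries.coeff_one] using this

lemma hh_map {S : Type*} [CommRing S] [Algebra ℚ S] (f : R →ₐ[ℚ] S) (q : ℕ → R) (n : ℕ) :
    f (hh q n) = hh (fun k => f (q k)) n := by
  refine hh_unique _ (fun n => f (hh q n)) (by simp [hh_zero]) ?_ n
  intro n
  rw [← map_smul, hh_succ, map_sum]
  simp

lemma hh_geom (q : ℕ → R) (t : R) (d : ℚ) (hq : ∀ k, q k = d • t ^ (k + 1)) (n : ℕ) :
    hh q n = (hh (fun _ => d) n) • t ^ n := by
  symm
  refine hh_unique _ (fun n => (hh (fun _ => d) n) • t ^ n) (by simp [hh_zero]) ?_ n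
  intro n
  rw [smul_smul]
  have := hh_succ (fun _ => d) n
  rw [smul_eq_mul] at this
  rw [this, Finset.sum_smul]
  refine Finset.sum_congr rfl fun k hk => ?_
  have : k ≤ n := by simp at hk; omega
  rw [hq, smul_mul_smul_comm, ← pow_add]
  congr 2; omega

lemma hh_one_const (n : ℕ) : hh (fun _ => (1 : ℚ)) n = 1 := by
  symm
  refine hh_unique _ (fun _ => (1:ℚ)) rfl ?_ n
  intro n; simp

lemma hh_pow (t : R) (n : ℕ) : hh (fun k => t ^ (k + 1)) n = t ^ n := by
  rw [hh_geom (fun k => t ^ (k + 1)) t 1 (by simp), hh_one_const, one_smul]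

lemma hh_deriv (D : Derivation ℚ R R) (q : ℕ → R) (j : ℕ) (x : ℚ)
    (hD : ∀ k, D (q k) = if k = j then algebraMap ℚ R ((j + 1 : ℕ) * x) else 0) (n : ℕ) :
    D (hh q n) = if j + 1 ≤ n then x • hh q (n - (j + 1)) else 0 := by
  induction n using Nat.strong_induction_on with
  | _ n ih =>
    cases n with
    | zero => simp [hh_zero]
    | succ n =>
      have h1 := congrArg D (hh_succ q n)
      rw [Derivation.map_smul, map_sum] at h1
      simp only [Derivation.leibniz, smul_eq_mul] at h1
      rw [Finset.sum_add_distrib] at h1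
      have e1 : ∑ k ∈ Finset.range (n + 1), hh q (n - k) * D (q k) =
          if j + 1 ≤ n + 1 then ((j + 1 : ℕ) * x) • hh q (n - j) else 0 := by
        simp only [hD, mul_ite, mul_zero]
        rw [Finset.sum_ite_eq' (Finset.range (n+1)) j]
        simp only [Finset.mem_range, Algebra.smul_def]
        by_cases hj : j + 1 ≤ n + 1
        · rw [if_pos hj, if_pos (by omega), mul_comm]
        · rw [if_neg hj, if_neg (by omega)]
      have e2 : ∑ k ∈ Finset.range (n + 1), q k * D (hh q (n - k)) =
          if j + 1 ≤ n + 1 then ((n - j : ℕ) * x) • hh q (n - j) else 0 := by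
        rw [Finset.sum_congr rfl fun k hk => by rw [ih (n - k) (by omega)]]
        by_cases hj : j + 1 ≤ n + 1
        · rw [if_pos hj]
          obtain ⟨m, rfl⟩ : ∃ m, n = j + m := ⟨n - j, by omega⟩
          have : j + m - j = m := by omega
          rw [this]
          cases m with
          | zero =>
            simp only [Nat.cast_zero, zero_mul, zero_smul]
            apply Finset.sum_eq_zero
            intro k _
            rw [if_neg (by omega), mul_zero]
          | succ m =>
            rw [mul_comm (((m + 1 : ℕ)) : ℚ) x, mul_smul, hh_succ, Finset.smul_sum]
            rw [← Finset.sum_subset (s₁ := Finset.range (m + 1))]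
            · refine Finset.sum_congr rfl fun k hk => ?_
              have : k ≤ m := by simp at hk; omega
              rw [if_pos (by omega), mul_smul_comm]
              congr 3; omega
            · intro k; simp; omega
            · intro k hk hk'
              simp at hk hk'
              rw [if_neg (by omega), mul_zero]
        · rw [if_neg hj]
          apply Finset.sum_eq_zero
          intro k _
          rw [if_neg (by omega), mul_zero]
      rw [e1, e2] at h1
      have h2 : ((n + 1 : ℕ) : ℚ) ≠ 0 := by positivity
      have h3 := congrArg (fun x => ((n + 1 : ℕ) : ℚ)⁻¹ • x) h1
      simp only [smul_smul, inv_mul_cancel₀ h2, one_smul] at h3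
      rw [h3]
      by_cases hj : j + 1 ≤ n + 1
      · simp only [if_pos hj]
        rw [← add_smul, smul_smul]
        have : n + 1 - (j + 1) = n - j := by omega
        rw [this]
        congr 1
        have : ((n - j : ℕ) : ℚ) * x + (j + 1 : ℕ) * x = ((n + 1 : ℕ) : ℚ) * x := by
          rw [← add_mul, ← Nat.cast_add]; congr 2; omega
        rw [this, ← mul_assoc, inv_mul_cancel₀ h2, one_mul]
      · simp only [if_neg hj]; simp

lemma hh_neg_mem (S : Subring R) (q : ℕ → R) (h : ∀ n, hh q n ∈ S) (n : ℕ) : hh (-q) n ∈ S := by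
  induction n using Nat.strong_induction_on with
  | _ n ih =>
    cases n with
    | zero => rw [hh_zero]; exact S.one_mem
    | succ n =>
      have h1 := hh_add q (-q) (n + 1)
      rw [add_neg_cancel, hh_of_zero, if_neg (by omega), Finset.sum_range_succ', hh_zero] at h1
      simp only [one_mul, Nat.sub_zero] at h1
      have : hh (-q) (n + 1) = - ∑ k ∈ Finset.range (n + 1), hh q (k + 1) * hh (-q) (n + 1 - (k + 1)) := by
        linear_combination (-1 : R) * h1
      rw [this]
      refine S.neg_mem (S.sum_mem fun k hk => S.mul_mem (h _) (ih _ (by omega)))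

lemma hh_add_mem (S : Subring R) (q q' : ℕ → R) (h : ∀ n, hh q n ∈ S) (h' : ∀ n, hh q' n ∈ S) (n : ℕ) :
    hh (q + q') n ∈ S := by
  rw [hh_add]
  exact S.sum_mem fun k _ => S.mul_mem (h _) (h' _)

lemma hh_zero_mem (S : Subring R) (n : ℕ) : hh (0 : ℕ → R) n ∈ S := by
  rw [hh_of_zero]; split_ifs; exacts [S.one_mem, S.zero_mem]

lemma hh_zsmul_mem (S : Subring R) (q : ℕ → R) (h : ∀ n, hh q n ∈ S) (x : ℤ) :
    ∀ n, hh (x • q) n ∈ S := by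
  induction x using Int.induction_on with
  | zero => intro n; rw [zero_smul]; exact hh_zero_mem S n
  | succ i ih => rw [add_smul, one_smul]; exact hh_add_mem S _ _ ih h
  | pred i ih => rw [sub_smul, one_smul, sub_eq_add_neg]; exact hh_add_mem S _ _ ih (hh_neg_mem S _ h)

lemma hh_sum_mem {ι : Type*} (s : Finset ι) (S : Subring R) (q : ι → ℕ → R) (x : ι → ℤ)
    (h : ∀ i ∈ s, ∀ n, hh (q i) n ∈ S) :
    ∀ n, hh (∑ i ∈ s, x i • q i) n ∈ S := by
  induction s using Finset.induction_on with
  | empty => intro n; rw [Finset.sum_empty]; exact hh_zero_mem S n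
  | insert a s ha ih =>
    rw [Finset.sum_insert ha]
    exact hh_add_mem S _ _ (hh_zsmul_mem S _ (h a (by simp)) _) (ih fun i hi => h i (by simp [hi]))

end hh

/-- colored complete symmetric function -/
def hp {C : Type*} (c : C) (n : ℕ) : Q C := hh (fun k => MvPolynomial.X (c, k)) n

/-- colored complete symmetric function with integer index -/
def hz {C : Type*} (c : C) (m : ℤ) : Q C := if 0 ≤ m then hp c m.toNat else 0

lemma hz_neg {C : Type*} (c : C) {m : ℤ} (h : m < 0) : hz c m = 0 := by
  rw [hz, if_neg (by omega)]

lemma hz_nat {C : Type*} (c : C) (m : ℕ) : hz c (m : ℤ) = hp c m := by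
  rw [hz, if_pos (by omega)]; simp

lemma hz_zero {C : Type*} (c : C) : hz c 0 = 1 := by
  have := hz_nat c 0
  rw [hp, hh_zero] at this; simpa using this

lemma DD_X {C : Type*} [DecidableEq C] (i k : C × ℕ) :
    DD i (MvPolynomial.X k : Q C) = if k = i then MvPolynomial.C ((i.2 + 1 : ℕ) : ℚ) else 0 := by
  rw [DD_apply]
  rw [MvPolynomial.pderiv_X]
  by_cases h : i = k
  · subst h; simp [MvPolynomial.smul_eq_C_mul]
  · have : k ≠ i := fun e => h e.symm
    simp [this, h]

lemma DD_hz {C : Type*} [DecidableEq C] (c c' : C) (j : ℕ) (m : ℤ) :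
    DD (c, j) (hz c' m) = if c' = c then hz c' (m - ((j : ℤ) + 1)) else 0 := by
  by_cases hm : m < 0
  · rw [hz_neg _ hm, hz_neg _ (by omega : m - ((j : ℤ) + 1) < 0)]; simp
  obtain ⟨n, rfl⟩ : ∃ n : ℕ, m = n := ⟨m.toNat, by omega⟩
  rw [hz_nat, hp, hh_deriv (DD (c, j)) _ j (if c' = c then 1 else 0)]
  · by_cases hc : c' = c
    · simp only [hc, if_true, one_smul]
      by_cases h : j + 1 ≤ n
      · rw [if_pos h]
        have : ((n : ℤ) - ((j : ℤ) + 1)) = ((n - (j + 1) : ℕ) : ℤ) := by omega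
        rw [this, hz_nat]; rfl
      · rw [if_neg h, hz_neg _ (by omega)]
    · simp [hc]
  · intro k
    rw [DD_X]
    simp only [Prod.mk.injEq]
    by_cases hc : c' = c <;> by_cases hk : k = j <;> simp [hc, hk, MvPolynomial.algebraMap_eq]

lemma Hom_X {C : Type*} (i : C × ℕ) : Hom (MvPolynomial.X i : Q C) (i.2 + 1) :=
  MvPolynomial.isWeightedHomogeneous_X ℚ (wt C) i

lemma Hom_hp {C : Type*} (c : C) (n : ℕ) : Hom (hp c n : Q C) n := by
  induction n using Nat.strong_induction_on with
  | _ n ih =>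
    cases n with
    | zero => rw [hp, hh_zero]; exact MvPolynomial.isWeightedHomogeneous_one ℚ _
    | succ n =>
      have h2 : ((n + 1 : ℕ) : ℚ) ≠ 0 := by positivity
      have h1 := congrArg (fun x => ((n + 1 : ℕ) : ℚ)⁻¹ • x) (hh_succ (fun k => (MvPolynomial.X (c, k) : Q C)) n)
      simp only [smul_smul, inv_mul_cancel₀ h2, one_smul] at h1
      rw [hp, h1]
      refine Submodule.smul_mem (MvPolynomial.weightedHomogeneousSubmodule ℚ (wt C) (n+1)) _ (Submodule.sum_mem _ fun k hk => ?_)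
      have hk' : k ≤ n := by simp at hk; omega
      have := (Hom_X (c, k)).mul (ih (n - k) (by omega))
      rw [MvPolynomial.mem_weightedHomogeneousSubmodule]
      have e : (c, k).2 + 1 + (n - k) = n + 1 := by
        change k + 1 + (n - k) = n + 1; omega
      rw [e] at this
      exact this

end CBI

namespace CBI

section
variable {B C : Type*} [Fintype B] [DecidableEq B] [DecidableEq C]

/-- matrix of complete functions -/
def smat (κ : B → C) (δ : B → ℕ) (γ : B → ℤ) : Matrix B B (Q C) :=
  Matrix.of fun i j => if κ i = κ j then hz (κ j) (γ i - δ j) else 0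

/-- coloured Schur function -/
def sch (κ : B → C) (δ : B → ℕ) (γ : B → ℤ) : Q C := (smat κ δ γ).det

lemma deriv_prod {R ι : Type*} [CommRing R] [Algebra ℚ R] [DecidableEq ι] (D : Derivation ℚ R R) (s : Finset ι)
    (f : ι → R) : D (∏ i ∈ s, f i) = ∑ t ∈ s, ∏ i ∈ s, Function.update f t (D (f t)) i := by
  induction s using Finset.induction_on with
  | empty => simp
  | insert a s ha ih =>
    rw [Finset.prod_insert ha, Derivation.leibniz, ih, Finset.sum_insert ha, Finset.prod_insert ha]
    have h1 : ∏ i ∈ s, Function.update f a (D (f a)) i = ∏ i ∈ s, f i :=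
      Finset.prod_congr rfl fun i hi => Function.update_of_ne (by rintro rfl; exact ha hi) _ _
    have h2 : ∀ t ∈ s, ∏ i ∈ insert a s, Function.update f t (D (f t)) i =
        f a * ∏ i ∈ s, Function.update f t (D (f t)) i := by
      intro t ht
      rw [Finset.prod_insert ha, Function.update_of_ne (show a ≠ t by rintro rfl; exact ha ht)]
    rw [Finset.sum_congr rfl h2, h1, ← Finset.mul_sum]
    simp only [smul_eq_mul, Function.update_self]
    ring

lemma deriv_det {R : Type*} [CommRing R] [Algebra ℚ R] (D : Derivation ℚ R R) (M : Matrix B B R) :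
    D M.det = ∑ t, (M.updateRow t (fun j => D (M t j))).det := by
  simp only [Matrix.det_apply]
  rw [map_sum, Finset.sum_comm]
  refine Finset.sum_congr rfl fun σ _ => ?_
  have h : ∀ x : R, D (Equiv.Perm.sign σ • x) = Equiv.Perm.sign σ • D x := by
    intro x
    rcases Int.units_eq_one_or (Equiv.Perm.sign σ) with h | h <;> simp [h]
  rw [h, deriv_prod, Finset.smul_sum]
  refine Fintype.sum_equiv σ _ _ fun t => ?_
  congr 1
  refine Finset.prod_congr rfl fun i _ => ?_
  by_cases hi : i = t
  · subst hi; simp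
  · rw [Function.update_of_ne hi, Matrix.updateRow_ne]
    exact fun h => hi (σ.injective h)

lemma DD_sch (κ : B → C) (δ : B → ℕ) (γ : B → ℤ) (c : C) (j : ℕ) :
    DD (c, j) (sch κ δ γ) =
      ∑ t, if κ t = c then sch κ δ (Function.update γ t (γ t - ((j : ℤ) + 1))) else 0 := by
  rw [sch, deriv_det]
  refine Finset.sum_congr rfl fun t _ => ?_
  have hrow : ∀ i, DD (c, j) (smat κ δ γ t i) = if κ t = c then smat κ δ (Function.update γ t (γ t - ((j : ℤ) + 1))) t i else 0 := by
    intro i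
    simp only [smat, Matrix.of_apply, Function.update_self]
    by_cases h : κ t = κ i
    · rw [if_pos h, DD_hz, h, if_pos rfl]
      split_ifs
      · congr 1; ring
      · rfl
    · simp [h]
  by_cases ht : κ t = c
  · rw [if_pos ht, sch]
    congr 1
    ext1 i k
    by_cases hi : i = t
    · subst hi
      rw [Matrix.updateRow_self, hrow, if_pos ht]
    · rw [Matrix.updateRow_ne hi]
      simp only [smat, Matrix.of_apply, Function.update_of_ne hi]
  · rw [if_neg ht]
    apply Matrix.det_eq_zero_of_row_eq_zero t
    intro k
    rw [Matrix.updateRow_self, hrow, if_neg ht]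

lemma sch_eq (κ : B → C) (δ : B → ℕ) (γ : B → ℤ) :
    sch κ δ γ = ∑ σ : Equiv.Perm B, ((Equiv.Perm.sign σ : ℤ)) •
      if (∀ i, κ (σ i) = κ i) then ∏ i, hz (κ i) (γ (σ i) - δ i) else 0 := by
  rw [sch, Matrix.det_apply]
  refine Finset.sum_congr rfl fun σ _ => ?_
  congr 1
  simp only [smat, Matrix.of_apply]
  split_ifs with h
  · exact Finset.prod_congr rfl fun i _ => if_pos (h i)
  · push Not at h
    obtain ⟨i, hi⟩ := h
    exact Finset.prod_eq_zero (Finset.mem_univ i) (if_neg hi)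

lemma Hom_zero (w : ℕ) : Hom (0 : Q C) w := MvPolynomial.isWeightedHomogeneous_zero ℚ _ _

lemma Hom_prod_hz {ι : Type*} (s : Finset ι) (κ : ι → C) (α : ι → ℤ) (w : ℕ) (h : ∑ i ∈ s, α i = w) :
    Hom (∏ i ∈ s, hz (κ i) (α i)) w := by
  by_cases hn : ∃ i ∈ s, α i < 0
  · obtain ⟨i, hi, h0⟩ := hn
    rw [Finset.prod_eq_zero hi (hz_neg _ h0)]
    exact Hom_zero w
  · push Not at hn
    have : w = ∑ i ∈ s, (α i).toNat := by
      zify; rw [← h]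
      exact Finset.sum_congr rfl fun i hi => by simp [hn i hi]
    rw [this]
    apply MvPolynomial.IsWeightedHomogeneous.prod
    intro i hi
    rw [hz, if_pos (hn i hi)]
    exact Hom_hp _ _

lemma Hom_sch (κ : B → C) (δ : B → ℕ) (γ : B → ℤ) (w : ℕ) (h : ∑ i, γ i = ∑ i, (δ i : ℤ) + w) :
    Hom (sch κ δ γ) w := by
  rw [sch_eq]
  refine Submodule.sum_mem (MvPolynomial.weightedHomogeneousSubmodule ℚ (wt C) w) fun σ _ => ?_
  refine zsmul_mem ?_ _
  split_ifs
  · apply Hom_prod_hz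
    rw [Finset.sum_sub_distrib, Equiv.sum_comp σ, h]; ring
  · exact Submodule.zero_mem _

/-- signed count of colour preserving permutations carrying `γ'` to `γ` -/
def FF (κ : B → C) (γ' γ : B → ℤ) : ℚ :=
  ∑ σ : Equiv.Perm B, if (∀ i, κ (σ i) = κ i) ∧ γ = γ' ∘ σ then ((Equiv.Perm.sign σ : ℤ) : ℚ) else 0

/-- the same with a positivity condition -/
def eps (κ : B → C) (γ γ' : B → ℤ) : ℚ := if ∀ i, 0 ≤ γ i then FF κ γ' γ else 0

lemma FF_comp (κ : B → C) (γ' γ : B → ℤ) (τ : Equiv.Perm B) (hτ : ∀ i, κ (τ i) = κ i) :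
    FF κ γ' (γ ∘ τ) = ((Equiv.Perm.sign τ : ℤ) : ℚ) * FF κ γ' γ := by
  unfold FF
  rw [Finset.mul_sum, ← Equiv.sum_comp (Equiv.mulRight τ)]
  refine Finset.sum_congr rfl fun σ _ => ?_
  have e : ((∀ i, κ ((Equiv.mulRight τ σ) i) = κ i) ∧ γ ∘ τ = γ' ∘ (Equiv.mulRight τ σ)) ↔
      ((∀ i, κ (σ i) = κ i) ∧ γ = γ' ∘ σ) := by
    simp only [Equiv.coe_mulRight, Equiv.Perm.mul_apply, Equiv.Perm.coe_mul]
    constructor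
    · rintro ⟨h1, h2⟩
      refine ⟨fun i => ?_, ?_⟩
      · have := h1 (τ.symm i)
        have h3 := hτ (τ.symm i)
        simp at this h3
        rw [this, ← h3]
      · funext i
        have := congrFun h2 (τ.symm i)
        simpa using this
    · rintro ⟨h1, h2⟩
      refine ⟨fun i => by rw [h1, hτ], ?_⟩
      rw [h2]; rfl
  simp only [e]
  split_ifs
  · simp [Equiv.Perm.sign_mul, mul_comm]
  · simp

lemma FF_symm (κ : B → C) (γ' γ : B → ℤ) : FF κ γ' γ = FF κ γ γ' := by
  unfold FF
  rw [← Equiv.sum_comp (Equiv.inv (Equiv.Perm B))]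
  refine Finset.sum_congr rfl fun σ _ => ?_
  have e : ((∀ i, κ ((Equiv.inv (Equiv.Perm B) σ) i) = κ i) ∧ γ = γ' ∘ (Equiv.inv (Equiv.Perm B) σ)) ↔
      ((∀ i, κ (σ i) = κ i) ∧ γ' = γ ∘ σ) := by
    simp only [Equiv.inv_apply]
    constructor
    · rintro ⟨h1, h2⟩
      exact ⟨fun i => by have := h1 (σ i); simpa using this.symm, by rw [h2]; funext i; simp⟩
    · rintro ⟨h1, h2⟩
      exact ⟨fun i => by have := h1 (σ⁻¹ i); simpa using this.symm, by rw [h2]; funext i; simp⟩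
  simp only [e]
  simp [Equiv.Perm.sign_inv]

lemma FF_eq_zero (κ : B → C) (γ' γ : B → ℤ) (s t : B) (hst : s ≠ t) (hκ : κ s = κ t) (h : γ s = γ t) :
    FF κ γ' γ = 0 := by
  have h1 := FF_comp κ γ' γ (Equiv.swap s t) (by
    intro i; rw [Equiv.swap_apply_def]; split_ifs with h1 h2
    · rw [h1, hκ]
    · rw [h2, hκ]
    · rfl)
  have h2 : γ ∘ (Equiv.swap s t) = γ := by
    funext i
    simp only [Function.comp, Equiv.swap_apply_def]
    split_ifs with h1 h2
    · rw [h1, h]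
    · rw [h2, h]
    · rfl
  rw [h2, Equiv.Perm.sign_swap hst] at h1
  push_cast at h1
  linarith

/-- vacuum configuration -/
structure Vac (κ : B → C) (δ : B → ℕ) : Prop where
  inj : ∀ s t, κ s = κ t → δ s = δ t → s = t
  cnt : ∀ t, δ t = (Finset.univ.filter fun s => κ s = κ t ∧ δ s < δ t).card

/-- ordered pairs of distinct elements of the same colour -/
def prs (κ : B → C) : Finset (B × B) := Finset.univ.filter fun x => x.1 ≠ x.2 ∧ κ x.1 = κ x.2

lemma two_count (κ : B → C) (γ : B → ℤ) (hinj : ∀ s t, κ s = κ t → γ s = γ t → s = t) :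
    2 * ∑ t, (Finset.univ.filter fun s => κ s = κ t ∧ γ s < γ t).card = (prs κ).card := by
  have e1 : ∑ t, (Finset.univ.filter fun s => κ s = κ t ∧ γ s < γ t).card =
      (Finset.univ.filter fun x : B × B => κ x.1 = κ x.2 ∧ γ x.1 < γ x.2).card := by
    simp only [Finset.card_filter]
    rw [← Finset.univ_product_univ, Finset.sum_product_right]
  have e2 : (Finset.univ.filter fun x : B × B => κ x.1 = κ x.2 ∧ γ x.1 < γ x.2).card =
      (Finset.univ.filter fun x : B × B => κ x.1 = κ x.2 ∧ γ x.2 < γ x.1).card := by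
    refine Finset.card_bij (fun x _ => x.swap) ?_ ?_ ?_
    · intro x; simp; intro h1 h2; exact ⟨h1.symm, h2⟩
    · intro x _ y _ h; exact Prod.swap_injective h
    · intro x hx; refine ⟨x.swap, ?_, by simp⟩
      simp at hx ⊢; exact ⟨hx.1.symm, hx.2⟩
  rw [two_mul]
  conv_lhs => rw [e1]; enter [2]; rw [e2]
  rw [← Finset.card_union_of_disjoint]
  · congr 1
    ext x
    simp only [prs, Finset.mem_union, Finset.mem_filter, Finset.mem_univ, true_and]
    constructor
    · rintro (⟨h1, h2⟩ | ⟨h1, h2⟩)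
      · exact ⟨fun h => by rw [h] at h2; omega, h1⟩
      · exact ⟨fun h => by rw [h] at h2; omega, h1⟩
    · rintro ⟨h1, h2⟩
      rcases lt_trichotomy (γ x.1) (γ x.2) with h | h | h
      · exact Or.inl ⟨h2, h⟩
      · exact absurd (hinj _ _ h2 h) h1
      · exact Or.inr ⟨h2, h⟩
  · rw [Finset.disjoint_left]
    intro x hx hx'
    simp at hx hx'
    omega

lemma Vac.two_sum {κ : B → C} {δ : B → ℕ} (hv : Vac κ δ) : 2 * ∑ t, δ t = (prs κ).card := by
  rw [← two_count κ (fun t => (δ t : ℤ)) (fun s t h1 h2 => hv.inj s t h1 (by exact_mod_cast h2))]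
  congr 1
  refine Finset.sum_congr rfl fun t _ => ?_
  conv_lhs => rw [hv.cnt t]
  simp

lemma cnt_le (κ : B → C) (γ : B → ℤ) (hinj : ∀ s t, κ s = κ t → γ s = γ t → s = t) (h0 : ∀ i, 0 ≤ γ i) (t : B) :
    ((Finset.univ.filter fun s => κ s = κ t ∧ γ s < γ t).card : ℤ) ≤ γ t := by
  have : (Finset.univ.filter fun s => κ s = κ t ∧ γ s < γ t).card ≤ (Finset.Ico 0 (γ t)).card := by
    apply Finset.card_le_card_of_injOn γ
    · intro s hs
      simp at hs ⊢
      exact ⟨h0 s, hs.2⟩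
    · intro s hs s' hs' h
      simp at hs hs'
      exact hinj _ _ (hs.1.trans hs'.1.symm) h
  rw [Int.card_Ico] at this
  have := h0 t
  omega

lemma FF_small {κ : B → C} {δ : B → ℕ} (hv : Vac κ δ) (γ' γ : B → ℤ) (h0 : ∀ i, 0 ≤ γ i)
    (hs : ∑ i, γ i < ∑ i, (δ i : ℤ)) : FF κ γ' γ = 0 := by
  by_cases hinj : ∀ s t, κ s = κ t → γ s = γ t → s = t
  · exfalso
    have h1 := two_count κ γ hinj
    have h2 := hv.two_sum
    have h3 := Finset.sum_le_sum fun t (_ : t ∈ Finset.univ) => cnt_le κ γ hinj h0 t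
    rw [← h2] at h1
    zify at h1
    linarith
  · push Not at hinj
    obtain ⟨s, t, h1, h2, h3⟩ := hinj
    exact FF_eq_zero κ γ' γ s t h3 h1 h2

lemma exists_perm {κ : B → C} {δ : B → ℕ} (hv : Vac κ δ) (γ : B → ℤ) (h0 : ∀ i, 0 ≤ γ i)
    (hinj : ∀ s t, κ s = κ t → γ s = γ t → s = t)
    (hs : ∑ i, γ i = ∑ i, (δ i : ℤ)) : ∃ σ : Equiv.Perm B, (∀ i, κ (σ i) = κ i) ∧ γ = (fun i => (δ i : ℤ)) ∘ σ := by
  have h1 := two_count κ γ hinj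
  have h2 := hv.two_sum
  rw [← h2] at h1
  zify at h1
  have h3 : ∀ t, ((Finset.univ.filter fun s => κ s = κ t ∧ γ s < γ t).card : ℤ) = γ t := by
    have := (Finset.sum_eq_sum_iff_of_le fun t (_ : t ∈ Finset.univ) => cnt_le κ γ hinj h0 t).1 (by linarith)
    intro t; exact this t (Finset.mem_univ _)
  have h4 : ∀ t, ∃ u, κ u = κ t ∧ (δ u : ℤ) = γ t := by
    intro t
    set cl := Finset.univ.filter fun s => κ s = κ t with hcl
    have hlt : γ t < cl.card := by
      rw [← h3 t]
      have : (Finset.univ.filter fun s => κ s = κ t ∧ γ s < γ t).card < cl.card := by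
        apply Finset.card_lt_card
        rw [Finset.ssubset_iff_of_subset]
        · exact ⟨t, by simp [hcl], by simp⟩
        · intro s; simp [hcl]; intro h _; exact h
      exact_mod_cast this
    have himg : cl.image δ = Finset.range cl.card := by
      apply Finset.eq_of_subset_of_card_le
      · intro x hx
        simp only [Finset.mem_image] at hx
        obtain ⟨s, hs, rfl⟩ := hx
        rw [Finset.mem_range, hv.cnt s]
        apply Finset.card_lt_card
        simp [hcl] at hs
        rw [Finset.ssubset_iff_of_subset]
        · exact ⟨s, by simp [hcl, hs], by simp⟩
        · intro s'; simp [hcl]; intro h _; exact h.trans hs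
      · rw [Finset.card_range, Finset.card_image_of_injOn]
        intro s hs s' hs' h
        simp [hcl] at hs hs'
        exact hv.inj _ _ (hs.trans hs'.symm) h
    have : (γ t).toNat ∈ cl.image δ := by
      rw [himg, Finset.mem_range]; have := h0 t; omega
    simp only [Finset.mem_image] at this
    obtain ⟨u, hu, hu'⟩ := this
    refine ⟨u, by simpa [hcl] using hu, ?_⟩
    have := h0 t; omega
  choose f hf1 hf2 using h4
  have hfi : Function.Injective f := by
    intro s t h
    apply hinj
    · rw [← hf1 s, ← hf1 t, h]
    · rw [← hf2 s, ← hf2 t, h]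
  refine ⟨Equiv.ofBijective f (Finite.injective_iff_bijective.1 hfi), hf1, ?_⟩
  funext t
  simp [hf2]

lemma FF_self {κ : B → C} {δ : B → ℕ} (hv : Vac κ δ) :
    FF κ (fun i => (δ i : ℤ)) (fun i => (δ i : ℤ)) = 1 := by
  unfold FF
  rw [Finset.sum_eq_single 1]
  · rw [if_pos ⟨fun _ => rfl, rfl⟩]; simp
  · intro σ _ hσ
    rw [if_neg]
    rintro ⟨h1, h2⟩
    apply hσ
    ext i
    have h3 := congrFun h2 i
    simp only [Function.comp] at h3
    exact (hv.inj _ _ (h1 i) (by exact_mod_cast h3.symm))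
  · simp

lemma sch_base (κ : B → C) (δ : B → ℕ) (γ : B → ℤ) (h : ∑ i, γ i = ∑ i, (δ i : ℤ)) :
    sch κ δ γ = MvPolynomial.C (FF κ γ (fun i => (δ i : ℤ))) := by
  rw [sch_eq, FF, map_sum]
  refine Finset.sum_congr rfl fun σ _ => ?_
  by_cases h1 : ∀ i, κ (σ i) = κ i
  · rw [if_pos h1]
    by_cases h2 : (fun i => (δ i : ℤ)) = γ ∘ σ
    · rw [if_pos ⟨h1, h2⟩]
      have : ∀ i, γ (σ i) - δ i = 0 := fun i => by
        have := congrFun h2 i; simp at this; omega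
      simp only [this, hz_zero, Finset.prod_const_one]
      simp
    · rw [if_neg (fun h => h2 h.2)]
      have : ∃ i, γ (σ i) - δ i < 0 := by
        by_contra hcon
        push Not at hcon
        apply h2
        have hsum : ∑ i, (γ (σ i) - δ i) = 0 := by
          rw [Finset.sum_sub_distrib, Equiv.sum_comp σ, h]; ring
        rw [Finset.sum_eq_zero_iff_of_nonneg (fun i _ => hcon i)] at hsum
        funext i
        have := hsum i (Finset.mem_univ i)
        simp; omega
      obtain ⟨i, hi⟩ := this
      rw [Finset.prod_eq_zero (Finset.mem_univ i) (hz_neg _ hi)]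
      simp
  · rw [if_neg h1, if_neg (fun h => h1 h.1)]; simp

lemma ip_C (a b : ℚ) : ip (MvPolynomial.C a : Q C) (MvPolynomial.C b) = a * b := by
  rw [← MvPolynomial.monomial_zero' , ip_monomial]; simp [zz]

lemma ip_base {κ : B → C} {δ : B → ℕ} (hv : Vac κ δ) (γ γ' : B → ℤ) (h : ∑ i, γ i = ∑ i, (δ i : ℤ))
    (h' : ∑ i, γ' i = ∑ i, (δ i : ℤ)) : ip (sch κ δ γ) (sch κ δ γ') = eps κ γ γ' := by
  rw [sch_base κ δ γ h, sch_base κ δ γ' h', ip_C]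
  by_cases hc : ∃ σ : Equiv.Perm B, (∀ i, κ (σ i) = κ i) ∧ γ = (fun i => (δ i : ℤ)) ∘ σ
  · obtain ⟨σ, h1, rfl⟩ := hc
    rw [eps, if_pos (fun i => by simp), FF_comp _ _ _ _ h1, FF_symm, FF_comp _ _ _ _ h1, FF_self hv, mul_one]
  · have e1 : FF κ γ (fun i => (δ i : ℤ)) = 0 := by
      rw [FF_symm]
      apply Finset.sum_eq_zero
      intro σ _
      rw [if_neg (fun hσ => hc ⟨σ, hσ⟩)]
    rw [e1, zero_mul, eps]
    split_ifs with h0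
    · by_cases hinj : ∀ s t, κ s = κ t → γ s = γ t → s = t
      · exact absurd (exists_perm hv γ h0 hinj h) hc
      · push Not at hinj
        obtain ⟨s, t, h1, h2, h3⟩ := hinj
        exact (FF_eq_zero κ γ' γ s t h3 h1 h2).symm
    · rfl

end
end CBI

namespace CBI

section
variable {B C : Type*} [Fintype B] [DecidableEq B] [DecidableEq C]

lemma FF_shift (κ : B → C) (γ' γ : B → ℤ) (t : B) (J : ℤ) :
    ∑ t', (if κ t = κ t' then FF κ (γ' - Pi.single t' J) γ else 0) =
      ∑ s, (if κ t = κ s then FF κ γ' (γ + Pi.single s J) else 0) := by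
  have e1 : ∀ (P : B → Prop) [DecidablePred P] (f : B → Equiv.Perm B → ℚ), ∑ t', (if P t' then ∑ σ, f t' σ else 0) =
      ∑ σ, ∑ t', if P t' then f t' σ else 0 := by
    intro P _ f
    rw [Finset.sum_comm]
    refine Finset.sum_congr rfl fun x _ => ?_
    split_ifs <;> simp
  unfold FF
  rw [e1, e1]
  refine Finset.sum_congr rfl fun σ _ => ?_
  refine (Fintype.sum_equiv σ _ _ fun s => ?_).symm
  by_cases hσ : ∀ i, κ (σ i) = κ i
  · have e2 : (γ + Pi.single s J = γ' ∘ σ) ↔ (γ = (γ' - Pi.single (σ s) J) ∘ σ) := by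
      have : (γ' - Pi.single (σ s) J) ∘ σ = γ' ∘ σ - Pi.single s J := by
        funext i
        simp [Pi.single_apply]
      rw [this, eq_sub_iff_add_eq]
    simp only [hσ s, hσ, e2]
  · simp [hσ]

lemma FF_pair (κ : B → C) (γ' γ : B → ℤ) (t s : B) (hts : t ≠ s) (hκ : κ t = κ s) (a b : ℕ)
    (ha : γ t = a) (hb : γ s = b) :
    (∑ j ∈ Finset.range a, FF κ γ' (γ - Pi.single t ((j : ℤ) + 1) + Pi.single s ((j : ℤ) + 1))) +
    (∑ j ∈ Finset.range b, FF κ γ' (γ - Pi.single s ((j : ℤ) + 1) + Pi.single t ((j : ℤ) + 1))) = - FF κ γ' γ := by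
  set G : ℤ → ℚ := fun x => FF κ γ' (γ + Pi.single s x - Pi.single t x) with hG
  have anti : ∀ x, G ((a : ℤ) - b - x) = - G x := by
    intro x
    have h1 := FF_comp κ γ' (γ + Pi.single s x - Pi.single t x) (Equiv.swap t s) (by
      intro i; rw [Equiv.swap_apply_def]; split_ifs with h1 h2
      · rw [h1, hκ]
      · rw [h2, hκ]
      · rfl)
    have h2 : (γ + Pi.single s x - Pi.single t x) ∘ (Equiv.swap t s) =
        γ + Pi.single s ((a : ℤ) - b - x) - Pi.single t ((a : ℤ) - b - x) := by
      funext i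
      simp only [Function.comp, Equiv.swap_apply_def]
      split_ifs with h1 h2
      · subst h1; simp [hts, hts.symm, ha, hb]; ring
      · subst h2; simp [hts, hts.symm, ha, hb]; ring
      · simp [h1, h2]
    rw [h2, Equiv.Perm.sign_swap hts] at h1
    push_cast at h1
    simp only [hG]
    linarith
  have tot : ∑ i ∈ Finset.range (b + (a + 1)), G ((i : ℤ) - b) = 0 := by
    have h1 := Finset.sum_range_reflect (fun i : ℕ => G ((i : ℤ) - b)) (b + (a + 1))
    have h2 : ∑ i ∈ Finset.range (b + (a + 1)), G (((b + (a + 1) - 1 - i : ℕ) : ℤ) - b) =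
        - ∑ i ∈ Finset.range (b + (a + 1)), G ((i : ℤ) - b) := by
      rw [← Finset.sum_neg_distrib]
      refine Finset.sum_congr rfl fun i hi => ?_
      rw [← anti]
      congr 1
      have : i < b + (a + 1) := by simpa using hi
      omega
    rw [h2] at h1
    linarith
  rw [Finset.sum_range_add, Finset.sum_range_succ'] at tot
  rw [← Finset.sum_range_reflect (fun i : ℕ => G ((i : ℤ) - b))] at tot
  have e1 : ∑ j ∈ Finset.range a, FF κ γ' (γ - Pi.single t ((j : ℤ) + 1) + Pi.single s ((j : ℤ) + 1)) =
      ∑ k ∈ Finset.range a, G (((b + (k + 1) : ℕ) : ℤ) - b) := by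
    refine Finset.sum_congr rfl fun j _ => ?_
    simp only [hG]
    have : (((b + (j + 1) : ℕ) : ℤ) - b) = (j : ℤ) + 1 := by push_cast; ring
    rw [this]; congr 1; abel
  have e2 : ∑ j ∈ Finset.range b, FF κ γ' (γ - Pi.single s ((j : ℤ) + 1) + Pi.single t ((j : ℤ) + 1)) =
      ∑ k ∈ Finset.range b, G (((b - 1 - k : ℕ) : ℤ) - b) := by
    refine Finset.sum_congr rfl fun j hj => ?_
    simp only [hG]
    have : j < b := by simpa using hj
    have : (((b - 1 - j : ℕ) : ℤ) - b) = - ((j : ℤ) + 1) := by omega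
    rw [this, Pi.single_neg, Pi.single_neg]; congr 1; abel
  have e3 : G (((b + 0 : ℕ) : ℤ) - b) = FF κ γ' γ := by
    simp [hG]
  rw [e1, e2, ← e3]
  linarith

lemma comb {κ : B → C} {δ : B → ℕ} (hv : Vac κ δ) (γ γ' : B → ℤ) (w : ℕ)
    (hγ : ∑ i, γ i = ∑ i, (δ i : ℤ) + w) :
    ∑ j ∈ Finset.range w, ∑ t, ∑ t', (if κ t = κ t' then
      eps κ (γ - Pi.single t ((j : ℤ) + 1)) (γ' - Pi.single t' ((j : ℤ) + 1)) else 0) = w * eps κ γ γ' := by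
  by_cases h0 : ∀ i, 0 ≤ γ i
  swap
  · rw [eps, if_neg h0, mul_zero]
    refine Finset.sum_eq_zero fun j _ => Finset.sum_eq_zero fun t _ => Finset.sum_eq_zero fun t' _ => ?_
    have hn : ¬ ∀ i, 0 ≤ (γ - Pi.single t ((j : ℤ) + 1) : B → ℤ) i := ?_
    · rw [eps, if_neg hn, ite_self]
    intro h
    apply h0
    intro i
    have := h i
    by_cases hi : i = t
    · subst hi; simp at this; omega
    · simpa [hi] using this
  have hK : ∀ t, γ t ≤ ((∑ i, δ i + w : ℕ) : ℤ) := by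
    intro t
    push_cast; rw [← hγ]
    exact Finset.single_le_sum (f := γ) (fun i _ => h0 i) (Finset.mem_univ t)
  set K := ∑ i, δ i + w with hKdef
  have e0 : ∑ j ∈ Finset.range w, ∑ t, ∑ t', (if κ t = κ t' then
      eps κ (γ - Pi.single t ((j : ℤ) + 1)) (γ' - Pi.single t' ((j : ℤ) + 1)) else 0) =
      ∑ j ∈ Finset.range K, ∑ t, ∑ t', (if κ t = κ t' then
      eps κ (γ - Pi.single t ((j : ℤ) + 1)) (γ' - Pi.single t' ((j : ℤ) + 1)) else 0) := by
    apply Finset.sum_subset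
    · intro j; simp; omega
    · intro j _ hj
      simp at hj
      refine Finset.sum_eq_zero fun t _ => Finset.sum_eq_zero fun t' _ => ?_
      rw [eps]
      split_ifs with h1 h2
      · apply FF_small hv _ _ h2
        simp only [Pi.sub_apply, Finset.sum_sub_distrib, Finset.sum_pi_single', hγ]
        simp; omega
      · rfl
      · rfl
  rw [e0]
  have e1 : ∀ (j : ℕ) (t : B), ∑ t', (if κ t = κ t' then
      eps κ (γ - Pi.single t ((j : ℤ) + 1)) (γ' - Pi.single t' ((j : ℤ) + 1)) else 0) =
      ∑ s, if κ t = κ s then (if (j : ℤ) + 1 ≤ γ t then FF κ γ' (γ - Pi.single t ((j : ℤ) + 1) + Pi.single s ((j : ℤ) + 1)) else 0) else 0 := by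
    intro j t
    have hiff : (∀ i, 0 ≤ (γ - Pi.single t ((j : ℤ) + 1) : B → ℤ) i) ↔ (j : ℤ) + 1 ≤ γ t := by
      constructor
      · intro h; have := h t; simp at this; omega
      · intro h i
        by_cases hi : i = t
        · subst hi; simp; omega
        · simpa [hi] using h0 i
    simp only [eps, hiff]
    by_cases h : (j : ℤ) + 1 ≤ γ t
    · simp only [h, if_true]
      exact FF_shift κ γ' _ t _
    · simp only [h, if_false, ite_self]
  simp only [e1]
  set A : B → B → ℚ := fun t s => ∑ j ∈ Finset.range (γ t).toNat, FF κ γ' (γ - Pi.single t ((j : ℤ) + 1) + Pi.single s ((j : ℤ) + 1)) with hA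
  have e2 : ∑ j ∈ Finset.range K, ∑ t, ∑ s, (if κ t = κ s then (if (j : ℤ) + 1 ≤ γ t then FF κ γ' (γ - Pi.single t ((j : ℤ) + 1) + Pi.single s ((j : ℤ) + 1)) else 0) else 0) =
      ∑ t, ∑ s, if κ t = κ s then A t s else 0 := by
    rw [Finset.sum_comm]
    refine Finset.sum_congr rfl fun t _ => ?_
    rw [Finset.sum_comm]
    refine Finset.sum_congr rfl fun s _ => ?_
    by_cases h : κ t = κ s
    · simp only [h, if_true]
      rw [hA]
      simp only
      rw [← Finset.sum_filter]
      refine Finset.sum_congr ?_ fun _ _ => rfl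
      ext j
      have := hK t
      have := h0 t
      simp only [Finset.mem_filter, Finset.mem_range]
      omega
    · simp only [h, if_false, Finset.sum_const_zero]
  rw [e2, eps, if_pos h0]
  have e3 : ∑ t, ∑ s, (if κ t = κ s then A t s else 0) = ∑ t, A t t + ∑ x ∈ prs κ, A x.1 x.2 := by
    rw [prs, Finset.sum_filter, ← Finset.univ_product_univ, Finset.sum_product, ← Finset.sum_add_distrib]
    refine Finset.sum_congr rfl fun t _ => ?_
    rw [← Finset.add_sum_erase _ _ (Finset.mem_univ t), if_pos rfl]
    congr 1
    rw [← Finset.add_sum_erase _ _ (Finset.mem_univ t), if_neg (by simp), zero_add]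
    refine Finset.sum_congr rfl fun s hs => ?_
    have : t ≠ s := by simp at hs; exact fun h => hs h.symm
    simp [this]
  have e4 : ∑ t, A t t = ((∑ i, γ i : ℤ) : ℚ) * FF κ γ' γ := by
    push_cast
    rw [Finset.sum_mul]
    refine Finset.sum_congr rfl fun t _ => ?_
    simp only [hA, sub_add_cancel, Finset.sum_const, Finset.card_range, nsmul_eq_mul]
    congr 1
    have : ((γ t).toNat : ℤ) = γ t := by have := h0 t; omega
    exact_mod_cast congrArg (fun z : ℤ => (z : ℚ)) this
  have e5 : ∑ x ∈ prs κ, A x.1 x.2 = ∑ x ∈ prs κ, A x.2 x.1 := by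
    refine Finset.sum_nbij' Prod.swap Prod.swap ?_ ?_ ?_ ?_ ?_
    · intro x; simp [prs]; intro h1 h2; exact ⟨fun h => h1 h.symm, h2.symm⟩
    · intro x; simp [prs]; intro h1 h2; exact ⟨fun h => h1 h.symm, h2.symm⟩
    · intro x _; simp
    · intro x _; simp
    · intro x _; rfl
  have e6 : ∑ x ∈ prs κ, A x.1 x.2 + ∑ x ∈ prs κ, A x.2 x.1 = - ((prs κ).card : ℚ) * FF κ γ' γ := by
    rw [← Finset.sum_add_distrib, Finset.sum_congr rfl (g := fun _ => - FF κ γ' γ)]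
    · rw [Finset.sum_const, nsmul_eq_mul]; ring
    · intro x hx
      simp [prs] at hx
      exact FF_pair κ γ' γ x.1 x.2 hx.1 hx.2 _ _ (by have := h0 x.1; omega) (by have := h0 x.2; omega)
  have e7 := hv.two_sum
  rw [← e7, ← e5] at e6
  rw [e3, e4, hγ]
  push_cast at e6 ⊢
  linarith

lemma update_eq (γ : B → ℤ) (t : B) (J : ℤ) : Function.update γ t (γ t - J) = γ - Pi.single t J := by
  funext i
  by_cases hi : i = t
  · subst hi; simp
  · simp [hi]

theorem ip_sch [Fintype C] {κ : B → C} {δ : B → ℕ} (hv : Vac κ δ) (w : ℕ) : ∀ (γ γ' : B → ℤ)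
    (_ : ∑ i, γ i = ∑ i, (δ i : ℤ) + w) (_ : ∑ i, γ' i = ∑ i, (δ i : ℤ) + w),
    ip (sch κ δ γ) (sch κ δ γ') = eps κ γ γ' := by
  induction w using Nat.strong_induction_on with
  | _ w ih =>
    intro γ γ' h h'
    rcases Nat.eq_zero_or_pos w with rfl | hw
    · exact ip_base hv γ γ' (by simpa using h) (by simpa using h')
    have h1 := euler_ip (sch κ δ γ) (sch κ δ γ') w (Hom_sch κ δ γ w h)
    have h2 := comb hv γ γ' w h
    have h3 : ∑ c : C, ∑ j ∈ Finset.range w, ip (DD (c, j) (sch κ δ γ)) (DD (c, j) (sch κ δ γ')) =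
        ∑ j ∈ Finset.range w, ∑ t, ∑ t', (if κ t = κ t' then
      eps κ (γ - Pi.single t ((j : ℤ) + 1)) (γ' - Pi.single t' ((j : ℤ) + 1)) else 0) := by
      rw [Finset.sum_comm]
      refine Finset.sum_congr rfl fun j hj => ?_
      have hj' : j < w := by simpa using hj
      simp only [DD_sch, map_sum, LinearMap.sum_apply]
      have hc : ∀ c : C, ∑ x, ∑ x', ip (if κ x' = c then sch κ δ (Function.update γ x' (γ x' - ((j:ℤ) + 1))) else 0)
          (if κ x = c then sch κ δ (Function.update γ' x (γ' x - ((j:ℤ) + 1))) else 0) =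
          ∑ t, ∑ t', if κ t = c then (if κ t = κ t' then
      eps κ (γ - Pi.single t ((j : ℤ) + 1)) (γ' - Pi.single t' ((j : ℤ) + 1)) else 0) else 0 := by
        intro c
        rw [Finset.sum_comm]
        refine Finset.sum_congr rfl fun t _ => Finset.sum_congr rfl fun t' _ => ?_
        by_cases ht : κ t = c
        · by_cases ht' : κ t' = c
          · simp only [ht, ht', if_true, update_eq]
            apply ih (w - (j + 1)) (by omega)
            · simp only [Pi.sub_apply, Finset.sum_sub_distrib, h]
              simp; omega
            · simp only [Pi.sub_apply, Finset.sum_sub_distrib, h']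
              simp; omega
          · have : c ≠ κ t' := fun e => ht' e.symm
            simp [ht, ht', this]
        · simp [ht]
      rw [Finset.sum_congr rfl fun c _ => hc c, Finset.sum_comm]
      refine Finset.sum_congr rfl fun t _ => ?_
      rw [Finset.sum_comm]
      refine Finset.sum_congr rfl fun t' _ => ?_
      simp
    rw [h3, h2] at h1
    have : (w : ℚ) ≠ 0 := by positivity
    exact mul_left_cancel₀ this h1

end
end CBI

namespace CBI

lemma fs_ind {σ : Type*} {P : (σ →₀ ℕ) → Prop} (h0 : P 0)
    (h1 : ∀ α i, P α → P (α + Finsupp.single i 1)) : ∀ α, P α := by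
  intro α
  have : ∀ m : Multiset σ, P (Multiset.toFinsupp m) := by
    intro m
    induction m using Multiset.induction with
    | empty => simpa using h0
    | cons a m ih =>
      rw [← Multiset.singleton_add, map_add, add_comm, Multiset.toFinsupp_singleton]
      exact h1 _ _ ih
  have h2 := this (Finsupp.toMultiset α)
  simpa using h2

/-- lattice spanned by Schur functions -/
def SL {B C : Type*} [Fintype B] [DecidableEq B] [DecidableEq C] (κ : B → C) (δ : B → ℕ) (w : ℕ) : Submodule ℤ (Q C) :=
  Submodule.span ℤ {f | ∃ γ : B → ℤ, ∑ i, γ i = ∑ i, (δ i : ℤ) + w ∧ f = sch κ δ γ}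

/-- lattice spanned by products of complete functions -/
def HL {B C : Type*} [Fintype B] (κ : B → C) (w : ℕ) : Submodule ℤ (Q C) :=
  Submodule.span ℤ {f | ∃ α : B → ℤ, ∑ i, α i = w ∧ f = ∏ i, hz (κ i) (α i)}

section
variable {B C : Type*} [Fintype B] [DecidableEq B] [DecidableEq C]

lemma SL_le_HL (κ : B → C) (δ : B → ℕ) (w : ℕ) : SL κ δ w ≤ HL κ w := by
  rw [SL, Submodule.span_le]
  rintro f ⟨γ, h, rfl⟩
  rw [sch_eq]
  refine Submodule.sum_mem _ fun σ _ => Submodule.smul_mem _ _ ?_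
  split_ifs
  · refine Submodule.subset_span ⟨fun i => γ (σ i) - δ i, ?_, rfl⟩
    rw [Finset.sum_sub_distrib, Equiv.sum_comp σ, h]; ring
  · exact Submodule.zero_mem _

lemma HL_le_SL {κ : B → C} {δ : B → ℕ} (hv : Vac κ δ) (w : ℕ) : HL κ w ≤ SL κ δ w := by
  have key : ∀ (n : ℕ) (α : B → ℤ), ∑ i, α i = w → (w : ℤ)^2 - ∑ i, (α i)^2 < n →
      ∏ i, hz (κ i) (α i) ∈ SL κ δ w := by
    intro n
    induction n with
    | zero =>
      intro α h h'
      by_cases hn : ∀ i, 0 ≤ α i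
      · exfalso
        have : ∑ i, (α i)^2 ≤ (∑ i, α i)^2 := Finset.sum_sq_le_sq_sum_of_nonneg fun i _ => hn i
        rw [h] at this
        push_cast at h'
        linarith
      · push Not at hn
        obtain ⟨i, hi⟩ := hn
        rw [Finset.prod_eq_zero (Finset.mem_univ i) (hz_neg _ hi)]
        exact Submodule.zero_mem _
    | succ n ih =>
      intro α0 h0 h0'
      -- choose a rearrangement
      set CP := (Finset.univ.filter fun σ : Equiv.Perm B => ∀ i, κ (σ i) = κ i) with hCP
      have hne : CP.Nonempty := ⟨1, by simp [hCP]⟩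
      obtain ⟨τ, hτ, hmax⟩ := Finset.exists_max_image CP (fun σ => ∑ i, α0 (σ i) * (δ i : ℤ)) hne
      simp only [hCP, Finset.mem_filter, Finset.mem_univ, true_and] at hτ
      set α : B → ℤ := fun i => α0 (τ i) with hα
      have hsum : ∑ i, α i = w := by rw [← h0]; exact Equiv.sum_comp τ α0
      have hsq : ∑ i, (α i)^2 = ∑ i, (α0 i)^2 := Equiv.sum_comp τ (fun i => (α0 i)^2)
      have hprod : ∏ i, hz (κ i) (α0 i) = ∏ i, hz (κ i) (α i) := by
        rw [← Equiv.prod_comp τ (fun i => hz (κ i) (α0 i))]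
        exact Finset.prod_congr rfl fun i _ => by rw [hτ]
      have hmax' : ∀ σ : Equiv.Perm B, (∀ i, κ (σ i) = κ i) → ∑ i, α (σ i) * (δ i : ℤ) ≤ ∑ i, α i * (δ i : ℤ) := by
        intro σ hσ
        exact hmax (τ * σ) (by simp [hCP]; intro i; rw [hτ, hσ])
      rw [hprod]
      have hs : sch κ δ (fun i => α i + δ i) ∈ SL κ δ w := by
        refine Submodule.subset_span ⟨_, ?_, rfl⟩
        rw [Finset.sum_add_distrib, hsum]; ring
      rw [sch_eq, ← Finset.add_sum_erase _ _ (Finset.mem_univ 1)] at hs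
      have h1 : ∑ x ∈ Finset.univ.erase 1, ((Equiv.Perm.sign x : ℤ)) •
          (if ∀ i, κ (x i) = κ i then ∏ i, hz (κ i) (α (x i) + δ (x i) - δ i) else 0) ∈ SL κ δ w := by
        refine Submodule.sum_mem _ fun σ hσ => Submodule.smul_mem _ _ ?_
        have hσ1 : σ ≠ 1 := by simpa using hσ
        split_ifs with hκ
        · refine ih _ ?_ ?_
          · rw [Finset.sum_sub_distrib, Finset.sum_add_distrib, Equiv.sum_comp σ α, Equiv.sum_comp σ (fun i => (δ i : ℤ)), hsum]; ring
          · have e1 : ∑ i, (α (σ i) + δ (σ i) - δ i)^2 = ∑ i, (α i)^2 + 2 * (∑ i, α i * (δ i : ℤ) - ∑ i, α (σ i) * (δ i : ℤ)) + ∑ i, ((δ (σ i) : ℤ) - δ i)^2 := by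
              rw [← Equiv.sum_comp σ (fun i => (α i)^2), ← Equiv.sum_comp σ (fun i => α i * (δ i : ℤ)), ← Finset.sum_sub_distrib,
                Finset.mul_sum, ← Finset.sum_add_distrib, ← Finset.sum_add_distrib]
              refine Finset.sum_congr rfl fun i _ => ?_
              ring
            have e2 := hmax' σ hκ
            have e3 : 0 < ∑ i, ((δ (σ i) : ℤ) - δ i)^2 := by
              by_contra hcon
              have hz0 : ∑ i, ((δ (σ i) : ℤ) - δ i)^2 = 0 := le_antisymm (not_lt.1 hcon) (Finset.sum_nonneg fun i _ => sq_nonneg _)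
              rw [Finset.sum_eq_zero_iff_of_nonneg (fun i _ => sq_nonneg _)] at hz0
              apply hσ1
              ext i
              have := hz0 i (Finset.mem_univ i)
              have h3 : (δ (σ i) : ℤ) = δ i := by
                have := pow_eq_zero_iff (two_ne_zero) |>.1 this
                linarith
              exact hv.inj _ _ (hκ i) (by exact_mod_cast h3)
            rw [e1, hsq]
            push_cast at h0'
            linarith
        · exact Submodule.zero_mem _
      have h2 := (Submodule.add_mem_iff_left _ h1).1 hs
      simpa using h2
  rw [HL, Submodule.span_le]
  rintro f ⟨α, h, rfl⟩
  obtain ⟨n, hn⟩ := exists_nat_gt ((w : ℤ)^2 - ∑ i, (α i)^2)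
  exact key n α h (by exact_mod_cast hn)

end

section
variable {C : Type*}

/-- monomials in the complete functions -/
def hmon (α : C × ℕ →₀ ℕ) : Q C := α.prod fun i m => (hp i.1 (i.2 + 1)) ^ m

/-- weight -/
abbrev wgt (α : C × ℕ →₀ ℕ) : ℕ := Finsupp.weight (wt C) α

lemma wgt_add (α β : C × ℕ →₀ ℕ) : wgt (α + β) = wgt α + wgt β := map_add _ _ _

lemma wgt_single (i : C × ℕ) (m : ℕ) : wgt (Finsupp.single i m) = m * (i.2 + 1) := by
  simp [wgt, Finsupp.weight_single, wt]

lemma wgt_zero : wgt (0 : C × ℕ →₀ ℕ) = 0 := map_zero _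

lemma hmon_add [DecidableEq C] (α β : C × ℕ →₀ ℕ) : hmon (α + β) = hmon α * hmon β :=
  Finsupp.prod_add_index' (by simp) (by intros; rw [pow_add])

lemma hmon_single (i : C × ℕ) (m : ℕ) : hmon (Finsupp.single i m) = (hp i.1 (i.2 + 1)) ^ m :=
  Finsupp.prod_single_index (by simp)

lemma hmon_zero : hmon (0 : C × ℕ →₀ ℕ) = 1 := Finsupp.prod_zero_index

/-- lattice spanned by monomials in complete functions -/
def HML (C : Type*) (w : ℕ) : Submodule ℤ (Q C) :=
  Submodule.span ℤ {f | ∃ α : C × ℕ →₀ ℕ, wgt α = w ∧ f = hmon α}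

/-- evaluation map -/
def Th (C : Type*) : MvPolynomial (C × ℕ) ℤ →ₐ[ℤ] Q C := MvPolynomial.aeval fun i => hp i.1 (i.2 + 1)

lemma Th_monomial (α : C × ℕ →₀ ℕ) (a : ℤ) : Th C (MvPolynomial.monomial α a) = a • hmon α := by
  rw [Th, MvPolynomial.aeval_monomial, hmon, Algebra.smul_def]

/-- integral subring -/
def IntS (C : Type*) : Subring (Q C) := (Th C).toRingHom.range

lemma hp_mem (c : C) (n : ℕ) : hp c n ∈ IntS C := by
  cases n with
  | zero => rw [hp, hh_zero]; exact (IntS C).one_mem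
  | succ n => exact ⟨MvPolynomial.X (c, n), by simp [Th]⟩

lemma hmon_mem (α : C × ℕ →₀ ℕ) : hmon α ∈ IntS C := by
  refine Subring.prod_mem _ fun i _ => ?_
  exact Subring.pow_mem _ (hp_mem _ _) _

lemma Hom_hmon (α : C × ℕ →₀ ℕ) : Hom (hmon α) (wgt α) := by
  induction α using fs_ind with
  | h0 => rw [hmon_zero, wgt_zero]; exact MvPolynomial.isWeightedHomogeneous_one ℚ _
  | h1 α i ih =>
    rw [hmon_add, wgt_add, hmon_single, wgt_single, pow_one, one_mul]
    exact ih.mul (Hom_hp _ _)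

lemma HML_le (w : ℕ) : ∀ f ∈ HML C w, f ∈ IntS C := by
  intro f hf
  have : HML C w ≤ (IntS C).toAddSubgroup.toIntSubmodule := by
    rw [HML, Submodule.span_le]
    rintro f ⟨α, _, rfl⟩
    exact hmon_mem α
  exact this hf

lemma HML_hom (w : ℕ) : ∀ f ∈ HML C w, Hom f w := by
  intro f hf
  have : HML C w ≤ (MvPolynomial.weightedHomogeneousSubmodule ℚ (wt C) w).toAddSubgroup.toIntSubmodule := by
    rw [HML, Submodule.span_le]
    rintro f ⟨α, rfl, rfl⟩
    exact Hom_hmon α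
  exact this hf

lemma mem_HML (w : ℕ) (f : Q C) (hf : f ∈ IntS C) (hw : Hom f w) : f ∈ HML C w := by
  obtain ⟨F, rfl⟩ := hf
  have h1 : ∀ α ∈ F.support, MvPolynomial.weightedHomogeneousComponent (wt C) w (Th C (MvPolynomial.monomial α (F.coeff α))) ∈ HML C w := by
    intro α _
    rw [Th_monomial, map_zsmul]
    refine Submodule.smul_mem _ _ ?_
    by_cases h : wgt α = w
    · subst h
      rw [MvPolynomial.weightedHomogeneousComponent_of_mem (Hom_hmon α), if_pos rfl]
      exact Submodule.subset_span ⟨α, rfl, rfl⟩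
    · rw [MvPolynomial.weightedHomogeneousComponent_of_mem (Hom_hmon α), if_neg (fun e => h e.symm)]
      exact Submodule.zero_mem _
  have h2 : MvPolynomial.weightedHomogeneousComponent (wt C) w (Th C F) = Th C F := by
    have := MvPolynomial.weightedHomogeneousComponent_of_mem (m := w) (n := w) hw
    rw [if_pos rfl] at this
    exact this
  change Th C F ∈ _
  rw [← h2]
  rw [MvPolynomial.as_sum F, map_sum, map_sum]
  exact Submodule.sum_mem _ h1

lemma HL_le_HML {B : Type*} [Fintype B] [DecidableEq C] (κ : B → C) (w : ℕ) : HL κ w ≤ HML C w := by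
  rw [HL, Submodule.span_le]
  rintro f ⟨α, h, rfl⟩
  refine mem_HML w _ (Subring.prod_mem _ fun i _ => ?_) (Hom_prod_hz _ _ _ _ h)
  rw [hz]; split_ifs
  · exact hp_mem _ _
  · exact Subring.zero_mem _

lemma HML_le_HL {B : Type*} [Fintype B] [DecidableEq B] [DecidableEq C] (κ : B → C) (w : ℕ)
    (hN : ∀ c, w ≤ (Finset.univ.filter fun t => κ t = c).card) : HML C w ≤ HL κ w := by
  have key : ∀ α : C × ℕ →₀ ℕ, wgt α ≤ w → ∃ a : B → ℕ, hmon α = ∏ t, hp (κ t) (a t) ∧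
      ∑ t, a t = wgt α ∧ (Finset.univ.filter fun t => a t ≠ 0).card ≤ wgt α := by
    intro α
    induction α using fs_ind with
    | h0 =>
      intro _
      exact ⟨0, by simp [hmon_zero, hp, hh_zero], by simp, by simp⟩
    | h1 α i ih =>
      intro hw
      rw [wgt_add, wgt_single] at hw
      obtain ⟨a, h1, h2, h3⟩ := ih (by omega)
      have : ∃ t, κ t = i.1 ∧ a t = 0 := by
        by_contra hcon
        push Not at hcon
        have : (Finset.univ.filter fun t => κ t = i.1).card ≤ (Finset.univ.filter fun t => a t ≠ 0).card := by
          apply Finset.card_le_card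
          intro t; simp; exact hcon t
        have := hN i.1
        omega
      obtain ⟨t, ht, ht0⟩ := this
      refine ⟨Function.update a t (i.2 + 1), ?_, ?_, ?_⟩
      · rw [hmon_add, hmon_single, pow_one, h1, ← Finset.mul_prod_erase _ _ (Finset.mem_univ t),
          ← Finset.mul_prod_erase _ _ (Finset.mem_univ t), Function.update_self, ht, ht0]
        rw [Finset.prod_congr rfl (g := fun x => hp (κ x) (Function.update a t (i.2+1) x))]
        · simp [hp, hh_zero]; ring
        · intro x hx
          rw [Function.update_of_ne (by simpa using hx)]
      · rw [Finset.sum_update_of_mem (Finset.mem_univ t), wgt_add, wgt_single, ← h2,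
          ← Finset.add_sum_erase _ _ (Finset.mem_univ t), ht0, Finset.sdiff_singleton_eq_erase]
        ring
      · rw [wgt_add, wgt_single]
        have : (Finset.univ.filter fun x => Function.update a t (i.2+1) x ≠ 0) ⊆ insert t (Finset.univ.filter fun t => a t ≠ 0) := by
          intro x; simp only [Finset.mem_filter, Finset.mem_univ, true_and, Finset.mem_insert]
          intro hx
          by_cases hxt : x = t
          · exact Or.inl hxt
          · right; rwa [Function.update_of_ne hxt] at hx
        have := (Finset.card_le_card this).trans (Finset.card_insert_le _ _)
        omega
  rw [HML, Submodule.span_le]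
  rintro f ⟨α, h, rfl⟩
  obtain ⟨a, h1, h2, _⟩ := key α h.le
  refine Submodule.subset_span ⟨fun t => (a t : ℤ), ?_, ?_⟩
  · rw [← h, ← h2]; push_cast; rfl
  · rw [h1]; exact Finset.prod_congr rfl fun t _ => (hz_nat _ _).symm

lemma SL_eq_HML {B : Type*} [Fintype B] [DecidableEq B] [DecidableEq C] {κ : B → C} {δ : B → ℕ} (hv : Vac κ δ) (w : ℕ)
    (hN : ∀ c, w ≤ (Finset.univ.filter fun t => κ t = c).card) : SL κ δ w = HML C w :=
  le_antisymm ((SL_le_HL κ δ w).trans (HL_le_HML κ w)) ((HML_le_HL κ w hN).trans (HL_le_SL hv w))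

end
end CBI

namespace CBI

theorem basis_change {M T T' : Type*} [AddCommGroup M] [Fintype T] [DecidableEq T] (b : T → M) (b' : T' → M)
    (hb : LinearIndependent ℤ b) (hb' : LinearIndependent ℤ b')
    (hs : Submodule.span ℤ (Set.range b) = Submodule.span ℤ (Set.range b')) :
    ∃ (e : T ≃ T') (U : Matrix T T ℤ), IsUnit U ∧ ∀ t, b t = ∑ s, U t s • b' (e s) := by
  set b1 := Module.Basis.span hb
  set b2 := (Module.Basis.span hb').map (LinearEquiv.ofEq _ _ hs.symm)
  set e := b1.indexEquiv b2
  set b3 := b2.reindex e.symm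
  refine ⟨e, (b3.toMatrix b1).transpose, ?_, ?_⟩
  · have := Module.Basis.invertibleToMatrix b3 b1
    rw [Matrix.isUnit_transpose]
    exact isUnit_of_invertible _
  · intro t
    have h1 := b3.sum_toMatrix_smul_self b1 t
    have h2 := congrArg (Submodule.subtype _) h1
    rw [map_sum] at h2
    have h3 : b t = Submodule.subtype _ (b1 t) := by
      simp only [b1, Submodule.subtype_apply, Module.Basis.span_apply]
    rw [h3, ← h2]
    refine Finset.sum_congr rfl fun s _ => ?_
    rw [map_smul, Matrix.transpose_apply]
    congr 1
    simp only [b3, b2, Module.Basis.reindex_apply, Equiv.symm_symm, Module.Basis.map_apply, Submodule.subtype_apply,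
      LinearEquiv.coe_ofEq_apply, Module.Basis.span_apply]

/-- index set -/
abbrev J (C : Type*) (w : ℕ) := {α : C × ℕ →₀ ℕ // wgt α = w}

lemma le_wgt {C : Type*} (α : C × ℕ →₀ ℕ) (i : C × ℕ) : α i * (i.2 + 1) ≤ wgt α := by
  by_cases h : α i = 0
  · simp [h]
  have := Finset.single_le_sum (f := fun i => α i • wt C i) (fun _ _ => Nat.zero_le _) (Finsupp.mem_support_iff.2 h)
  simpa [wgt, Finsupp.weight_apply, Finsupp.sum, wt] using this

instance {C : Type*} [Fintype C] (w : ℕ) : Finite (J C w) := by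
  refine Finite.of_injective (β := C × Fin w → Fin (w + 1)) (fun α x => ⟨α.1 (x.1, x.2.1), ?_⟩) ?_
  · have := le_wgt α.1 (x.1, x.2.1)
    rw [α.2] at this
    have h2 : α.1 (x.1, x.2.1) * 1 ≤ α.1 (x.1, x.2.1) * ((x.1, x.2.1).2 + 1) := Nat.mul_le_mul_left _ (by omega)
    omega
  · intro α β h
    apply Subtype.ext
    ext ⟨c, j⟩
    by_cases hj : j < w
    · have := congrFun h (c, ⟨j, hj⟩)
      simpa using this
    · have key : ∀ α : J C w, α.1 (c, j) = 0 := by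
        intro α
        have := le_wgt α.1 (c, j)
        rw [α.2] at this
        by_contra h0
        have h2 : 1 * ((c, j).2 + 1) ≤ α.1 (c, j) * ((c, j).2 + 1) := Nat.mul_le_mul_right _ (by omega)
        simp only at this h2
        omega
      rw [key, key]

instance {C : Type*} [Fintype C] (w : ℕ) : Fintype (J C w) := Fintype.ofFinite _

section
variable {C : Type*} [Fintype C] [DecidableEq C]

lemma X_mem (c : C) (n : ℕ) : (MvPolynomial.X (c, n) : Q C) ∈ IntS C := by
  induction n using Nat.strong_induction_on with
  | _ n ih =>
    have h := hh_succ (fun k => (MvPolynomial.X (c, k) : Q C)) n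
    rw [Finset.sum_range_succ] at h
    simp only [Nat.sub_self, hh_zero, mul_one] at h
    have h2 : (MvPolynomial.X (c, n) : Q C) = ((n + 1 : ℕ) : ℚ) • hp c (n + 1) -
        ∑ x ∈ Finset.range n, (MvPolynomial.X (c, x) : Q C) * hp c (n - x) := by
      simp only [hp]; rw [h]; ring
    rw [h2]
    refine Subring.sub_mem _ ?_ (Subring.sum_mem _ fun k hk => Subring.mul_mem _ (ih k (by simpa using hk)) (hp_mem _ _))
    have : ((n + 1 : ℕ) : ℚ) • hp c (n + 1) = (n + 1) • hp c (n + 1) := by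
      rw [Nat.cast_smul_eq_nsmul]
    rw [this]
    exact nsmul_mem (hp_mem _ _) _

lemma Hom_monomial (ν : C × ℕ →₀ ℕ) (a : ℚ) : Hom (MvPolynomial.monomial ν a : Q C) (wgt ν) :=
  MvPolynomial.isWeightedHomogeneous_monomial _ _ _ rfl

lemma monomial_mem (ν : C × ℕ →₀ ℕ) : (MvPolynomial.monomial ν 1 : Q C) ∈ HML C (wgt ν) := by
  refine mem_HML _ _ ?_ (Hom_monomial ν 1)
  rw [MvPolynomial.monomial_eq, map_one, one_mul]
  exact Subring.prod_mem _ fun i _ => Subring.pow_mem _ (X_mem i.1 i.2) _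

/-- transition matrix -/
def Kmat (C : Type*) [Fintype C] (w : ℕ) : Matrix (J C w) (J C w) ℚ :=
  Matrix.of fun α ν => MvPolynomial.coeff ν.1 (hmon α.1)

lemma mem_HML_iff (w : ℕ) (f : Q C) : f ∈ HML C w ↔ ∃ n : J C w → ℤ, f = ∑ α, n α • hmon α.1 := by
  have : {f | ∃ α : C × ℕ →₀ ℕ, wgt α = w ∧ f = hmon α} = Set.range (fun α : J C w => hmon α.1) := by
    ext f; constructor
    · rintro ⟨α, h, rfl⟩; exact ⟨⟨α, h⟩, rfl⟩
    · rintro ⟨α, rfl⟩; exact ⟨α.1, α.2, rfl⟩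
  rw [HML, this, Submodule.mem_span_range_iff_exists_fun]
  simp only [eq_comm]

lemma HML_eq (w : ℕ) : HML C w = Submodule.span ℤ (Set.range (fun α : J C w => hmon α.1)) := by
  rw [HML]; congr 1
  ext f; constructor
  · rintro ⟨α, h, rfl⟩; exact ⟨⟨α, h⟩, rfl⟩
  · rintro ⟨α, rfl⟩; exact ⟨α.1, α.2, rfl⟩

lemma Kmat_unit (w : ℕ) : IsUnit (Kmat C w).det := by
  have h1 : ∀ ν : J C w, ∃ n : J C w → ℤ, (MvPolynomial.monomial ν.1 1 : Q C) = ∑ α, n α • hmon α.1 := by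
    intro ν
    rw [← mem_HML_iff]
    have := monomial_mem ν.1
    rwa [ν.2] at this
  choose n hn using h1
  have h2 : (Matrix.of fun ν α => (n ν α : ℚ)) * Kmat C w = 1 := by
    ext ν μ
    have := congrArg (MvPolynomial.coeff μ.1) (hn ν)
    rw [MvPolynomial.coeff_monomial, MvPolynomial.coeff_sum] at this
    rw [Matrix.mul_apply, Matrix.one_apply]
    simp only [Matrix.of_apply, Kmat]
    have e : ∀ x, MvPolynomial.coeff μ.1 (n ν x • hmon x.1) = (n ν x : ℚ) * MvPolynomial.coeff μ.1 (hmon x.1) := by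
      intro x
      rw [← Int.cast_smul_eq_zsmul ℚ, MvPolynomial.coeff_smul, smul_eq_mul]
    simp only [e] at this
    rw [← this]
    simp [Subtype.ext_iff]
  have h3 := congrArg Matrix.det h2
  rw [Matrix.det_mul, Matrix.det_one] at h3
  exact IsUnit.of_mul_eq_one _ (by rw [mul_comm]; exact h3)

lemma hom_eq_sum (w : ℕ) (f : Q C) (hf : Hom f w) :
    f = ∑ ν : J C w, MvPolynomial.monomial ν.1 (MvPolynomial.coeff ν.1 f) := by
  ext μ
  rw [MvPolynomial.coeff_sum]
  simp only [MvPolynomial.coeff_monomial]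
  by_cases h : wgt μ = w
  · rw [Finset.sum_eq_single ⟨μ, h⟩]
    · simp
    · intro ν _ hν
      rw [if_neg (fun e => hν (Subtype.ext e))]
    · simp
  · have h0 : MvPolynomial.coeff μ f = 0 := by
      by_contra hc; exact h (hf hc)
    rw [h0, Finset.sum_eq_zero]
    intro ν _
    rw [if_neg (fun e => h (by rw [← e]; exact ν.2))]

lemma ip_eq_sum (w : ℕ) (f g : Q C) (hf : Hom f w) :
    ip f g = ∑ ν : J C w, zz ν.1 * MvPolynomial.coeff ν.1 f * MvPolynomial.coeff ν.1 g := by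
  conv_lhs => rw [hom_eq_sum w f hf]
  rw [map_sum, LinearMap.sum_apply]
  refine Finset.sum_congr rfl fun ν _ => ?_
  rw [ip_monomial]; ring

lemma hmon_li (w : ℕ) : LinearIndependent ℤ (fun α : J C w => hmon α.1) := by
  rw [Fintype.linearIndependent_iff]
  intro n hn
  have h1 : Matrix.vecMul (fun α => (n α : ℚ)) (Kmat C w) = 0 := by
    funext μ
    have := congrArg (MvPolynomial.coeff μ.1) hn
    rw [MvPolynomial.coeff_sum] at this
    simp only [Matrix.vecMul, dotProduct, Kmat, Matrix.of_apply, Pi.zero_apply]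
    rw [MvPolynomial.coeff_zero] at this
    rw [← this]
    refine Finset.sum_congr rfl fun x _ => ?_
    rw [← Int.cast_smul_eq_zsmul ℚ, MvPolynomial.coeff_smul, smul_eq_mul]
  have h2 := Matrix.eq_zero_of_vecMul_eq_zero (Kmat_unit (C := C) w).ne_zero h1
  intro α
  have := congrFun h2 α
  simpa using this

end

section
variable {B C : Type*} [Fintype B] [DecidableEq B] [DecidableEq C] [Fintype C]

lemma FF_self' (κ : B → C) (γ : B → ℤ) (hinj : ∀ s t, κ s = κ t → γ s = γ t → s = t) : FF κ γ γ = 1 := by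
  unfold FF
  rw [Finset.sum_eq_single 1]
  · rw [if_pos ⟨fun _ => rfl, rfl⟩]; simp
  · intro σ _ hσ
    rw [if_neg]
    rintro ⟨h1, h2⟩
    apply hσ
    ext i
    have h3 := congrFun h2 i
    exact (hinj _ _ (h1 i) h3.symm)
  · simp

lemma sch_comp (κ : B → C) (δ : B → ℕ) (γ : B → ℤ) (σ : Equiv.Perm B) (hσ : ∀ i, κ (σ i) = κ i) :
    sch κ δ (γ ∘ σ) = ((Equiv.Perm.sign σ : ℤ)) • sch κ δ γ := by
  have : smat κ δ (γ ∘ σ) = (smat κ δ γ).submatrix σ id := by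
    ext1 i j
    simp [smat, hσ]
  rw [sch, this, Matrix.det_permute, sch]
  simp [zsmul_eq_mul]

lemma sch_zero {κ : B → C} {δ : B → ℕ} (hv : Vac κ δ) (w : ℕ) (γ : B → ℤ) (h : ∑ i, γ i = ∑ i, (δ i : ℤ) + w)
    (hn : ¬ ((∀ i, 0 ≤ γ i) ∧ ∀ s t, κ s = κ t → γ s = γ t → s = t)) : sch κ δ γ = 0 := by
  apply (ip_self_nonneg _).2
  rw [ip_sch hv w γ γ h h, eps]
  split_ifs with h0
  · have : ¬ ∀ s t, κ s = κ t → γ s = γ t → s = t := fun h => hn ⟨h0, h⟩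
    push Not at this
    obtain ⟨s, t, h1, h2, h3⟩ := this
    exact FF_eq_zero κ γ γ s t h3 h1 h2
  · rfl

/-- valid exponents -/
def Val (κ : B → C) (δ : B → ℕ) (w : ℕ) : Type _ := {γ : B → ℤ // ∑ i, γ i = ∑ i, (δ i : ℤ) + w ∧
  (∀ i, 0 ≤ γ i) ∧ ∀ s t, κ s = κ t → γ s = γ t → s = t}

/-- equivalence up to colour preserving permutations -/
def valSetoid (κ : B → C) (δ : B → ℕ) (w : ℕ) : Setoid (Val κ δ w) where
  r γ γ' := ∃ σ : Equiv.Perm B, (∀ i, κ (σ i) = κ i) ∧ γ.1 = γ'.1 ∘ σ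
  iseqv := {
    refl := fun γ => ⟨1, fun _ => rfl, rfl⟩
    symm := by
      rintro γ γ' ⟨σ, h1, h2⟩
      refine ⟨σ⁻¹, fun i => ?_, ?_⟩
      · have := h1 (σ⁻¹ i); simpa using this.symm
      · rw [h2]; funext i; simp
    trans := by
      rintro γ γ' γ'' ⟨σ, h1, h2⟩ ⟨τ, h3, h4⟩
      refine ⟨τ * σ, fun i => ?_, ?_⟩
      · rw [Equiv.Perm.mul_apply, h3, h1]
      · rw [h2, h4]; rfl }

/-- orthonormal family -/
def orth (κ : B → C) (δ : B → ℕ) (w : ℕ) (a : Quotient (valSetoid κ δ w)) : Q C := sch κ δ a.out.1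

lemma ip_orth {κ : B → C} {δ : B → ℕ} (hv : Vac κ δ) (w : ℕ) (a b : Quotient (valSetoid κ δ w)) :
    ip (orth κ δ w a) (orth κ δ w b) = if a = b then 1 else 0 := by
  rw [orth, orth, ip_sch hv w _ _ a.out.2.1 b.out.2.1, eps, if_pos a.out.2.2.1]
  split_ifs with h
  · subst h; exact FF_self' κ _ a.out.2.2.2
  · apply Finset.sum_eq_zero
    intro σ _
    rw [if_neg]
    rintro ⟨h1, h2⟩
    apply h
    rw [← a.out_eq, ← b.out_eq]
    exact Quotient.sound ⟨σ, h1, h2⟩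

lemma orth_li {κ : B → C} {δ : B → ℕ} (hv : Vac κ δ) (w : ℕ) : LinearIndependent ℤ (orth κ δ w) := by
  rw [linearIndependent_iff']
  intro s g hg i hi
  have := congrArg (fun x => ip x (orth κ δ w i)) hg
  simp only [map_sum, LinearMap.sum_apply, map_zero, LinearMap.zero_apply, map_zsmul, LinearMap.smul_apply, ip_orth hv] at this
  simpa [hi] using this

lemma orth_span {κ : B → C} {δ : B → ℕ} (hv : Vac κ δ) (w : ℕ) :
    Submodule.span ℤ (Set.range (orth κ δ w)) = SL κ δ w := by
  apply le_antisymm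
  · rw [Submodule.span_le]
    rintro f ⟨a, rfl⟩
    exact Submodule.subset_span ⟨_, a.out.2.1, rfl⟩
  · rw [SL, Submodule.span_le]
    rintro f ⟨γ, h, rfl⟩
    by_cases hn : ((∀ i, 0 ≤ γ i) ∧ ∀ s t, κ s = κ t → γ s = γ t → s = t)
    · let v : Val κ δ w := ⟨γ, h, hn⟩
      obtain ⟨σ, h1, h2⟩ := (valSetoid κ δ w).symm (Quotient.exact (Quotient.out_eq (Quotient.mk (valSetoid κ δ w) v)))
      have : γ = (Quotient.mk (valSetoid κ δ w) v).out.1 ∘ σ := h2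
      rw [this, sch_comp _ _ _ _ h1]
      exact Submodule.smul_mem _ _ (Submodule.subset_span ⟨_, rfl⟩)
    · rw [sch_zero hv w γ h hn]; exact Submodule.zero_mem _

lemma vac_std (C : Type*) [Fintype C] [DecidableEq C] (w : ℕ) : Vac (fun x : C × Fin w => x.1) (fun x => x.2.1) where
  inj := by
    intro s t h1 h2
    exact Prod.ext h1 (Fin.ext h2)
  cnt := by
    intro t
    have : (Finset.univ.filter fun s : C × Fin w => s.1 = t.1 ∧ s.2.1 < t.2.1) = (Finset.Iio t.2).image (fun j => (t.1, j)) := by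
      ext s
      simp only [Finset.mem_filter, Finset.mem_univ, true_and, Finset.mem_image, Finset.mem_Iio]
      constructor
      · rintro ⟨h1, h2⟩; exact ⟨s.2, h2, by rw [← h1]⟩
      · rintro ⟨j, h1, rfl⟩; exact ⟨rfl, h1⟩
    rw [this, Finset.card_image_of_injective]
    · simp
    · intro a b h; simpa using h

lemma std_card (C : Type*) [Fintype C] [DecidableEq C] (w : ℕ) (c : C) :
    w ≤ (Finset.univ.filter fun t : C × Fin w => t.1 = c).card := by
  have : (Finset.univ.image (fun j : Fin w => (c, j))) ⊆ (Finset.univ.filter fun t : C × Fin w => t.1 = c) := by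
    intro x; simp; rintro j rfl; rfl
  have := Finset.card_le_card this
  rw [Finset.card_image_of_injective] at this
  · simpa using this
  · intro a b h; simpa using h

/-- The Gram matrix of the complete functions is unimodular. -/
theorem gram_unimod (C : Type*) [Fintype C] [DecidableEq C] (w : ℕ) :
    ∃ U : Matrix (J C w) (J C w) ℤ, IsUnit U ∧ ∀ α β : J C w, ip (hmon α.1) (hmon β.1) = ((U * U.transpose) α β : ℤ) := by
  have hv := vac_std C w
  have hsp : Submodule.span ℤ (Set.range (fun α : J C w => hmon α.1)) =
      Submodule.span ℤ (Set.range (orth (fun x : C × Fin w => x.1) (fun x => x.2.1) w)) := by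
    rw [orth_span hv, SL_eq_HML hv w (std_card C w), HML_eq]
  obtain ⟨e, U, hU, h⟩ := basis_change _ _ (hmon_li w) (orth_li hv w) hsp
  refine ⟨U, hU, fun α β => ?_⟩
  have h1 : hmon α.1 = _ := h α
  have h2 : hmon β.1 = _ := h β
  rw [Matrix.mul_apply, h1, h2]
  simp only [map_sum, LinearMap.sum_apply, map_zsmul, LinearMap.smul_apply, ip_orth hv, Matrix.transpose_apply]
  simp [mul_comm]

lemma ip_int (w : ℕ) (f g : Q C) (hf : f ∈ HML C w) (hg : g ∈ HML C w) : ∃ n : ℤ, ip f g = n := by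
  obtain ⟨a, rfl⟩ := (mem_HML_iff w f).1 hf
  obtain ⟨b, rfl⟩ := (mem_HML_iff w g).1 hg
  obtain ⟨U, _, hU⟩ := gram_unimod C w
  refine ⟨∑ α, ∑ β, b α * (a β * (U * U.transpose) β α), ?_⟩
  simp only [map_sum, LinearMap.sum_apply, map_zsmul, LinearMap.smul_apply, hU]
  push_cast
  simp [zsmul_eq_mul, Finset.mul_sum]

end
end CBI

namespace CBI

section
variable {C C' C'' : Type*} [Fintype C] [DecidableEq C] [Fintype C'] [DecidableEq C'] [Fintype C''] [DecidableEq C'']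

/-- linear substitution of colours -/
def sub (x : Matrix C' C ℤ) : Q C' →ₐ[ℚ] Q C :=
  MvPolynomial.aeval fun i => ∑ c, (x i.1 c : ℚ) • MvPolynomial.X (c, i.2)

lemma sub_X (x : Matrix C' C ℤ) (i : C' × ℕ) :
    sub x (MvPolynomial.X i) = ∑ c, (x i.1 c : ℚ) • MvPolynomial.X (c, i.2) := by
  simp [sub]

lemma sub_hp_mem (x : Matrix C' C ℤ) (k : C') (n : ℕ) : sub x (hp k n) ∈ IntS C := by
  rw [hp, hh_map]
  have : (fun j => sub x (MvPolynomial.X (k, j))) = ∑ c, x k c • (fun j => (MvPolynomial.X (c, j) : Q C)) := by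
    funext j
    rw [sub_X, Finset.sum_apply]
    refine Finset.sum_congr rfl fun c _ => ?_
    rw [Pi.smul_apply, Int.cast_smul_eq_zsmul]
  rw [this]
  exact hh_sum_mem _ _ _ _ (fun c _ n => hp_mem c n) n

lemma sub_mem (x : Matrix C' C ℤ) (f : Q C') (hf : f ∈ IntS C') : sub x f ∈ IntS C := by
  obtain ⟨F, rfl⟩ := hf
  induction F using MvPolynomial.induction_on with
  | C a => simp
  | add p q hp hq => rw [map_add, map_add]; exact Subring.add_mem _ hp hq
  | mul_X p i ih =>
    rw [map_mul, map_mul]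
    refine Subring.mul_mem _ ih ?_
    have : (Th C').toRingHom (MvPolynomial.X i) = hp i.1 (i.2 + 1) := by simp [Th]
    rw [this]
    exact sub_hp_mem _ _ _

lemma sub_hom (x : Matrix C' C ℤ) (f : Q C') (w : ℕ) (hf : Hom f w) : Hom (sub x f) w := by
  rw [hom_eq_sum w f hf, map_sum]
  refine (MvPolynomial.weightedHomogeneousSubmodule ℚ (wt C) w).sum_mem fun ν _ => ?_
  rw [MvPolynomial.mem_weightedHomogeneousSubmodule, sub, MvPolynomial.aeval_monomial]
  obtain ⟨ν, hν⟩ := ν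
  have h1 : Hom (ν.prod fun i m => (∑ c, (x i.1 c : ℚ) • (MvPolynomial.X (c, i.2) : Q C)) ^ m) w := by
    rw [← hν, wgt, Finsupp.weight_apply]
    unfold Finsupp.prod Finsupp.sum
    refine MvPolynomial.IsWeightedHomogeneous.prod _ _ _ fun i _ => ?_
    refine MvPolynomial.IsWeightedHomogeneous.pow ?_ _
    refine (MvPolynomial.weightedHomogeneousSubmodule ℚ (wt C) _).sum_mem fun c _ => ?_
    exact Submodule.smul_mem _ _ (Hom_X (c, i.2))
  have := (MvPolynomial.isWeightedHomogeneous_C (wt C) (MvPolynomial.coeff ν f)).mul h1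
  rw [zero_add] at this
  exact this

lemma sub_HML (x : Matrix C' C ℤ) (f : Q C') (w : ℕ) (hf : f ∈ HML C' w) : sub x f ∈ HML C w :=
  mem_HML _ _ (sub_mem x f (HML_le w f hf)) (sub_hom x f w (HML_hom w f hf))

lemma sub_sub (x : Matrix C' C ℤ) (y : Matrix C C'' ℤ) (f : Q C') : sub y (sub x f) = sub (x * y) f := by
  have : (sub y).comp (sub x) = sub (x * y) := by
    apply MvPolynomial.algHom_ext
    intro i
    rw [AlgHom.comp_apply, sub_X, sub_X, map_sum]
    simp only [map_smul, sub_X, Finset.smul_sum]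
    rw [Finset.sum_comm]
    refine Finset.sum_congr rfl fun c _ => ?_
    rw [Matrix.mul_apply]
    push_cast
    rw [Finset.sum_smul]
    refine Finset.sum_congr rfl fun c _ => ?_
    rw [mul_smul]
  exact DFunLike.congr_fun this f

lemma sub_one (f : Q C) : sub (1 : Matrix C C ℤ) f = f := by
  have : sub (1 : Matrix C C ℤ) = AlgHom.id ℚ _ := by
    apply MvPolynomial.algHom_ext
    intro i
    rw [sub_X]
    simp [Matrix.one_apply]
  rw [this]; rfl

lemma DD_C {D : Type*} (i : D × ℕ) (a : ℚ) : DD i (MvPolynomial.C a : Q D) = 0 := by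
  rw [DD_apply]; simp

lemma C_eq_smul {D : Type*} (a : ℚ) : (MvPolynomial.C a : Q D) = a • 1 := by
  rw [MvPolynomial.smul_eq_C_mul, mul_one]

lemma DD_sub (y : Matrix C C' ℤ) (k : C') (j : ℕ) (g : Q C) :
    DD (k, j) (sub y g) = sub y (∑ c, (y c k : ℚ) • DD (c, j) g) := by
  induction g using MvPolynomial.induction_on with
  | C a =>
    have h1 : sub y (MvPolynomial.C a) = MvPolynomial.C a := by simp [sub]
    rw [h1]
    simp [DD_C]
  | add p q hp hq =>
    simp only [map_add, hp, hq, smul_add, Finset.sum_add_distrib]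
  | mul_X p i hp =>
    have h1 : DD (k, j) (sub y (MvPolynomial.X i)) = sub y (∑ c, (y c k : ℚ) • DD (c, j) (MvPolynomial.X i)) := by
      rw [sub_X]
      have e1 : DD (k, j) (∑ c, (y i.1 c : ℚ) • (MvPolynomial.X (c, i.2) : Q C')) = ∑ c, (y i.1 c : ℚ) • (if (c, i.2) = (k, j) then MvPolynomial.C ((j + 1 : ℕ) : ℚ) else 0) := by
        rw [map_sum]
        exact Finset.sum_congr rfl fun c _ => by rw [Derivation.map_smul, DD_X]
      have e2 : sub y (∑ c, (y c k : ℚ) • DD (c, j) (MvPolynomial.X i)) = ∑ c, (y c k : ℚ) • (if i = (c, j) then MvPolynomial.C ((j + 1 : ℕ) : ℚ) else 0) := by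
        rw [map_sum]
        refine Finset.sum_congr rfl fun c _ => ?_
        rw [map_smul, DD_X]
        split_ifs
        · simp [sub]
        · simp
      rw [e1, e2]
      by_cases hj : i.2 = j
      · obtain ⟨c, j'⟩ := i
        simp only at hj
        subst hj
        simp [MvPolynomial.algHom_C, Prod.ext_iff, apply_ite, smul_ite]
      · have : ∀ c, ¬ (c, i.2) = (k, j) := fun c h => hj (by simpa using congrArg Prod.snd h)
        have h3 : ∀ c, ¬ i = (c, j) := fun c h => hj (by rw [h])
        simp [this, h3]
    rw [map_mul, Derivation.leibniz, h1, hp]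
    simp only [Derivation.leibniz, smul_eq_mul, map_add, map_mul, smul_add, Finset.sum_add_distrib, map_sum, map_smul,
      Finset.mul_sum, mul_smul_comm]

lemma ip_sub (u : Matrix C' C ℤ) (f : Q C') (g : Q C) : ip (sub u f) g = ip f (sub u.transpose g) := by
  induction f using MvPolynomial.induction_on generalizing g with
  | C a =>
    rw [C_eq_smul, map_smul, map_one, map_smul, map_smul, LinearMap.smul_apply, LinearMap.smul_apply, ip_one_left, ip_one_left]
    congr 1
    induction g using MvPolynomial.induction_on with
    | C a => simp [sub]
    | add p q hp hq => simp [hp, hq]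
    | mul_X p i hp =>
      simp only [map_mul, sub_X, ← MvPolynomial.constantCoeff_eq]
      simp
  | add p q hp hq => simp only [map_add, LinearMap.add_apply, hp, hq]
  | mul_X p i hp =>
    rw [mul_comm, map_mul, sub_X, ip_X_mul, DD_sub, ← hp, Finset.sum_mul]
    simp only [map_sum, LinearMap.sum_apply, smul_mul_assoc, map_smul, LinearMap.smul_apply, ip_X_mul, Matrix.transpose_apply]

/-- the total skewing operator -/
def DT (j : ℕ) (g : Q C) : Q C := ∑ c, DD (c, j) g

lemma sub_inv {C₀ : Type*} [Fintype C₀] [DecidableEq C₀] (g : Q (Option C₀)) (hg : ∀ j, DT j g = 0)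
    : sub (Matrix.of fun c c' => (if c = c' ∧ c ≠ none then 1 else 0) - (if c ≠ none ∧ c' = none then 1 else 0) : Matrix (Option C₀) (Option C₀) ℤ) g = g := by
  set R : Matrix (Option C₀) (Option C₀) ℤ := Matrix.of fun c c' => (if c = c' then 1 else 0) + (if c ≠ none ∧ c' = none then 1 else 0) with hR
  set Ri : Matrix (Option C₀) (Option C₀) ℤ := Matrix.of fun c c' => (if c = c' then 1 else 0) - (if c ≠ none ∧ c' = none then 1 else 0) with hRi
  set Z : Matrix (Option C₀) (Option C₀) ℤ := Matrix.of fun c c' => (if c = c' ∧ c ≠ none then 1 else 0) with hZ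
  set G := sub R g with hG
  have h1 : ∀ j, DD (none, j) G = 0 := by
    intro j
    rw [hG, DD_sub]
    have : ∑ c, ((R c none : ℤ) : ℚ) • DD (c, j) g = DT j g := by
      refine Finset.sum_congr rfl fun c _ => ?_
      cases c <;> simp [hR]
    rw [this, hg, map_zero]
  have h2 : ∀ ν j, ν (none, j) ≠ 0 → MvPolynomial.coeff ν G = 0 := by
    intro ν j h
    have h3 := ip_monomial ν 1 G
    have h4 : (MvPolynomial.monomial ν (1 : ℚ)) = MvPolynomial.X (none, j) * MvPolynomial.monomial (ν - Finsupp.single (none, j) 1) 1 := by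
      rw [MvPolynomial.X, MvPolynomial.monomial_mul, mul_one, add_tsub_cancel_of_le]
      rw [Finsupp.single_le_iff]; omega
    rw [h4, ip_X_mul, h1, map_zero, one_mul] at h3
    have := (zz_pos ν).ne'
    rcases mul_eq_zero.1 h3.symm with h | h
    · exact absurd h this
    · exact h
  have h3 : sub Z G = G := by
    conv_lhs => rw [MvPolynomial.as_sum G]
    conv_rhs => rw [MvPolynomial.as_sum G]
    rw [map_sum]
    refine Finset.sum_congr rfl fun ν hν => ?_
    rw [sub, MvPolynomial.aeval_monomial, MvPolynomial.monomial_eq]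
    congr 1
    refine Finset.prod_congr rfl fun i hi => ?_
    have : i.1 ≠ none := by
      intro h
      refine MvPolynomial.mem_support_iff.1 hν (h2 ν i.2 ?_)
      rw [← h]
      exact Finsupp.mem_support_iff.1 hi
    simp [hZ, this]
  have h4 : sub Ri G = g := by
    rw [hG, sub_sub]
    have : R * Ri = 1 := by
      ext c c'
      rw [Matrix.mul_apply, Fintype.sum_option]
      cases c <;> cases c' <;> simp [hR, hRi, Matrix.one_apply]
    rw [this, sub_one]
  conv_rhs => rw [← h4, ← h3, hG, sub_sub, sub_sub]
  congr 1
  congr 1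
  ext c c'
  rw [Matrix.mul_apply, Fintype.sum_option]
  simp only [Matrix.mul_apply, Fintype.sum_option]
  cases c <;> cases c' <;> simp [hR, hRi, hZ]

/-- the kernel lattice -/
def KL (C : Type*) [Fintype C] [DecidableEq C] (w : ℕ) : Set (Q C) := {g | g ∈ HML C w ∧ ∀ j, DT j g = 0}

lemma kernel_basis {C₀ : Type*} [Fintype C₀] [DecidableEq C₀] (w : ℕ) (u : Matrix C' (Option C₀) ℤ) (a : Matrix (Option C₀) C' ℤ)
    (hau : a * u = Matrix.of fun c c' => (if c = c' ∧ c ≠ none then 1 else 0) - (if c ≠ none ∧ c' = none then 1 else 0))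
    (hua : u * a = 1) (hu : ∀ k, ∑ c, u k c = 0) :
    LinearIndependent ℤ (fun α : J C' w => sub u (hmon α.1)) ∧
    (Submodule.span ℤ (Set.range (fun α : J C' w => sub u (hmon α.1))) : Set (Q (Option C₀))) = KL (Option C₀) w := by
  have hinv : ∀ f, sub a (sub u f) = f := fun f => by rw [sub_sub, hua, sub_one]
  have hr : (fun α : J C' w => sub u (hmon α.1)) = ((sub u).toLinearMap.restrictScalars ℤ) ∘ (fun α : J C' w => hmon α.1) := rfl
  constructor
  · rw [hr]
    refine (hmon_li w).map' _ (LinearMap.ker_eq_bot.2 ?_)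
    exact Function.LeftInverse.injective hinv
  · rw [hr, Set.range_comp, ← Submodule.map_span, ← HML_eq]
    ext g
    constructor
    · rintro ⟨f, hf, rfl⟩
      refine ⟨sub_HML _ _ _ hf, fun j => ?_⟩
      unfold DT
      change ∑ c, DD (c, j) (sub u f) = 0
      simp only [DD_sub]
      rw [← map_sum, Finset.sum_comm]
      simp only [← Finset.sum_smul]
      have : ∀ k, ∑ c, ((u k c : ℤ) : ℚ) = 0 := fun k => by exact_mod_cast hu k
      simp [this]
    · rintro ⟨h1, h2⟩
      refine ⟨sub a g, sub_HML _ _ _ h1, ?_⟩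
      change sub u (sub a g) = g
      rw [sub_sub, hau]
      exact sub_inv g h2

end
end CBI

namespace CBI

theorem basis_change_e {M T T' : Type*} [AddCommGroup M] [Fintype T] [DecidableEq T] (b : T → M) (b' : T' → M)
    (hb : LinearIndependent ℤ b) (hb' : LinearIndependent ℤ b')
    (hs : Submodule.span ℤ (Set.range b) = Submodule.span ℤ (Set.range b')) (e : T ≃ T') :
    ∃ (U : Matrix T T ℤ), IsUnit U ∧ ∀ t, b t = ∑ s, U t s • b' (e s) := by
  have hs2 : Submodule.span ℤ (Set.range b) = Submodule.span ℤ (Set.range (b' ∘ e)) := by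
    rw [hs, Set.range_comp, e.range_eq_univ, Set.image_univ]
  obtain ⟨e2, U, hU, h⟩ := basis_change b (b' ∘ e) hb (hb'.comp _ e.injective) hs2
  have hP : U.submatrix id e2.symm = U.submatrix (Equiv.refl _) e2.symm := rfl
  refine ⟨U.submatrix id e2.symm, ?_, fun t => ?_⟩
  · rw [Matrix.isUnit_iff_isUnit_det] at hU ⊢
    have h1 : U.submatrix id e2.symm = U * (e2.symm.toPEquiv.toMatrix : Matrix T T ℤ).transpose := by
      ext i j
      rw [Matrix.mul_apply]
      simp [PEquiv.toMatrix_apply, Equiv.toPEquiv_apply]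
    have h2 : IsUnit ((e2.symm.toPEquiv.toMatrix : Matrix T T ℤ)).det := by
      have : (e2.symm.toPEquiv.toMatrix : Matrix T T ℤ) = (Equiv.Perm.permMatrix ℤ e2.symm) := rfl
      rw [this, Matrix.det_permutation]
      exact (Equiv.Perm.sign e2.symm).isUnit.map (Int.castRingHom ℤ : ℤ →* ℤ)
    rw [h1, Matrix.det_mul, Matrix.det_transpose]
    exact hU.mul h2
  · rw [h t]
    refine Fintype.sum_equiv e2 _ _ fun s => ?_
    rw [Matrix.submatrix_apply, id, Equiv.symm_apply_apply]; rfl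

section
variable {C : Type*} [Fintype C] [DecidableEq C]

lemma hmon_HML (w : ℕ) (α : J C w) : hmon α.1 ∈ HML C w :=
  mem_HML _ _ (hmon_mem α.1) (by have := Hom_hmon α.1; rwa [α.2] at this)

lemma Amat_ex (d : C → ℤ) (w : ℕ) (α β : J C w) : ∃ n : ℤ, ip (hmon α.1) (sub (Matrix.diagonal d) (hmon β.1)) = n :=
  ip_int w _ _ (hmon_HML w α) (sub_HML _ _ _ (hmon_HML w β))

/-- the reduced Cartan matrix -/
def Amat (d : C → ℤ) (w : ℕ) : Matrix (J C w) (J C w) ℤ := Matrix.of fun α β => (Amat_ex d w α β).choose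

lemma Amat_spec (d : C → ℤ) (w : ℕ) (α β : J C w) :
    ((Amat d w α β : ℤ) : ℚ) = ip (hmon α.1) (sub (Matrix.diagonal d) (hmon β.1)) :=
  (Amat_ex d w α β).choose_spec.symm

lemma Amat_symm (d : C → ℤ) (w : ℕ) : (Amat d w).transpose = Amat d w := by
  ext α β
  have : ((Amat d w β α : ℤ) : ℚ) = (Amat d w α β : ℤ) := by
    rw [Amat_spec, Amat_spec, ip_symm, ip_sub, Matrix.diagonal_transpose]
  exact_mod_cast this

/-- the product of the multipliers -/
def dmon (d : C → ℤ) (ν : C × ℕ →₀ ℕ) : ℤ := ν.prod fun i m => d i.1 ^ m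

lemma sub_diag_monomial (d : C → ℤ) (ν : C × ℕ →₀ ℕ) (a : ℚ) :
    sub (Matrix.diagonal d) (MvPolynomial.monomial ν a) = MvPolynomial.monomial ν (dmon d ν * a) := by
  rw [sub, MvPolynomial.aeval_monomial]
  have : ∀ i : C × ℕ, ∑ c, ((Matrix.diagonal d i.1 c : ℤ) : ℚ) • (MvPolynomial.X (c, i.2) : Q C) = (d i.1 : ℚ) • MvPolynomial.X i := by
    intro i
    rw [Finset.sum_eq_single i.1]
    · rw [Matrix.diagonal_apply_eq]
    · intro c _ hc
      rw [Matrix.diagonal_apply_ne _ hc.symm]; simp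
    · simp
  simp only [this]
  rw [MvPolynomial.monomial_eq, MvPolynomial.algebraMap_eq, dmon]
  unfold Finsupp.prod
  simp only [smul_pow, MvPolynomial.smul_eq_C_mul, mul_pow, Finset.prod_mul_distrib]
  push_cast
  simp only [map_mul, map_prod]
  rw [← mul_assoc, mul_comm (MvPolynomial.C a)]
  simp

lemma coeff_sub_diag (d : C → ℤ) (ν : C × ℕ →₀ ℕ) (g : Q C) :
    MvPolynomial.coeff ν (sub (Matrix.diagonal d) g) = dmon d ν * MvPolynomial.coeff ν g := by
  induction g using MvPolynomial.induction_on' with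
  | monomial μ a =>
    rw [sub_diag_monomial, MvPolynomial.coeff_monomial, MvPolynomial.coeff_monomial]
    split_ifs with h
    · rw [h]
    · simp
  | add p q hp hq => rw [map_add, MvPolynomial.coeff_add, hp, hq, MvPolynomial.coeff_add, mul_add]

theorem Amat_det (d : C → ℤ) (w : ℕ) : (Amat d w).det = ∏ ν : J C w, dmon d ν.1 := by
  have h1 : ∀ e : C → ℤ, (Amat e w).map (fun x : ℤ => (x : ℚ)) = Kmat C w * Matrix.diagonal (fun ν : J C w => zz ν.1 * dmon e ν.1) * (Kmat C w).transpose := by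
    intro e
    ext α β
    rw [Matrix.map_apply, Amat_spec, ip_eq_sum w _ _ (HML_hom _ _ (hmon_HML w α)), Matrix.mul_apply]
    refine Finset.sum_congr rfl fun ν _ => ?_
    rw [Matrix.mul_diagonal, coeff_sub_diag, Matrix.transpose_apply, Kmat, Matrix.of_apply, Matrix.of_apply]
    ring
  have h2 : ∀ e : C → ℤ, (((Amat e w).det : ℤ) : ℚ) = (Kmat C w).det ^ 2 * (∏ ν : J C w, zz ν.1) * ∏ ν : J C w, (dmon e ν.1 : ℚ) := by
    intro e
    have := congrArg Matrix.det (h1 e)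
    rw [Matrix.det_mul, Matrix.det_mul, Matrix.det_transpose, Matrix.det_diagonal, Finset.prod_mul_distrib] at this
    have h3 : ((Amat e w).map (fun x : ℤ => (x : ℚ))).det = ((Amat e w).det : ℤ) := by
      have := (Int.castRingHom ℚ).map_det (Amat e w)
      exact this.symm
    rw [h3] at this
    rw [this]; ring
  obtain ⟨U, hU, hg⟩ := gram_unimod C w
  have h3 : Amat (1 : C → ℤ) w = U * U.transpose := by
    ext α β
    have : ((Amat (1 : C → ℤ) w α β : ℤ) : ℚ) = ((U * U.transpose) α β : ℤ) := by
      rw [Amat_spec, ← hg]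
      have : (Matrix.diagonal (1 : C → ℤ)) = 1 := Matrix.diagonal_one
      rw [this, sub_one]
    exact_mod_cast this
  have h4 : (Amat (1 : C → ℤ) w).det = 1 := by
    rw [h3, Matrix.det_mul, Matrix.det_transpose]
    rw [Matrix.isUnit_iff_isUnit_det] at hU
    exact Int.isUnit_mul_self hU
  have h5 := h2 1
  rw [h4] at h5
  have h6 : ∀ ν : J C w, dmon (1 : C → ℤ) ν.1 = 1 := by intro ν; simp [dmon]
  simp only [h6] at h5
  have h7 := h2 d
  have h8 : (Kmat C w).det ^ 2 * (∏ ν : J C w, zz ν.1) = 1 := by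
    have := h5.symm
    simpa using this
  rw [h8, one_mul] at h7
  exact_mod_cast h7

end

section
variable (k : ℕ)
/-- first kernel basis -/
def uM : Matrix (Option (Fin k)) (Option (Option (Fin k))) ℤ := Matrix.of fun i c =>
  match i with
  | some i => (if c = some (some i) then 1 else 0) - (if c = some none then 1 else 0)
  | none => (if c = some none then ((k : ℤ) + 2) else 0) - 1

/-- second kernel basis -/
def vM : Matrix (Option (Fin k)) (Option (Option (Fin k))) ℤ := Matrix.of fun i c =>
  match i with
  | some i => (if c = some (some i) then 1 else 0) - (if c = none then 1 else 0)
  | none => 1 - (if c = none then ((k : ℤ) + 2) else 0)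

/-- inverse of the first -/
def uI : Matrix (Option (Option (Fin k))) (Option (Fin k)) ℤ := Matrix.of fun c i =>
  match c with
  | none => 0
  | some none => 1
  | some (some c) => 1 + if i = some c then 1 else 0

/-- inverse of the second -/
def vI : Matrix (Option (Option (Fin k))) (Option (Fin k)) ℤ := Matrix.of fun c i =>
  match c with
  | none => 0
  | some none => if i = none then 1 else -1
  | some (some c) => if i = some c then 1 else 0

/-- multipliers -/
def dM : Option (Fin k) → ℤ := fun i => if i = none then (k : ℤ) + 2 else 1

lemma uI_uM : uI k * uM k = Matrix.of fun c c' => (if c = c' ∧ c ≠ none then 1 else 0) - (if c ≠ none ∧ c' = none then 1 else 0) := by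
  ext c c'
  rw [Matrix.mul_apply, Fintype.sum_option]
  rcases c with _ | _ | c <;> rcases c' with _ | _ | c' <;>
    simp [uI, uM, Finset.sum_add_distrib, add_mul, mul_sub, eq_comm] <;> first | ring1 | (split_ifs <;> simp_all)

lemma uM_uI : uM k * uI k = 1 := by
  ext c c'
  rw [Matrix.mul_apply, Fintype.sum_option, Fintype.sum_option]
  rcases c with _ | c <;> rcases c' with _ | c' <;>
    simp [uI, uM, Matrix.one_apply, Finset.sum_add_distrib, mul_add, sub_mul] <;> first | ring1 | (split_ifs <;> simp_all)

lemma vI_vM : vI k * vM k = Matrix.of fun c c' => (if c = c' ∧ c ≠ none then 1 else 0) - (if c ≠ none ∧ c' = none then 1 else 0) := by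
  ext c c'
  rw [Matrix.mul_apply, Fintype.sum_option]
  rcases c with _ | _ | c <;> rcases c' with _ | _ | c' <;>
    simp [vI, vM, Finset.sum_add_distrib, add_mul, mul_sub, eq_comm] <;> first | ring1 | (split_ifs <;> simp_all)

lemma vM_vI : vM k * vI k = 1 := by
  ext c c'
  rw [Matrix.mul_apply, Fintype.sum_option, Fintype.sum_option]
  rcases c with _ | c <;> rcases c' with _ | c' <;>
    simp [vI, vM, Matrix.one_apply, Finset.sum_add_distrib, mul_add, sub_mul] <;> first | ring1 | (split_ifs <;> simp_all)

lemma uM_sum (i : Option (Fin k)) : ∑ c, uM k i c = 0 := by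
  rw [Fintype.sum_option, Fintype.sum_option]
  rcases i with _ | i <;> simp [uM]
  ring

lemma vM_sum (i : Option (Fin k)) : ∑ c, vM k i c = 0 := by
  rw [Fintype.sum_option, Fintype.sum_option]
  rcases i with _ | i <;> simp [vM]
  ring

lemma vM_uM : vM k * (uM k).transpose = Matrix.diagonal (dM k) := by
  ext c c'
  rw [Matrix.mul_apply, Fintype.sum_option, Fintype.sum_option]
  rcases c with _ | c <;> rcases c' with _ | c' <;>
    simp [vM, uM, dM, Matrix.diagonal_apply, Finset.sum_add_distrib, mul_add, sub_mul, mul_sub, eq_comm] <;> first | ring1 | (split_ifs <;> simp_all)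

theorem gram_reduce (w : ℕ) {T : Type*} [Fintype T] [DecidableEq T] (b : T → Q (Option (Option (Fin k))))
    (hb : LinearIndependent ℤ b)
    (hs : (Submodule.span ℤ (Set.range b) : Set (Q (Option (Option (Fin k))))) = KL (Option (Option (Fin k))) w) :
    ∃ (e : T ≃ J (Option (Fin k)) w) (U V : Matrix T T ℤ), IsUnit U ∧ IsUnit V ∧
      ∀ t q, ip (b t) (b q) = (U * (Amat (dM k) w).submatrix e e * V) t q := by
  obtain ⟨hu1, hu2⟩ := kernel_basis w (uM k) (uI k) (uI_uM k) (uM_uI k) (uM_sum k)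
  obtain ⟨hv1, hv2⟩ := kernel_basis w (vM k) (vI k) (vI_vM k) (vM_vI k) (vM_sum k)
  have hsu := SetLike.coe_injective (hs.trans hu2.symm)
  have hsv := SetLike.coe_injective (hs.trans hv2.symm)
  obtain ⟨e, U, hU, h⟩ := basis_change _ _ hb hu1 hsu
  obtain ⟨V, hV, h'⟩ := basis_change_e _ _ hb hv1 hsv e
  refine ⟨e, U, V.transpose, hU, by rwa [Matrix.isUnit_transpose], fun t q => ?_⟩
  rw [h t, h' q, Matrix.mul_apply]
  simp only [map_sum, LinearMap.sum_apply, map_zsmul, LinearMap.smul_apply, Matrix.transpose_apply]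
  push_cast
  refine Finset.sum_congr rfl fun r _ => ?_
  rw [Matrix.mul_apply]
  rw [zsmul_eq_mul, mul_comm]
  congr 1
  push_cast
  refine Finset.sum_congr rfl fun s _ => ?_
  rw [zsmul_eq_mul, Matrix.submatrix_apply, Amat_spec, ip_sub, sub_sub, vM_uM]
end

end CBI

namespace CBI

section
variable {B C : Type*} [Fintype B] [DecidableEq B] [DecidableEq C]

/-- evaluation in finitely many coloured variables -/
def ev (κ : B → C) : Q C →ₐ[ℚ] MvPolynomial B ℚ :=
  MvPolynomial.aeval fun i => ∑ b ∈ Finset.univ.filter (fun b => κ b = i.1), MvPolynomial.X b ^ (i.2 + 1)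

lemma coeff_zero_prod_hz (κ : B → C) (lam : B →₀ ℕ) :
    MvPolynomial.coeff 0 (∏ b, hz (κ b) (lam b : ℤ)) = if lam = 0 then 1 else 0 := by
  split_ifs with h
  · subst h; simp [hz_zero]
  · have h1 : Hom (∏ b, hz (κ b) (lam b : ℤ)) (∑ b, lam b) := Hom_prod_hz _ _ _ _ (by push_cast; rfl)
    by_contra hc
    have := h1 hc
    rw [map_zero] at this
    apply h
    ext b
    exact (Finset.sum_eq_zero_iff.1 this.symm) b (Finset.mem_univ b)

theorem ip_prod_hz (κ : B → C) (f : Q C) (lam : B →₀ ℕ) :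
    ip f (∏ b, hz (κ b) (lam b : ℤ)) = MvPolynomial.coeff lam (ev κ f) := by
  induction f using MvPolynomial.induction_on generalizing lam with
  | C a =>
    rw [C_eq_smul, map_smul, LinearMap.smul_apply, ip_one_left, coeff_zero_prod_hz, map_smul, map_one,
      MvPolynomial.coeff_smul, MvPolynomial.coeff_one]
    simp only [eq_comm]
  | add p q hp hq => simp only [map_add, LinearMap.add_apply, hp, hq, MvPolynomial.coeff_add]
  | mul_X p i ih =>
    obtain ⟨c, j⟩ := i
    rw [mul_comm, ip_X_mul, deriv_prod, map_mul]
    have e1 : ev κ (MvPolynomial.X (c, j)) = ∑ b ∈ Finset.univ.filter (fun b => κ b = c), MvPolynomial.X b ^ (j + 1) := by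
      simp [ev]
    rw [e1, Finset.sum_mul, MvPolynomial.coeff_sum, map_sum, Finset.sum_filter]
    refine Finset.sum_congr rfl fun b _ => ?_
    rw [MvPolynomial.X_pow_eq_monomial, MvPolynomial.coeff_monomial_mul', DD_hz]
    split_ifs with h1 h2 h2
    · rw [Finsupp.single_le_iff] at h2
      rw [one_mul, ← ih]
      congr 1
      refine Finset.prod_congr rfl fun b' _ => ?_
      by_cases hb : b' = b
      · subst hb
        rw [Function.update_self, Finsupp.tsub_apply, Finsupp.single_eq_same]
        congr 1
        push_cast [h2]; ring
      · rw [Function.update_of_ne hb, Finsupp.tsub_apply, Finsupp.single_eq_of_ne hb]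
        simp
    · rw [Finsupp.single_le_iff] at h2
      have : hz (κ b) ((lam b : ℤ) - ((j : ℤ) + 1)) = 0 := hz_neg _ (by push Not at h2; omega)
      rw [this, Finset.prod_eq_zero (Finset.mem_univ b), map_zero]
      rw [Function.update_self]
    · rw [Finset.prod_eq_zero (Finset.mem_univ b), map_zero]
      rw [Function.update_self]
end

section
/-- `x` is divisible by `p ^ s` locally at `p` -/
def ge (p : ℕ) (s : ℕ) (x : ℚ) : Prop := padicNorm p x ≤ (p : ℚ) ^ (-(s : ℤ))

variable {p : ℕ} [hpf : Fact p.Prime]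

lemma ge_zero (s : ℕ) : ge p s 0 := by
  unfold ge; simp only [padicNorm.zero]; positivity

lemma ge_add {s : ℕ} {x y : ℚ} (hx : ge p s x) (hy : ge p s y) : ge p s (x + y) :=
  (padicNorm.nonarchimedean).trans (max_le hx hy)

lemma ge_sum {ι : Type*} {s : ℕ} (t : Finset ι) (f : ι → ℚ) (h : ∀ i ∈ t, ge p s (f i)) : ge p s (∑ i ∈ t, f i) :=
  Finset.sum_induction f (ge p s) (fun _ _ => ge_add) (ge_zero s) h

lemma ge_mul {s t : ℕ} {x y : ℚ} (hx : ge p s x) (hy : ge p t y) : ge p (s + t) (x * y) := by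
  have hp0 : (p : ℚ) ≠ 0 := by exact_mod_cast hpf.out.ne_zero
  unfold ge at *
  rw [padicNorm.mul]
  push_cast
  rw [neg_add, zpow_add₀ hp0]
  exact mul_le_mul hx hy (padicNorm.nonneg _) (by positivity)

lemma ge_mono {s t : ℕ} {x : ℚ} (h : t ≤ s) (hx : ge p s x) : ge p t x := by
  refine hx.trans (zpow_le_zpow_right₀ (by exact_mod_cast hpf.out.one_le) (by omega))

lemma ge_one : ge p 0 1 := by simp [ge]

lemma ge_prod {ι : Type*} (t : Finset ι) (s : ι → ℕ) (f : ι → ℚ) (h : ∀ i ∈ t, ge p (s i) (f i)) :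
    ge p (∑ i ∈ t, s i) (∏ i ∈ t, f i) := by
  induction t using Finset.induction_on with
  | empty => simpa using ge_one
  | insert a t ha ih =>
    rw [Finset.sum_insert ha, Finset.prod_insert ha]
    exact ge_mul (h a (by simp)) (ih fun i hi => h i (by simp [hi]))

lemma ge_pow {s : ℕ} {x : ℚ} (m : ℕ) (h : ge p s x) : ge p (m * s) (x ^ m) := by
  have := ge_prod (p := p) (Finset.range m) (fun _ => s) (fun _ => x) (fun _ _ => h)
  simpa using this

lemma ge_int {s : ℕ} (n : ℤ) : ge p s n ↔ (p : ℤ) ^ s ∣ n := by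
  unfold ge
  rw [← padicNorm.dvd_iff_norm_le]
  push_cast
  rfl

lemma ge_of_eq {s : ℕ} {x : ℚ} {n : ℕ} (hn : n ≠ 0) (h : ge p (s + padicValNat p n) (n * x)) : ge p s x := by
  have hp0 : (p : ℚ) ≠ 0 := by exact_mod_cast hpf.out.ne_zero
  have hp1 : (0 : ℚ) < p := by exact_mod_cast hpf.out.pos
  unfold ge at *
  rw [padicNorm.mul, padicNorm.eq_zpow_of_nonzero (by exact_mod_cast hn), padicValRat.of_nat] at h
  push_cast at h
  rw [neg_add, zpow_add₀ hp0, mul_comm] at h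
  exact le_of_mul_le_mul_right h (by positivity)

lemma ge_iff_mul {s : ℕ} {x : ℚ} {n : ℕ} (hn : n ≠ 0) (h : ge p s x) : ge p (s + padicValNat p n) (n * x) := by
  rw [add_comm]
  refine ge_mul ?_ h
  unfold ge
  rw [padicNorm.eq_zpow_of_nonzero (by exact_mod_cast hn), padicValRat.of_nat]

/-- capped complementary valuation -/
def sg (p r n : ℕ) : ℕ := if n = 0 then 0 else r - padicValNat p n

lemma sg_add (r m n : ℕ) : sg p r (m + n) ≤ max (sg p r m) (sg p r n) := by
  unfold sg
  by_cases hm : m = 0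
  · subst hm; simp
  by_cases hn : n = 0
  · subst hn; simp
  have h : m + n ≠ 0 := by omega
  simp only [hm, hn, h, if_false]
  have key : min (padicValNat p m) (padicValNat p n) ≤ padicValNat p (m + n) := by
    rw [← padicValNat_dvd_iff_le h]
    apply dvd_add
    · rw [padicValNat_dvd_iff_le hm]; exact min_le_left _ _
    · rw [padicValNat_dvd_iff_le hn]; exact min_le_right _ _
  omega

lemma sg_sum {ι : Type*} (r : ℕ) (t : Finset ι) (f : ι → ℕ) : sg p r (∑ i ∈ t, f i) ≤ ∑ i ∈ t, sg p r (f i) := by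
  induction t using Finset.induction_on with
  | empty => simp [sg]
  | insert a t ha ih =>
    rw [Finset.sum_insert ha, Finset.sum_insert ha]
    have := sg_add (p := p) r (f a) (∑ i ∈ t, f i)
    omega

lemma sg_mul (r m n : ℕ) : sg p r (m * n) ≤ sg p r n := by
  unfold sg
  by_cases hm : m = 0
  · subst hm; simp
  by_cases hn : n = 0
  · subst hn; simp
  simp only [hm, hn, mul_eq_zero, or_self, if_false]
  rw [padicValNat.mul hm hn]; omega

lemma sg_mul_lt (r m n : ℕ) (hd : p ∣ m) (h : sg p r n ≠ 0) : sg p r (m * n) < sg p r n := by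
  unfold sg at *
  by_cases hn : n = 0
  · subst hn; simp at h
  by_cases hm : m = 0
  · subst hm; simp only [hn, if_false] at h; simp [hn]; omega
  simp only [hm, hn, mul_eq_zero, or_self, if_false] at h ⊢
  rw [padicValNat.mul hm hn]
  have : 1 ≤ padicValNat p m := one_le_padicValNat_of_dvd hm hd
  omega

lemma val_fact_le (m : ℕ) : padicValNat p (m + 1).factorial ≤ m := by
  have h := sub_one_mul_padicValNat_factorial_lt_of_ne_zero (p := p) (n := m + 1) (by omega)
  have h2 : 1 ≤ p - 1 := by have := hpf.out.two_le; omega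
  have : 1 * padicValNat p (m + 1).factorial ≤ (p - 1) * padicValNat p (m + 1).factorial := Nat.mul_le_mul_right _ h2
  omega

variable {B : Type*} [Fintype B] [DecidableEq B] (r : B → ℕ)

/-- weight of a monomial -/
def sw (p : ℕ) (r : B → ℕ) (η : B →₀ ℕ) : ℕ := ∑ b, sg p (r b) (η b)

lemma sw_add (η θ : B →₀ ℕ) : sw p r (η + θ) ≤ sw p r η + sw p r θ := by
  unfold sw
  rw [← Finset.sum_add_distrib]
  refine Finset.sum_le_sum fun b _ => ?_
  have := sg_add (p := p) (r b) (η b) (θ b)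
  rw [Finsupp.add_apply]; omega

lemma sw_mul (m : ℕ) (η : B →₀ ℕ) : sw p r (m • η) ≤ sw p r η :=
  Finset.sum_le_sum fun b _ => by rw [Finsupp.smul_apply, smul_eq_mul]; exact sg_mul _ _ _

lemma sw_mul_lt (m : ℕ) (η : B →₀ ℕ) (hd : p ∣ m) (h : sw p r η ≠ 0) : sw p r (m • η) < sw p r η := by
  obtain ⟨b, hb, h⟩ := Finset.exists_ne_zero_of_sum_ne_zero h
  refine Finset.sum_lt_sum (fun b _ => by rw [Finsupp.smul_apply, smul_eq_mul]; exact sg_mul _ _ _) ⟨b, hb, ?_⟩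
  rw [Finsupp.smul_apply, smul_eq_mul]
  exact sg_mul_lt _ _ _ hd h

/-- the filtration -/
def Fil (p : ℕ) (r : B → ℕ) (a : ℕ) (f : MvPolynomial B ℚ) : Prop :=
  ∀ η, ge p (sw p r η + if sw p r η < a then 1 else 0) (MvPolynomial.coeff η f)

lemma Fil_mul {a b : ℕ} {f g : MvPolynomial B ℚ} (hf : Fil p r a f) (hg : Fil p r b g) : Fil p r (a + b) (f * g) := by
  intro η
  rw [MvPolynomial.coeff_mul]
  refine ge_sum _ _ fun x hx => ?_
  have hx := Finset.HasAntidiagonal.mem_antidiagonal.1 hx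
  refine ge_mono ?_ (ge_mul (hf x.1) (hg x.2))
  have := sw_add (p := p) r x.1 x.2
  rw [hx] at this
  split_ifs <;> omega

lemma Fil_add {a : ℕ} {f g : MvPolynomial B ℚ} (hf : Fil p r a f) (hg : Fil p r a g) : Fil p r a (f + g) := by
  intro η
  rw [MvPolynomial.coeff_add]
  exact ge_add (hf η) (hg η)

lemma Fil_zero (a : ℕ) : Fil p r a 0 := fun η => by rw [MvPolynomial.coeff_zero]; exact ge_zero _

lemma Fil_sum {ι : Type*} {a : ℕ} (t : Finset ι) (f : ι → MvPolynomial B ℚ) (h : ∀ i ∈ t, Fil p r a (f i)) :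
    Fil p r a (∑ i ∈ t, f i) :=
  Finset.sum_induction f (Fil p r a) (fun _ _ => Fil_add r) (Fil_zero r a) h

lemma Fil_monomial {a : ℕ} (η : B →₀ ℕ) (x : ℚ) (h : ge p (sw p r η + if sw p r η < a then 1 else 0) x) :
    Fil p r a (MvPolynomial.monomial η x) := by
  intro θ
  rw [MvPolynomial.coeff_monomial]
  by_cases h1 : η = θ
  · subst h1; simpa using h
  · rw [if_neg h1]; exact ge_zero _

lemma sw_zero : sw p r 0 = 0 := by simp [sw, sg]

lemma Fil_one : Fil p r 0 1 := by
  have := Fil_monomial (p := p) (a := 0) r 0 1 (by rw [sw_zero]; simpa using ge_one)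
  exact this

lemma Fil_prod {ι : Type*} (t : Finset ι) (a : ι → ℕ) (f : ι → MvPolynomial B ℚ) (h : ∀ i ∈ t, Fil p r (a i) (f i)) :
    Fil p r (∑ i ∈ t, a i) (∏ i ∈ t, f i) := by
  induction t using Finset.induction_on with
  | empty => simpa using Fil_one r
  | insert i t ha ih =>
    rw [Finset.sum_insert ha, Finset.prod_insert ha]
    exact Fil_mul r (h i (by simp)) (ih fun i hi => h i (by simp [hi]))

/-- divided powers of a good monomial -/
lemma Fil_dp_monomial {a : ℕ} (ha : 1 ≤ a) (η : B →₀ ℕ) (x : ℚ) (hx : ge p (sw p r η) x) (hη : a ≤ sw p r η) (m : ℕ) :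
    Fil p r (m * a) ((m.factorial : ℚ)⁻¹ • (MvPolynomial.monomial η x) ^ m) := by
  rw [MvPolynomial.monomial_pow, MvPolynomial.smul_monomial]
  apply Fil_monomial
  apply ge_of_eq (n := m.factorial) (Nat.factorial_ne_zero m)
  have h0 : (m.factorial : ℚ) ≠ 0 := by exact_mod_cast Nat.factorial_ne_zero m
  rw [smul_eq_mul, mul_inv_cancel_left₀ h0]
  refine ge_mono ?_ (ge_pow m hx)
  rcases m with _ | m
  · simp [sw_zero]
  rcases m with _ | m
  · simp
    omega
  · have h1 := sw_mul (p := p) r (m + 1 + 1) η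
    have h3 : (if sw p r ((m + 1 + 1) • η) < (m + 1 + 1) * a then 1 else 0) ≤ 1 := by split_ifs <;> omega
    set s := sw p r η
    have h4 : m * 1 ≤ m * s := Nat.mul_le_mul_left _ (by omega)
    have h5 : (m + 1 + 1) * s = m * s + s + s := by ring
    by_cases hd : p ∣ m + 1 + 1
    · have h2 := sw_mul_lt (p := p) r (m + 1 + 1) η hd (by change s ≠ 0; omega)
      have := val_fact_le (p := p) (m + 1)
      change sw p r ((m + 1 + 1) • η) < s at h2
      omega
    · have h6 : padicValNat p (m + 1 + 1).factorial ≤ m := by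
        rw [Nat.factorial_succ, padicValNat.mul (by omega) (Nat.factorial_ne_zero _), padicValNat.eq_zero_of_not_dvd hd, zero_add]
        exact val_fact_le m
      omega

lemma dp_add (f g : MvPolynomial B ℚ) (m : ℕ) : (m.factorial : ℚ)⁻¹ • (f + g) ^ m =
    ∑ i ∈ Finset.range (m + 1), ((i.factorial : ℚ)⁻¹ • f ^ i) * (((m - i).factorial : ℚ)⁻¹ • g ^ (m - i)) := by
  rw [add_pow, Finset.smul_sum]
  refine Finset.sum_congr rfl fun i hi => ?_
  have hi' : i ≤ m := by simpa [Nat.lt_succ_iff] using hi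
  rw [smul_mul_smul_comm]
  have : f ^ i * g ^ (m - i) * (m.choose i : MvPolynomial B ℚ) = (m.choose i : ℚ) • (f ^ i * g ^ (m - i)) := by
    rw [MvPolynomial.smul_eq_C_mul, mul_comm]; simp
  rw [this, smul_smul]
  congr 1
  have h := Nat.choose_mul_factorial_mul_factorial hi'
  have h0 : (m.factorial : ℚ) ≠ 0 := by exact_mod_cast Nat.factorial_ne_zero m
  have h1 : (i.factorial : ℚ) ≠ 0 := by exact_mod_cast Nat.factorial_ne_zero i
  have h2 : ((m - i).factorial : ℚ) ≠ 0 := by exact_mod_cast Nat.factorial_ne_zero (m - i)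
  have h' : (m.choose i : ℚ) * i.factorial * (m - i).factorial = m.factorial := by exact_mod_cast h
  field_simp
  rw [← h']

lemma Fil_dp_add {a : ℕ} {f g : MvPolynomial B ℚ} (hf : ∀ m : ℕ, Fil p r (m * a) ((m.factorial : ℚ)⁻¹ • f ^ m))
    (hg : ∀ m : ℕ, Fil p r (m * a) ((m.factorial : ℚ)⁻¹ • g ^ m)) (m : ℕ) :
    Fil p r (m * a) ((m.factorial : ℚ)⁻¹ • (f + g) ^ m) := by
  rw [dp_add]
  refine Fil_sum r _ _ fun i hi => ?_
  have hi' : i ≤ m := by simpa [Nat.lt_succ_iff] using hi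
  have := Fil_mul r (hf i) (hg (m - i))
  rwa [← add_mul, Nat.add_sub_cancel' hi'] at this

lemma Fil_dp {a : ℕ} (ha : 1 ≤ a) (f : MvPolynomial B ℚ) (hf : ∀ η, ge p (sw p r η) (MvPolynomial.coeff η f))
    (hη : ∀ η, MvPolynomial.coeff η f ≠ 0 → a ≤ sw p r η) (m : ℕ) :
    Fil p r (m * a) ((m.factorial : ℚ)⁻¹ • f ^ m) := by
  rw [MvPolynomial.as_sum f]
  have : ∀ t : Finset (B →₀ ℕ), t ⊆ f.support → ∀ m : ℕ,
      Fil p r (m * a) ((m.factorial : ℚ)⁻¹ • (∑ η ∈ t, MvPolynomial.monomial η (MvPolynomial.coeff η f)) ^ m) := by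
    intro t
    induction t using Finset.induction_on with
    | empty =>
      intro _ m
      rw [Finset.sum_empty]
      rcases m with _ | m
      · simpa using Fil_one r
      · simpa using Fil_zero r _
    | insert η t h ih =>
      intro hs m
      rw [Finset.sum_insert h]
      refine Fil_dp_add r (fun m => ?_) (ih fun x hx => hs (by simp [hx])) m
      exact Fil_dp_monomial r ha η _ (hf η) (hη η (MvPolynomial.mem_support_iff.1 (hs (by simp)))) m
  exact this _ subset_rfl m

end

end CBI

namespace CBI

section
variable {p : ℕ} [hpf : Fact p.Prime]

lemma cdn_int (d : ℤ) (n : ℕ) : ∃ m : ℤ, hh (fun _ => (d : ℚ)) n = m := by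
  have h := hh_zsmul_mem (R := ℚ) (Int.castRingHom ℚ).range (fun _ => (1 : ℚ)) (fun n => by
    rw [hh_one_const]; exact Subring.one_mem _) d n
  have h2 : (d • fun _ : ℕ => (1 : ℚ)) = fun _ => (d : ℚ) := by
    funext i; simp
  rw [h2] at h
  obtain ⟨m, hm⟩ := h
  exact ⟨m, hm.symm⟩

lemma cdn_ge (d : ℤ) (n : ℕ) : ge p (sg p (padicValInt p d) n) (hh (fun _ => (d : ℚ)) n) := by
  have h0 : ∀ n, ge p 0 (hh (fun _ => (d : ℚ)) n) := by
    intro n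
    obtain ⟨m, hm⟩ := cdn_int d n
    rw [hm, ge_int]; simp
  rcases n with _ | n
  · simpa [sg] using h0 0
  by_cases hv : padicValNat p (n + 1) ≤ padicValInt p d
  · apply ge_of_eq (n := n + 1) (by omega)
    have : sg p (padicValInt p d) (n + 1) + padicValNat p (n + 1) = padicValInt p d := by
      simp only [sg, Nat.succ_ne_zero, if_false]; omega
    rw [this]
    have h := hh_succ (fun _ => (d : ℚ)) n
    rw [smul_eq_mul] at h
    rw [h]
    refine ge_sum _ _ fun k _ => ?_
    have := ge_mul (p := p) (s := padicValInt p d) (x := (d : ℚ)) ((ge_int d).2 (padicValInt_dvd _)) (h0 (n - k))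
    simpa using this
  · have : sg p (padicValInt p d) (n + 1) = 0 := by
      simp only [sg, Nat.succ_ne_zero, if_false]; omega
    rw [this]; exact h0 _

variable {B C : Type*} [Fintype B] [DecidableEq B] [Fintype C] [DecidableEq C]

/-- good polynomials of a given degree and colour -/
def Gd (p : ℕ) (r : B → ℕ) (P : B → Prop) (n : ℕ) (f : MvPolynomial B ℚ) : Prop :=
  ∀ η, ge p (sw p r η) (MvPolynomial.coeff η f) ∧ (MvPolynomial.coeff η f ≠ 0 → ∑ b, η b = n ∧ ∀ b, η b ≠ 0 → P b)

lemma Gd_mul (r : B → ℕ) (P : B → Prop) {m n : ℕ} {f g : MvPolynomial B ℚ} (hf : Gd p r P m f) (hg : Gd p r P n g) :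
    Gd p r P (m + n) (f * g) := by
  intro η
  rw [MvPolynomial.coeff_mul]
  constructor
  · refine ge_sum _ _ fun x hx => ?_
    have hx := Finset.HasAntidiagonal.mem_antidiagonal.1 hx
    refine ge_mono ?_ (ge_mul (hf x.1).1 (hg x.2).1)
    rw [← hx]; exact sw_add _ _ _
  · intro h
    obtain ⟨x, hx, h⟩ := Finset.exists_ne_zero_of_sum_ne_zero h
    have hx := Finset.HasAntidiagonal.mem_antidiagonal.1 hx
    obtain ⟨h1, h2⟩ := (hf x.1).2 (left_ne_zero_of_mul h)
    obtain ⟨h3, h4⟩ := (hg x.2).2 (right_ne_zero_of_mul h)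
    rw [← hx]
    constructor
    · simp [Finset.sum_add_distrib, h1, h3]
    · intro b hb
      by_cases hb1 : x.1 b = 0
      · apply h4; simpa [hb1] using hb
      · exact h2 b hb1

lemma Gd_add (r : B → ℕ) (P : B → Prop) {n : ℕ} {f g : MvPolynomial B ℚ} (hf : Gd p r P n f) (hg : Gd p r P n g) :
    Gd p r P n (f + g) := by
  intro η
  rw [MvPolynomial.coeff_add]
  refine ⟨ge_add (hf η).1 (hg η).1, fun h => ?_⟩
  by_cases h1 : MvPolynomial.coeff η f = 0
  · rw [h1, zero_add] at h; exact (hg η).2 h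
  · exact (hf η).2 h1

lemma Gd_zero (r : B → ℕ) (P : B → Prop) (n : ℕ) : Gd p r P n 0 := by
  intro η; simp [ge_zero]

lemma Gd_monomial (r : B → ℕ) (P : B → Prop) (η : B →₀ ℕ) (n : ℕ) (x : ℚ) (hx : ge p (sw p r η) x) (hn : ∑ b, η b = n)
    (hP : ∀ b, η b ≠ 0 → P b) : Gd p r P n (MvPolynomial.monomial η x) := by
  intro θ
  rw [MvPolynomial.coeff_monomial]
  by_cases h1 : η = θ
  · subst h1; simp only [if_true]; exact ⟨hx, fun _ => ⟨hn, hP⟩⟩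
  · simp [h1, ge_zero]

lemma Gd_hh (d : ℤ) (r : B → ℕ) (P : B → Prop) (s : Finset B) (hs : ∀ b ∈ s, P b ∧ r b = padicValInt p d) (n : ℕ) :
    Gd p r P n (hh (fun m => (d : ℚ) • ∑ b ∈ s, (MvPolynomial.X b : MvPolynomial B ℚ) ^ (m + 1)) n) := by
  induction s using Finset.induction_on generalizing n with
  | empty =>
    have : (fun m : ℕ => (d : ℚ) • ∑ b ∈ (∅ : Finset B), (MvPolynomial.X b : MvPolynomial B ℚ) ^ (m + 1)) = 0 := by
      funext m; simp
    rw [this, hh_of_zero]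
    split_ifs with h
    · subst h
      refine Gd_monomial r P 0 0 1 ?_ (by simp) (by simp)
      rw [sw_zero]; exact ge_one
    · exact Gd_zero _ _ _
  | insert a s ha ih =>
    have : (fun m : ℕ => (d : ℚ) • ∑ b ∈ insert a s, (MvPolynomial.X b : MvPolynomial B ℚ) ^ (m + 1)) =
        (fun m : ℕ => (d : ℚ) • (MvPolynomial.X a : MvPolynomial B ℚ) ^ (m + 1)) +
        (fun m : ℕ => (d : ℚ) • ∑ b ∈ s, (MvPolynomial.X b : MvPolynomial B ℚ) ^ (m + 1)) := by
      funext m; simp [Finset.sum_insert ha]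
    rw [this, hh_add]
    refine Finset.sum_induction _ (Gd p r P n) (fun _ _ => Gd_add r P) (Gd_zero r P n) fun k hk => ?_
    have hk' : k ≤ n := by simpa [Nat.lt_succ_iff] using hk
    have h2 := ih (fun b hb => hs b (by simp [hb])) (n - k)
    have h1 : Gd p r P k (hh (fun m : ℕ => (d : ℚ) • (MvPolynomial.X a : MvPolynomial B ℚ) ^ (m + 1)) k) := by
      rw [hh_geom _ (MvPolynomial.X a) (d : ℚ) (fun _ => rfl), MvPolynomial.X_pow_eq_monomial, MvPolynomial.smul_monomial, smul_eq_mul, mul_one]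
      obtain ⟨hP, hr⟩ := hs a (by simp)
      refine Gd_monomial r P _ _ _ ?_ ?_ ?_
      · have : sw p r (Finsupp.single a k) = sg p (padicValInt p d) k := by
          unfold sw
          rw [Finset.sum_eq_single a]
          · rw [hr, Finsupp.single_eq_same]
          · intro b _ hb; rw [Finsupp.single_eq_of_ne hb]; simp [sg]
          · simp
        rw [this]
        exact cdn_ge d k
      · simp
      · intro b hb
        by_cases hab : b = a
        · rw [hab]; exact hP
        · rw [Finsupp.single_eq_of_ne hab] at hb; exact absurd rfl hb
    have := Gd_mul r P h1 h2
    rwa [Nat.add_sub_cancel' hk'] at this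

/-- levels -/
def av (p : ℕ) (r : C → ℕ) (α : C × ℕ →₀ ℕ) : ℕ := α.sum fun i m => m * sg p (r i.1) (i.2 + 1)

/-- factorial parts -/
def zv (p : ℕ) (r : C → ℕ) (α : C × ℕ →₀ ℕ) : ℕ :=
  α.sum fun i m => if padicValNat p (i.2 + 1) < r i.1 then padicValNat p m.factorial else 0

/-- valuations of the multipliers -/
def rv (p : ℕ) (d : C → ℤ) (c : C) : ℕ := padicValInt p (d c)

/-- slots -/
abbrev Slot (α : C × ℕ →₀ ℕ) := (i : {i // i ∈ α.support}) × Fin (α i.1)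

lemma prod_slot {R : Type*} [CommMonoid R] (α : C × ℕ →₀ ℕ) (f : C × ℕ → R) :
    ∏ b : Slot α, f b.1.1 = α.prod fun i m => f i ^ m := by
  rw [Fintype.prod_sigma]
  simp only [Finset.prod_const, Finset.card_univ, Fintype.card_fin]
  rw [Finset.prod_coe_sort α.support (fun i => f i ^ α i)]
  rfl

lemma sum_slot (α : C × ℕ →₀ ℕ) (f : C × ℕ → ℕ) :
    ∑ b : Slot α, f b.1.1 = α.sum fun i m => m * f i := by
  rw [Fintype.sum_sigma]
  simp only [Finset.sum_const, Finset.card_univ, Fintype.card_fin, smul_eq_mul]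
  rw [Finset.sum_coe_sort α.support (fun i => α i * f i)]
  rfl

lemma ev_sub_hp (κ : B → C) (d : C → ℤ) (c : C) (n : ℕ) :
    ev κ (sub (Matrix.diagonal d) (hp c n)) =
      hh (fun m => (d c : ℚ) • ∑ b ∈ Finset.univ.filter (fun b => κ b = c), (MvPolynomial.X b : MvPolynomial B ℚ) ^ (m + 1)) n := by
  have := hh_map ((ev κ).comp (sub (Matrix.diagonal d))) (fun k => (MvPolynomial.X (c, k) : Q C)) n
  rw [AlgHom.comp_apply] at this
  rw [hp, this]
  congr 1
  funext m
  rw [AlgHom.comp_apply, MvPolynomial.X, sub_diag_monomial, MvPolynomial.monomial_eq]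
  simp [dmon, ev, MvPolynomial.smul_eq_C_mul]

theorem A_est (d : C → ℤ) (w : ℕ) (α β : J C w) :
    (p : ℤ) ^ (zv p (rv p d) α.1 + av p (rv p d) β.1 + if av p (rv p d) β.1 < av p (rv p d) α.1 then 1 else 0) ∣ Amat d w α β := by
  obtain ⟨α, hα⟩ := α
  obtain ⟨β, hβ⟩ := β
  rw [← ge_int, Amat_spec, ip_symm, ip_sub, Matrix.diagonal_transpose, ip_symm]
  simp only
  set κ : Slot β → C := fun b => b.1.1.1
  set lam : Slot β →₀ ℕ := Finsupp.equivFunOnFinite.symm (fun b => b.1.1.2 + 1) with hlam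
  set r : Slot β → ℕ := fun b => rv p d (κ b) with hr
  have h1 : hmon β = ∏ b, hz (κ b) (lam b : ℤ) := by
    rw [hmon, ← prod_slot β (fun i => hp i.1 (i.2 + 1))]
    refine Finset.prod_congr rfl fun b _ => ?_
    rw [hz_nat]; rfl
  have h2 : sw p r lam = av p (rv p d) β := by
    rw [av, ← sum_slot β (fun i => sg p (rv p d i.1) (i.2 + 1))]
    rfl
  rw [h1, ip_prod_hz]
  -- the polynomial
  set E : C × ℕ → MvPolynomial (Slot β) ℚ := fun i => ev κ (sub (Matrix.diagonal d) (hp i.1 (i.2 + 1))) with hE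
  have h3 : ev κ (sub (Matrix.diagonal d) (hmon α)) = ∏ i ∈ α.support, E i ^ α i := by
    rw [hmon]
    unfold Finsupp.prod
    simp only [map_prod, map_pow, hE]
  have h4 : ∀ i, Gd p r (fun b => κ b = i.1) (i.2 + 1) (E i) := by
    intro i
    rw [hE]
    simp only
    rw [ev_sub_hp]
    apply Gd_hh
    intro b hb
    have : κ b = i.1 := by simpa using hb
    exact ⟨this, by rw [hr]; simp only [this]; rfl⟩
  have h5 : ∀ i η, MvPolynomial.coeff η (E i) ≠ 0 → sg p (rv p d i.1) (i.2 + 1) ≤ sw p r η := by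
    intro i η h
    obtain ⟨h6, h7⟩ := (h4 i η).2 h
    rw [← h6]
    refine (sg_sum _ _ _).trans (Finset.sum_le_sum fun b _ => ?_)
    by_cases h0 : η b = 0
    · simp [h0, sg]
    · rw [hr]; simp only [h7 b h0]; exact le_rfl
  set ff : C × ℕ → ℚ := fun i => if padicValNat p (i.2 + 1) < rv p d i.1 then ((α i).factorial : ℚ) else 1 with hff
  have hff0 : ∀ i, ff i ≠ 0 := by
    intro i; rw [hff]; simp only; split_ifs
    · exact_mod_cast Nat.factorial_ne_zero _
    · exact one_ne_zero
  have h6 : ∀ i, Fil p r (α i * sg p (rv p d i.1) (i.2 + 1)) ((ff i)⁻¹ • E i ^ α i) := by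
    intro i
    by_cases hi : padicValNat p (i.2 + 1) < rv p d i.1
    · have : ff i = ((α i).factorial : ℚ) := by rw [hff]; simp only [hi, if_true]
      rw [this]
      apply Fil_dp
      · simp only [sg, Nat.succ_ne_zero, if_false]; omega
      · exact fun η => (h4 i η).1
      · exact h5 i
    · have h7 : ff i = 1 := by rw [hff]; simp only [hi, if_false]
      have h8 : sg p (rv p d i.1) (i.2 + 1) = 0 := by simp only [sg, Nat.succ_ne_zero, if_false]; omega
      rw [h7, h8, inv_one, one_smul]
      have h9 : Fil p r 0 (E i) := fun η => by simpa using (h4 i η).1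
      have := Fil_prod r (Finset.range (α i)) (fun _ => 0) (fun _ => E i) (fun _ _ => h9)
      simpa using this
  have h7 := Fil_prod r α.support _ _ (fun i _ => h6 i) lam
  have h8 : ∏ i ∈ α.support, (ff i)⁻¹ • E i ^ α i = (∏ i ∈ α.support, ff i)⁻¹ • ∏ i ∈ α.support, E i ^ α i := by
    rw [Finset.prod_smul, Finset.prod_inv_distrib]
  rw [h8, MvPolynomial.coeff_smul, ← h3, h2] at h7
  set x := MvPolynomial.coeff lam (ev κ (sub (Matrix.diagonal d) (hmon α)))
  have h9 : ge p (zv p (rv p d) α) (∏ i ∈ α.support, ff i) := by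
    refine ge_prod _ _ _ fun i _ => ?_
    rw [hff]; simp only
    split_ifs
    · have := ge_iff_mul (p := p) (n := (α i).factorial) (Nat.factorial_ne_zero _) ge_one
      simpa using this
    · exact ge_one
  have h10 := ge_mul h9 h7
  rw [smul_eq_mul, mul_inv_cancel_left₀ (Finset.prod_ne_zero_iff.2 fun i _ => hff0 i), ← add_assoc] at h10
  exact h10

end
end CBI

namespace CBI
section
variable {C : Type*} [Fintype C] [DecidableEq C]

/-- number of elements of `J C w` having multiplicity at least something of total weight `n` -/
def NN (C : Type*) [Fintype C] (w n : ℕ) : ℕ := if n ≤ w then Fintype.card (J C (w - n)) else 0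

lemma wgt_ge (α : C × ℕ →₀ ℕ) (i : C × ℕ) : α i * (i.2 + 1) ≤ wgt α := by
  have h : α = α.erase i + Finsupp.single i (α i) := (Finsupp.erase_add_single i α).symm
  have : wgt α = wgt (α.erase i) + α i * (i.2 + 1) := by
    conv_lhs => rw [h]
    rw [wgt_add, wgt_single]
  omega

lemma count_ge (w : ℕ) (i : C × ℕ) (m : ℕ) :
    (Finset.univ.filter fun α : J C w => m ≤ α.1 i).card = NN C w (m * (i.2 + 1)) := by
  unfold NN
  split_ifs with h
  · rw [← Fintype.card_subtype]
    refine Fintype.card_congr ⟨fun α => ⟨α.1.1 - Finsupp.single i m, ?_⟩, fun β => ⟨⟨β.1 + Finsupp.single i m, ?_⟩, ?_⟩, ?_, ?_⟩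
    · have h1 : α.1.1 - Finsupp.single i m + Finsupp.single i m = α.1.1 := by
        apply tsub_add_cancel_of_le
        rw [Finsupp.single_le_iff]; exact α.2
      have h2 := α.1.2
      rw [← h1, wgt_add, wgt_single] at h2
      omega
    · rw [wgt_add, wgt_single, β.2]; omega
    · simp
    · rintro ⟨⟨α, h1⟩, h2⟩
      apply Subtype.ext; apply Subtype.ext
      apply tsub_add_cancel_of_le
      rw [Finsupp.single_le_iff]; exact h2
    · rintro ⟨β, h1⟩
      apply Subtype.ext
      simp
  · rw [Finset.card_eq_zero, Finset.filter_eq_empty_iff]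
    rintro ⟨α, hα⟩ _ h2
    have := wgt_ge α i
    have h3 := Nat.mul_le_mul_right (i.2+1) h2
    simp only at h3
    omega

lemma sum_box (w : ℕ) (α : C × ℕ →₀ ℕ) (h : wgt α = w) (f : C × ℕ → ℕ → ℕ) (h0 : ∀ i, f i 0 = 0) :
    α.sum f = ∑ c : C, ∑ j ∈ Finset.range w, f (c, j) (α (c, j)) := by
  rw [← Finset.sum_product']
  unfold Finsupp.sum
  apply Finset.sum_subset
  · intro i hi
    rw [Finsupp.mem_support_iff] at hi
    have := wgt_ge α i
    have h3 : 1 * (i.2 + 1) ≤ α i * (i.2 + 1) := Nat.mul_le_mul_right _ (Nat.pos_of_ne_zero hi)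
    simp
    omega
  · intro i _ hi
    rw [Finsupp.notMem_support_iff] at hi
    rw [hi, h0]

lemma fact_count (p : ℕ) [Fact p.Prime] (w m : ℕ) (hm : m ≤ w) :
    padicValNat p m.factorial = ∑ s ∈ Finset.Icc 1 w, ∑ t ∈ Finset.Icc 1 w, if t * p ^ s ≤ m then 1 else 0 := by
  have hp1 : 1 < p := (Fact.out : p.Prime).one_lt
  have h1 : Nat.log p m < w + 1 := by
    have := Nat.log_le_self p m
    omega
  rw [padicValNat_factorial h1]
  have : Finset.Ico 1 (w+1) = Finset.Icc 1 w := by ext; simp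
  rw [this]
  refine Finset.sum_congr rfl fun s hs => ?_
  rw [← Finset.sum_filter, Finset.sum_const, smul_eq_mul, mul_one]
  have : (Finset.Icc 1 w).filter (fun t => t * p ^ s ≤ m) = Finset.Icc 1 (m / p ^ s) := by
    ext t
    have hpos : 0 < p ^ s := Nat.pow_pos (by omega)
    simp only [Finset.mem_filter, Finset.mem_Icc, Nat.le_div_iff_mul_le hpos]
    constructor
    · rintro ⟨⟨a, b⟩, c⟩; exact ⟨a, c⟩
    · rintro ⟨a, c⟩
      refine ⟨⟨a, ?_⟩, c⟩
      nlinarith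
  rw [this]; simp

lemma min_count (r v w m : ℕ) (hv : m ≠ 0 → v ≤ w) (hm : m ≤ w) :
    m * min r v = ∑ s ∈ Finset.Icc 1 w, ∑ t ∈ Finset.Icc 1 w, if s ≤ v ∧ v < r + s ∧ t ≤ m then 1 else 0 := by
  have h1 : ∀ s ∈ Finset.Icc 1 w, (∑ t ∈ Finset.Icc 1 w, if s ≤ v ∧ v < r + s ∧ t ≤ m then 1 else 0) = if s ≤ v ∧ v < r + s then m else 0 := by
    intro s _
    split_ifs with h
    · have : ∀ t, (if s ≤ v ∧ v < r + s ∧ t ≤ m then (1:ℕ) else 0) = if t ≤ m then 1 else 0 := by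
        intro t; simp [h]
      simp only [this]
      rw [← Finset.sum_filter, Finset.sum_const, smul_eq_mul, mul_one]
      have : (Finset.Icc 1 w).filter (fun t => t ≤ m) = Finset.Icc 1 m := by ext t; simp; omega
      rw [this]; simp
    · apply Finset.sum_eq_zero
      intro t _
      rw [if_neg]; tauto
  rw [Finset.sum_congr rfl h1, ← Finset.sum_filter, Finset.sum_const, smul_eq_mul]
  by_cases hm0 : m = 0
  · simp [hm0]
  rw [mul_comm]
  congr 1
  have : (Finset.Icc 1 w).filter (fun s => s ≤ v ∧ v < r + s) = Finset.Icc (v - min r v + 1) v := by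
    ext s; simp; have := hv hm0; omega
  rw [this, Nat.card_Icc]; omega

lemma shift_sum (p : ℕ) [Fact p.Prime] (w r s : ℕ) (hs : 1 ≤ s) (t : ℕ) (ht : 1 ≤ t) (N : ℕ → ℕ) (hN : ∀ n, w < n → N n = 0) :
    ∑ j ∈ Finset.range w, (if padicValNat p (j+1) < r then N (t * p ^ s * (j + 1)) else 0) =
    ∑ j ∈ Finset.range w, (if s ≤ padicValNat p (j+1) ∧ padicValNat p (j+1) < r + s then N (t * (j + 1)) else 0) := by
  have hpp : p.Prime := Fact.out
  have hpos : 0 < p ^ s := Nat.pow_pos hpp.pos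
  have hval : ∀ j, padicValNat p ((j + 1) * p ^ s) = padicValNat p (j+1) + s := by
    intro j
    rw [padicValNat.mul (by omega) (by omega), padicValNat.prime_pow]
  have hne : ∀ j, (j + 1) * p ^ s - 1 + 1 = (j + 1) * p ^ s := by
    intro j
    have : 0 < (j + 1) * p ^ s := by positivity
    omega
  refine Finset.sum_bij_ne_zero (fun j _ _ => (j + 1) * p ^ s - 1) ?_ ?_ ?_ ?_
  · intro j hj h
    rw [Finset.mem_range] at *
    have h1 : ¬ w < t * p ^ s * (j + 1) := by
      intro h1; apply h; rw [hN _ h1]; simp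
    have : (j + 1) * p ^ s ≤ t * ((j + 1) * p ^ s) := Nat.le_mul_of_pos_left _ ht
    have h3 : t * ((j + 1) * p ^ s) = t * p ^ s * (j + 1) := by ring
    have := hne j
    omega
  · intro j _ _ j' _ _ h
    have h1 := hne j
    have h2 := hne j'
    rw [h, h2] at h1
    have := Nat.eq_of_mul_eq_mul_right hpos h1
    omega
  · intro j' hj' h
    have h1 : s ≤ padicValNat p (j' + 1) ∧ padicValNat p (j' + 1) < r + s := by
      by_contra h1; rw [if_neg h1] at h; exact h rfl
    rw [if_pos h1] at h
    have h2 : p ^ s ∣ j' + 1 := (padicValNat_dvd_iff_le (by omega)).2 h1.1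
    obtain ⟨q, hq⟩ := h2
    have hq0 : q ≠ 0 := by rintro rfl; simp at hq
    obtain ⟨j, rfl⟩ := Nat.exists_eq_succ_of_ne_zero hq0
    rw [Nat.succ_eq_add_one] at hq
    have h4 : j' + 1 = (j + 1) * p ^ s := by rw [hq]; ring
    refine ⟨j, ?_, ?_, ?_⟩
    · rw [Finset.mem_range] at *
      have : j + 1 ≤ (j + 1) * p ^ s := Nat.le_mul_of_pos_right _ hpos
      omega
    · rw [h4, hval] at h1
      rw [if_pos (by omega)]
      rw [h4] at h
      have : t * p ^ s * (j + 1) = t * ((j + 1) * p ^ s) := by ring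
      rwa [this]
    · omega
  · intro j hj h
    rw [hne, hval]
    have : t * p ^ s * (j + 1) = t * ((j + 1) * p ^ s) := by ring
    rw [this]
    have : (padicValNat p (j + 1) < r) ↔ (s ≤ padicValNat p (j + 1) + s ∧ padicValNat p (j + 1) + s < r + s) := by omega
    simp only [this]

lemma sum_count (w : ℕ) (P : Prop) [Decidable P] (i : C × ℕ) (m : ℕ) :
    ∑ α : J C w, (if P ∧ m ≤ α.1 i then 1 else 0) = if P then NN C w (m * (i.2 + 1)) else 0 := by
  split_ifs with h
  · rw [← count_ge, Finset.card_filter]; simp [h]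
  · simp [h]

theorem val_id (p : ℕ) [Fact p.Prime] (r : C → ℕ) (w : ℕ) :
    ∑ α : J C w, (av p r α.1 + zv p r α.1) = ∑ α : J C w, α.1.sum fun i m => m * r i.1 := by
  have hle : ∀ (α : J C w) (i), α.1 i ≤ w := by
    intro α i
    have := wgt_ge α.1 i
    rw [α.2] at this
    nlinarith
  have h1 : ∀ α : J C w, zv p r α.1 = ∑ s ∈ Finset.Icc 1 w, ∑ t ∈ Finset.Icc 1 w, ∑ c : C, ∑ j ∈ Finset.range w, if padicValNat p (j+1) < r c ∧ t * p ^ s ≤ α.1 (c, j) then 1 else 0 := by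
    intro α
    unfold zv
    rw [sum_box w _ α.2 _ (by intro i; simp)]
    have : ∀ c : C, ∀ j, (if padicValNat p (j+1) < r c then padicValNat p (α.1 (c, j)).factorial else 0) = ∑ s ∈ Finset.Icc 1 w, ∑ t ∈ Finset.Icc 1 w, if padicValNat p (j+1) < r c ∧ t * p ^ s ≤ α.1 (c, j) then 1 else 0 := by
      intro c j
      split_ifs with h
      · rw [fact_count p w _ (hle _ _)]; simp [h]
      · simp [h]
    simp only [this]
    rw [Finset.sum_congr rfl fun c _ => Finset.sum_comm, Finset.sum_comm]
    refine Finset.sum_congr rfl fun s _ => ?_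
    rw [Finset.sum_congr rfl fun c _ => Finset.sum_comm, Finset.sum_comm]
  have h2 : ∀ α : J C w, (α.1.sum fun i m => m * min (r i.1) (padicValNat p (i.2 + 1))) = ∑ s ∈ Finset.Icc 1 w, ∑ t ∈ Finset.Icc 1 w, ∑ c : C, ∑ j ∈ Finset.range w, if (s ≤ padicValNat p (j+1) ∧ padicValNat p (j+1) < r c + s) ∧ t ≤ α.1 (c, j) then 1 else 0 := by
    intro α
    rw [sum_box w _ α.2 _ (by intro i; simp)]
    have : ∀ c : C, ∀ j, α.1 (c, j) * min (r c) (padicValNat p (j+1)) = ∑ s ∈ Finset.Icc 1 w, ∑ t ∈ Finset.Icc 1 w, if (s ≤ padicValNat p (j+1) ∧ padicValNat p (j+1) < r c + s) ∧ t ≤ α.1 (c, j) then 1 else 0 := by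
      intro c j
      rw [min_count (r c) (padicValNat p (j+1)) w _ ?_ (hle _ _)]
      · simp only [and_assoc]
      · intro h
        have h3 := wgt_ge α.1 (c, j)
        rw [α.2] at h3
        have h4 : 1 * (j + 1) ≤ α.1 (c, j) * (j + 1) := Nat.mul_le_mul_right _ (Nat.pos_of_ne_zero h)
        have h5 : padicValNat p (j + 1) ≤ j := by
          have := padicValNat_le_nat_log (p := p) (j + 1)
          have h6 := Nat.log_lt_self p (x := j + 1) (by omega)
          omega
        simp only at h3
        omega
    simp only [this]
    rw [Finset.sum_congr rfl fun c _ => Finset.sum_comm, Finset.sum_comm]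
    refine Finset.sum_congr rfl fun s _ => ?_
    rw [Finset.sum_congr rfl fun c _ => Finset.sum_comm, Finset.sum_comm]
  have h3 : ∑ α : J C w, zv p r α.1 = ∑ α : J C w, α.1.sum fun i m => m * min (r i.1) (padicValNat p (i.2 + 1)) := by
    simp only [h1, h2]
    rw [Finset.sum_comm]
    conv_rhs => rw [Finset.sum_comm]
    refine Finset.sum_congr rfl fun s hs => ?_
    rw [Finset.sum_comm]
    conv_rhs => rw [Finset.sum_comm]
    refine Finset.sum_congr rfl fun t ht => ?_
    rw [Finset.sum_comm]
    conv_rhs => rw [Finset.sum_comm]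
    refine Finset.sum_congr rfl fun c _ => ?_
    rw [Finset.sum_comm]
    conv_rhs => rw [Finset.sum_comm]
    simp only [sum_count]
    apply shift_sum
    · exact (Finset.mem_Icc.1 hs).1
    · exact (Finset.mem_Icc.1 ht).1
    · intro n hn
      unfold NN; rw [if_neg (by omega)]
  rw [Finset.sum_add_distrib, h3, ← Finset.sum_add_distrib]
  refine Finset.sum_congr rfl fun α _ => ?_
  unfold av Finsupp.sum
  rw [← Finset.sum_add_distrib]
  refine Finset.sum_congr rfl fun i _ => ?_
  rw [← mul_add]
  congr 1
  simp only [sg, Nat.succ_ne_zero, if_false]; omega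

end
end CBI

namespace CBI
section
universe u
variable {R : Type*} [CommRing R]

/-- equivalence of square matrices -/
def Eqv {ι : Type*} [Fintype ι] [DecidableEq ι] (A B : Matrix ι ι R) : Prop :=
  ∃ P V : Matrix ι ι R, IsUnit P ∧ IsUnit V ∧ P * A * V = B

lemma Eqv.refl {ι : Type*} [Fintype ι] [DecidableEq ι] (A : Matrix ι ι R) : Eqv A A :=
  ⟨1, 1, isUnit_one, isUnit_one, by simp⟩

lemma Eqv.trans {ι : Type*} [Fintype ι] [DecidableEq ι] {A B D : Matrix ι ι R} (h : Eqv A B) (h' : Eqv B D) : Eqv A D := by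
  obtain ⟨P, V, h1, h2, rfl⟩ := h
  obtain ⟨P', V', h1', h2', rfl⟩ := h'
  exact ⟨P' * P, V * V', h1'.mul h1, h2.mul h2', by simp only [Matrix.mul_assoc]⟩

lemma Eqv.symm {ι : Type*} [Fintype ι] [DecidableEq ι] {A B : Matrix ι ι R} (h : Eqv A B) : Eqv B A := by
  obtain ⟨P, V, ⟨P', rfl⟩, ⟨V', rfl⟩, rfl⟩ := h
  refine ⟨(P'⁻¹).1, (V'⁻¹).1, Units.isUnit _, Units.isUnit _, ?_⟩
  simp only [Matrix.mul_assoc, Units.mul_inv, Matrix.mul_one]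
  rw [← Matrix.mul_assoc, Units.inv_mul, Matrix.one_mul]

lemma isUnit_submatrix {ι ι' : Type*} [Fintype ι] [DecidableEq ι] [Fintype ι'] [DecidableEq ι'] (e : ι' ≃ ι) (P : Matrix ι ι R) (h : IsUnit P) :
    IsUnit (P.submatrix e e) := by
  rw [Matrix.isUnit_iff_isUnit_det] at *
  rwa [Matrix.det_submatrix_equiv_self]

lemma Eqv.reindex {ι ι' : Type*} [Fintype ι] [DecidableEq ι] [Fintype ι'] [DecidableEq ι'] (e : ι' ≃ ι) {A B : Matrix ι ι R} (h : Eqv A B) :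
    Eqv (A.submatrix e e) (B.submatrix e e) := by
  obtain ⟨P, V, h1, h2, rfl⟩ := h
  refine ⟨P.submatrix e e, V.submatrix e e, isUnit_submatrix _ _ h1, isUnit_submatrix _ _ h2, ?_⟩
  rw [Matrix.submatrix_mul_equiv, Matrix.submatrix_mul_equiv]

lemma Eqv.of_reindex {ι ι' : Type*} [Fintype ι] [DecidableEq ι] [Fintype ι'] [DecidableEq ι'] (e : ι' ≃ ι) {A B : Matrix ι ι R}
    (h : Eqv (A.submatrix e e) (B.submatrix e e)) : Eqv A B := by
  have := h.reindex e.symm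
  simpa using this

lemma Eqv.map {S : Type*} [CommRing S] (f : R →+* S) {ι : Type*} [Fintype ι] [DecidableEq ι] {A B : Matrix ι ι R} (h : Eqv A B) : Eqv (A.map f) (B.map f) := by
  obtain ⟨P, V, h1, h2, rfl⟩ := h
  refine ⟨P.map f, V.map f, h1.map f.mapMatrix, h2.map f.mapMatrix, ?_⟩
  rw [Matrix.map_mul, Matrix.map_mul]

lemma Eqv.blocks {m n : Type*} [Fintype m] [DecidableEq m] [Fintype n] [DecidableEq n] {A A' : Matrix m m R} {D D' : Matrix n n R}
    (h : Eqv A A') (h' : Eqv D D') : Eqv (Matrix.fromBlocks A 0 0 D) (Matrix.fromBlocks A' 0 0 D') := by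
  obtain ⟨P, V, h1, h2, rfl⟩ := h
  obtain ⟨P', V', h1', h2', rfl⟩ := h'
  refine ⟨Matrix.fromBlocks P 0 0 P', Matrix.fromBlocks V 0 0 V', ?_, ?_, ?_⟩
  · rw [Matrix.isUnit_iff_isUnit_det] at *
    rw [Matrix.det_fromBlocks_zero₂₁]; exact h1.mul h1'
  · rw [Matrix.isUnit_iff_isUnit_det] at *
    rw [Matrix.det_fromBlocks_zero₂₁]; exact h2.mul h2'
  · simp [Matrix.fromBlocks_multiply]

/-- one step -/
lemma loc_step [IsLocalRing R] (π : R) {m n : Type*} [Fintype m] [DecidableEq m] [Fintype n] [DecidableEq n] (a0 : ℕ)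
    (z1 : m → ℕ) (z2 a2 : n → ℕ) (ha : ∀ i, a0 < a2 i) (Y11 : Matrix m m R) (Y12 : Matrix m n R) (Y21 : Matrix n m R) (Y22 : Matrix n n R)
    (hY : IsUnit (Matrix.fromBlocks Y11 Y12 Y21 Y22).det)
    (h21 : ∀ i j, Y21 i j ∈ IsLocalRing.maximalIdeal R)
    (hsym : (Matrix.diagonal (fun i => π ^ Sum.elim z1 z2 i) * Matrix.fromBlocks Y11 Y12 Y21 Y22 * Matrix.diagonal (fun i => π ^ Sum.elim (fun _ => a0) a2 i)).transpose =
      Matrix.diagonal (fun i => π ^ Sum.elim z1 z2 i) * Matrix.fromBlocks Y11 Y12 Y21 Y22 * Matrix.diagonal (fun i => π ^ Sum.elim (fun _ => a0) a2 i)) :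
    ∃ Y' : Matrix n n R, IsUnit Y'.det ∧ (∀ i j, Y22 i j ∈ IsLocalRing.maximalIdeal R → Y' i j ∈ IsLocalRing.maximalIdeal R) ∧
      (Matrix.diagonal (fun i => π ^ z2 i) * Y' * Matrix.diagonal (fun i => π ^ a2 i)).transpose = (Matrix.diagonal (fun i => π ^ z2 i) * Y' * Matrix.diagonal (fun i => π ^ a2 i)) ∧
      Eqv (Matrix.diagonal (fun i => π ^ Sum.elim z1 z2 i) * Matrix.fromBlocks Y11 Y12 Y21 Y22 * Matrix.diagonal (fun i => π ^ Sum.elim (fun _ => a0) a2 i))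
       (Matrix.fromBlocks (Matrix.diagonal fun i => π ^ (z1 i + a0)) 0 0 (Matrix.diagonal (fun i => π ^ z2 i) * Y' * Matrix.diagonal (fun i => π ^ a2 i))) := by
  have hd : IsUnit Y11.det := by
    have h1 := hY.map (IsLocalRing.residue R)
    rw [RingHom.map_det] at h1
    have h2 : (IsLocalRing.residue R).mapMatrix (Matrix.fromBlocks Y11 Y12 Y21 Y22) = Matrix.fromBlocks (Y11.map (IsLocalRing.residue R)) (Y12.map (IsLocalRing.residue R)) 0 (Y22.map (IsLocalRing.residue R)) := by
      rw [RingHom.mapMatrix_apply, Matrix.fromBlocks_map]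
      congr 1
      ext i j
      simpa using (IsLocalRing.residue_eq_zero_iff _).2 (h21 i j)
    rw [h2, Matrix.det_fromBlocks_zero₂₁] at h1
    have h3 := isUnit_of_mul_isUnit_left h1
    have h4 : (Y11.map (IsLocalRing.residue R)).det = IsLocalRing.residue R Y11.det := by
      rw [RingHom.map_det]; rfl
    rw [h4] at h3
    exact isUnit_of_map_unit _ _ h3
  have hW : Y11 * Y11⁻¹ = 1 := Matrix.mul_nonsing_inv _ hd
  have hW' : Y11⁻¹ * Y11 = 1 := Matrix.nonsing_inv_mul _ hd
  have hWu : IsUnit Y11⁻¹ := IsUnit.of_mul_eq_one _ hW'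
  set W := Y11⁻¹ with hWdef
  have hdg : ∀ (u : m → ℕ) (v : n → ℕ), Matrix.diagonal (fun i => π ^ Sum.elim u v i) = Matrix.fromBlocks (Matrix.diagonal fun i => π ^ u i) 0 0 (Matrix.diagonal fun i => π ^ v i) := by
    intro u v
    rw [Matrix.fromBlocks_diagonal]
    congr 1
    ext i; cases i <;> rfl
  have hdA : Matrix.diagonal (fun i => π ^ Sum.elim z1 z2 i) * Matrix.fromBlocks Y11 Y12 Y21 Y22 * Matrix.diagonal (fun i => π ^ Sum.elim (fun _ => a0) a2 i) =
    Matrix.fromBlocks (Matrix.diagonal (fun i => π ^ z1 i) * Y11 * Matrix.diagonal (fun _ => π ^ a0)) (Matrix.diagonal (fun i => π ^ z1 i) * Y12 * Matrix.diagonal (fun i => π ^ a2 i))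
     (((Matrix.diagonal (fun i => π ^ z2 i) : Matrix n n R) * Y21 : Matrix n m R) * (Matrix.diagonal (fun _ => π ^ a0) : Matrix m m R) : Matrix n m R) (Matrix.diagonal (fun i => π ^ z2 i) * Y22 * Matrix.diagonal (fun i => π ^ a2 i)) := by
    rw [hdg, hdg (fun _ => a0)]
    simp only [Matrix.fromBlocks_multiply, Matrix.zero_mul, Matrix.mul_zero, add_zero, zero_add]
  rw [hdA] at hsym ⊢
  rw [Matrix.fromBlocks_transpose, Matrix.fromBlocks_inj] at hsym
  obtain ⟨s11, s12, s21, s22⟩ := hsym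
  set A11 : Matrix m m R := Matrix.diagonal (fun i => π ^ z1 i) * Y11 * Matrix.diagonal (fun _ => π ^ a0) with hA11
  set A12 : Matrix m n R := Matrix.diagonal (fun i => π ^ z1 i) * Y12 * Matrix.diagonal (fun i => π ^ a2 i) with hA12
  set A21 : Matrix n m R := (((Matrix.diagonal (fun i => π ^ z2 i) : Matrix n n R) * Y21 : Matrix n m R) * (Matrix.diagonal (fun _ => π ^ a0) : Matrix m m R) : Matrix n m R) with hA21
  set A22 : Matrix n n R := Matrix.diagonal (fun i => π ^ z2 i) * Y22 * Matrix.diagonal (fun i => π ^ a2 i) with hA22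
  set R12 : Matrix m n R := W * Y12 * Matrix.diagonal (fun i => π ^ (a2 i - a0)) with hR12
  have hda : (Matrix.diagonal (fun _ => π ^ a0) : Matrix m m R) = π ^ a0 • 1 := by
    rw [Matrix.smul_one_eq_diagonal]
  have hda2 : (π ^ a0) • (Matrix.diagonal (fun i => π ^ (a2 i - a0)) : Matrix n n R) = Matrix.diagonal (fun i => π ^ a2 i) := by
    rw [← Matrix.diagonal_smul]
    congr 1
    ext i
    simp only [Pi.smul_apply, smul_eq_mul]
    rw [← pow_add]; congr 1; have := ha i; omega
  have e1 : A11 * R12 = A12 := by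
    rw [hA11, hR12, hA12, hda, ← hda2]
    simp only [Matrix.mul_smul, Matrix.smul_mul, Matrix.mul_one, Matrix.mul_assoc]
    rw [← Matrix.mul_assoc Y11 W, hW, Matrix.one_mul]
  have e2 : R12.transpose * A11 = A21 := by
    rw [← s21, ← e1, Matrix.transpose_mul A11 R12, s11]
  have e3 : A21 * R12 = Matrix.diagonal (fun i => π ^ z2 i) * (Y21 * W * Y12) * Matrix.diagonal (fun i => π ^ a2 i) := by
    rw [hA21, hR12, hda, ← hda2]
    simp only [Matrix.mul_smul, Matrix.smul_mul, Matrix.mul_one, Matrix.mul_assoc]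
  have e4 : A22 - A21 * R12 = Matrix.diagonal (fun i => π ^ z2 i) * (Y22 - Y21 * W * Y12) * Matrix.diagonal (fun i => π ^ a2 i) := by
    rw [e3, hA22, Matrix.mul_sub, Matrix.sub_mul]
  refine ⟨Y22 - Y21 * W * Y12, ?_, ?_, ?_, ?_⟩
  · letI : Invertible Y11 := Matrix.invertibleOfIsUnitDet _ hd
    rw [Matrix.det_fromBlocks₁₁, Matrix.invOf_eq_nonsing_inv] at hY
    exact isUnit_of_mul_isUnit_right hY
  · intro i j h
    rw [Matrix.sub_apply]
    refine Ideal.sub_mem _ h ?_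
    rw [Matrix.mul_assoc, Matrix.mul_apply]
    exact Ideal.sum_mem _ fun k _ => Ideal.mul_mem_right _ _ (h21 i k)
  · rw [← e4, Matrix.transpose_sub, s22, ← e2, Matrix.mul_assoc, Matrix.transpose_mul, Matrix.transpose_mul, s11, Matrix.transpose_transpose, Matrix.mul_assoc]
  · rw [← e4]
    have h1 : Eqv (Matrix.fromBlocks A11 A12 A21 A22) (Matrix.fromBlocks A11 0 0 (A22 - A21 * R12)) := by
      refine ⟨Matrix.fromBlocks 1 0 (-R12.transpose) 1, Matrix.fromBlocks 1 (-R12) 0 1, ?_, ?_, ?_⟩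
      · rw [Matrix.isUnit_iff_isUnit_det, Matrix.det_fromBlocks_zero₁₂]; simp
      · rw [Matrix.isUnit_iff_isUnit_det, Matrix.det_fromBlocks_zero₂₁]; simp
      · rw [Matrix.fromBlocks_multiply, Matrix.fromBlocks_multiply]
        congr 1
        · simp
        · simp [e1]
        · simp [e2]
        · simp [e2, ← e1, ← Matrix.mul_assoc]
          abel
    refine h1.trans (Eqv.blocks ⟨1, W, isUnit_one, hWu, ?_⟩ (Eqv.refl _))
    rw [Matrix.one_mul, hA11, hda]
    simp only [Matrix.mul_smul, Matrix.smul_mul, Matrix.mul_one, Matrix.mul_assoc, hW]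
    rw [← Matrix.diagonal_smul]
    congr 1
    ext i
    simp [pow_add, mul_comm]

lemma loc_main [IsLocalRing R] (π : R) (N : ℕ) : ∀ (ι : Type u) [Fintype ι] [DecidableEq ι] (_ : Fintype.card ι = N) (z a : ι → ℕ) (Y : Matrix ι ι R)
    (_ : IsUnit Y.det) (_ : ∀ i j, a j < a i → Y i j ∈ IsLocalRing.maximalIdeal R)
    (_ : (Matrix.diagonal (fun i => π ^ z i) * Y * Matrix.diagonal (fun i => π ^ a i)).transpose = Matrix.diagonal (fun i => π ^ z i) * Y * Matrix.diagonal (fun i => π ^ a i)),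
    Eqv (Matrix.diagonal (fun i => π ^ z i) * Y * Matrix.diagonal (fun i => π ^ a i)) (Matrix.diagonal fun i => π ^ (z i + a i)) := by
  induction N using Nat.strong_induction_on with
  | _ N ih =>
  intro ι _ _ hN z a Y hY hm hs
  by_cases hne : IsEmpty ι
  · refine ⟨1, 1, isUnit_one, isUnit_one, ?_⟩
    ext i; exact hne.elim i
  rw [not_isEmpty_iff] at hne
  obtain ⟨i0, hi0⟩ := Finite.exists_min a
  set p : ι → Prop := fun i => a i = a i0 with hp'
  let e : {i // p i} ⊕ {i // ¬ p i} ≃ ι := Equiv.sumCompl p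
  apply Eqv.of_reindex e
  have hsz : ∀ u : ι → ℕ, (Matrix.diagonal (fun i => π ^ u i)).submatrix e e = Matrix.diagonal (fun i => π ^ Sum.elim (fun i : {i // p i} => u i.1) (fun i : {i // ¬ p i} => u i.1) i) := by
    intro u
    rw [Matrix.submatrix_diagonal_equiv]
    congr 1; ext i; cases i <;> rfl
  have hsz2 : (Matrix.diagonal (fun i => π ^ a i)).submatrix e e = Matrix.diagonal (fun i => π ^ Sum.elim (fun _ : {i // p i} => a i0) (fun i : {i // ¬ p i} => a i.1) i) := by
    rw [hsz]; congr 1; ext i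
    rcases i with i | i
    · simp only [Sum.elim_inl]; rw [i.2]
    · rfl
  have hYb : Y.submatrix e e = Matrix.fromBlocks (Y.submatrix e e).toBlocks₁₁ (Y.submatrix e e).toBlocks₁₂ (Y.submatrix e e).toBlocks₂₁ (Y.submatrix e e).toBlocks₂₂ := (Matrix.fromBlocks_toBlocks _).symm
  have hA : (Matrix.diagonal (fun i => π ^ z i) * Y * Matrix.diagonal (fun i => π ^ a i)).submatrix e e =
     Matrix.diagonal (fun i => π ^ Sum.elim (fun i : {i // p i} => z i.1) (fun i : {i // ¬ p i} => z i.1) i) * Matrix.fromBlocks (Y.submatrix e e).toBlocks₁₁ (Y.submatrix e e).toBlocks₁₂ (Y.submatrix e e).toBlocks₂₁ (Y.submatrix e e).toBlocks₂₂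
      * Matrix.diagonal (fun i => π ^ Sum.elim (fun _ : {i // p i} => a i0) (fun i : {i // ¬ p i} => a i.1) i) := by
    rw [← hYb, ← hsz, ← hsz2, Matrix.submatrix_mul_equiv, Matrix.submatrix_mul_equiv]
  have hlt : ∀ i : {i // ¬ p i}, a i0 < a i.1 := fun i => lt_of_le_of_ne (hi0 _) (fun h => i.2 h.symm)
  obtain ⟨Y', h1, h2, h3, h4⟩ := loc_step π (a i0) (fun i : {i // p i} => z i.1) (fun i : {i // ¬ p i} => z i.1) (fun i : {i // ¬ p i} => a i.1) hlt
    (Y.submatrix e e).toBlocks₁₁ (Y.submatrix e e).toBlocks₁₂ (Y.submatrix e e).toBlocks₂₁ (Y.submatrix e e).toBlocks₂₂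
    (by rw [← hYb, Matrix.det_submatrix_equiv_self]; exact hY)
    (by
      intro i j
      refine hm i.1 j.1 ?_
      have h1 := hlt i
      have h2 : a j.1 = a i0 := j.2
      omega)
    (by rw [← hA, Matrix.transpose_submatrix, hs])
  rw [hA]
  refine h4.trans ?_
  have hcard : Fintype.card {i // ¬ p i} < N := by
    rw [← hN]; exact Fintype.card_subtype_lt (x := i0) (by simp [hp'])
  have h5 := ih _ hcard {i // ¬ p i} rfl (fun i => z i.1) (fun i => a i.1) Y' h1 (fun i j hij => h2 i j (hm i.1 j.1 hij)) h3
  have h6 := Eqv.blocks (Eqv.refl (Matrix.diagonal fun i : {i // p i} => π ^ (z i.1 + a i0))) h5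
  convert h6 using 1
  rw [Matrix.submatrix_diagonal_equiv, Matrix.fromBlocks_diagonal]
  congr 1
  ext i
  rcases i with i | i
  · have : a i.1 = a i0 := i.2
    simp only [Sum.elim_inl, Function.comp, ← this]; rfl
  · rfl

end
end CBI

namespace CBI
section
variable {C : Type*} [Fintype C] [DecidableEq C]

lemma dmon_val (p : ℕ) [Fact p.Prime] (d : C → ℤ) (hd : ∀ c, d c ≠ 0) (ν : C × ℕ →₀ ℕ) :
    dmon d ν ≠ 0 ∧ padicValInt p (dmon d ν) = ν.sum fun i m => m * rv p d i.1 := by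
  unfold dmon Finsupp.prod Finsupp.sum
  induction ν.support using Finset.induction_on with
  | empty => simp
  | insert i s hi ih =>
    rw [Finset.prod_insert hi, Finset.sum_insert hi]
    have h1 : d i.1 ^ ν i ≠ 0 := pow_ne_zero _ (hd _)
    refine ⟨mul_ne_zero h1 ih.1, ?_⟩
    rw [padicValInt.mul h1 ih.1, ih.2]
    congr 1
    rw [padicValInt, Int.natAbs_pow, padicValNat.pow]
    rfl

lemma prod_val (p : ℕ) [Fact p.Prime] {ι : Type*} (s : Finset ι) (f : ι → ℤ) (hf : ∀ i, f i ≠ 0) :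
    ∏ i ∈ s, f i ≠ 0 ∧ padicValInt p (∏ i ∈ s, f i) = ∑ i ∈ s, padicValInt p (f i) := by
  induction s using Finset.induction_on with
  | empty => simp
  | insert i s hi ih =>
    rw [Finset.prod_insert hi, Finset.sum_insert hi]
    refine ⟨mul_ne_zero (hf i) ih.1, ?_⟩
    rw [padicValInt.mul (hf i) ih.1, ih.2]

theorem loc_A (p : ℕ) [hpp : Fact p.Prime] (d : C → ℤ) (hd : ∀ c, d c ≠ 0) (w k : ℕ) :
    Eqv ((Amat d w).map (Int.castRingHom (ZMod (p ^ k))))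
      (Matrix.diagonal fun α : J C w => (p : ZMod (p ^ k)) ^ (zv p (rv p d) α.1 + av p (rv p d) α.1)) := by
  have hp0 : (p : ℤ) ≠ 0 := by exact_mod_cast hpp.out.ne_zero
  set z : J C w → ℕ := fun α => zv p (rv p d) α.1 with hz
  set a : J C w → ℕ := fun α => av p (rv p d) α.1 with ha
  have h1 : ∀ α β, ∃ y : ℤ, Amat d w α β = (p : ℤ) ^ z α * y * (p : ℤ) ^ a β ∧ (a β < a α → (p : ℤ) ∣ y) := by
    intro α β
    obtain ⟨y, hy⟩ := A_est (p := p) d w α β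
    refine ⟨(p : ℤ) ^ (if a β < a α then 1 else 0) * y, ?_, ?_⟩
    · rw [hy, pow_add, pow_add]; ring
    · intro h; rw [if_pos h]; simp
  choose y hy hy' using h1
  let Y : Matrix (J C w) (J C w) ℤ := Matrix.of y
  have hA : Amat d w = Matrix.diagonal (fun i => (p : ℤ) ^ z i) * Y * Matrix.diagonal (fun i => (p : ℤ) ^ a i) := by
    ext α β
    rw [Matrix.mul_diagonal, Matrix.diagonal_mul]
    exact hy α β
  have hdet : ¬ (p : ℤ) ∣ Y.det := by
    have h2 := Amat_det d w
    have h3 : padicValInt p (∏ ν : J C w, dmon d ν.1) = ∑ α : J C w, (a α + z α) := by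
      rw [(prod_val p _ _ fun ν : J C w => (dmon_val p d hd ν.1).1).2]
      rw [Finset.sum_congr rfl fun (ν : J C w) _ => (dmon_val p d hd ν.1).2]
      exact (val_id p (rv p d) w).symm
    rw [← h2, hA, Matrix.det_mul, Matrix.det_mul, Matrix.det_diagonal, Matrix.det_diagonal, Finset.prod_pow_eq_pow_sum, Finset.prod_pow_eq_pow_sum,
      mul_right_comm, ← pow_add] at h3
    have h0 : Y.det ≠ 0 := by
      intro h0
      have := (prod_val p Finset.univ _ fun ν : J C w => (dmon_val p d hd ν.1).1).1
      rw [← h2, hA, Matrix.det_mul, Matrix.det_mul, h0] at this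
      simp at this
    rw [padicValInt.mul (pow_ne_zero _ hp0) h0, padicValInt, Int.natAbs_pow, Int.natAbs_natCast, padicValNat.prime_pow, Finset.sum_add_distrib] at h3
    intro hdv
    have : 1 ≤ padicValInt p Y.det := by
      have := (padicValInt_dvd_iff (p := p) 1 Y.det).1 (by simpa using hdv)
      tauto
    omega
  have hmem : ∀ x : ℤ, (p : ℤ) ∣ x → (x : ℤ_[p]) ∈ IsLocalRing.maximalIdeal ℤ_[p] := by
    rintro x ⟨y, rfl⟩
    rw [PadicInt.maximalIdeal_eq_span_p, Ideal.mem_span_singleton]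
    exact ⟨(y : ℤ_[p]), by push_cast; rfl⟩
  have key := loc_main (R := ℤ_[p]) (p : ℤ_[p]) _ (J C w) rfl z a (Y.map (Int.castRingHom ℤ_[p])) ?_ ?_ ?_
  · have h4 := key.map (PadicInt.toZModPow k)
    convert h4 using 1
    · rw [hA]
      ext i j
      simp [Matrix.mul_diagonal, Matrix.diagonal_mul, Y]
    · ext i j
      by_cases hij : i = j
      · subst hij; simp [hz, ha]
      · simp [hij]
  · have : (Y.map (Int.castRingHom ℤ_[p])).det = ((Y.det : ℤ) : ℤ_[p]) := by
      have := RingHom.map_det (Int.castRingHom ℤ_[p]) Y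
      simpa using this.symm
    rw [this, PadicInt.isUnit_iff]
    by_contra h5
    have h6 : ‖((Y.det : ℤ) : ℤ_[p])‖ < 1 := lt_of_le_of_ne (PadicInt.norm_le_one _) h5
    exact hdet ((PadicInt.norm_int_lt_one_iff_dvd _).1 h6)
  · intro i j hij
    exact hmem _ (hy' i j hij)
  · have h5 := congrArg (fun M : Matrix (J C w) (J C w) ℤ => M.map (Int.castRingHom ℤ_[p])) (Amat_symm d w)
    have h6 : (Amat d w).map (Int.castRingHom ℤ_[p]) = (Matrix.diagonal (fun i => (p : ℤ_[p]) ^ z i) * (Y.map (Int.castRingHom ℤ_[p])) * Matrix.diagonal (fun i => (p : ℤ_[p]) ^ a i)) := by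
      rw [hA]
      ext i j
      simp [Matrix.mul_diagonal, Matrix.diagonal_mul, Y]
    rw [← h6, ← Matrix.transpose_map]
    exact h5

end
end CBI

namespace CBI
section
variable {ι : Type*} [Fintype ι] [DecidableEq ι]

lemma smith (A : Matrix ι ι ℤ) (hA : A.det ≠ 0) : ∃ a : ι → ℤ, Eqv A (Matrix.diagonal a) := by
  let f : (ι → ℤ) →ₗ[ℤ] (ι → ℤ) := A.mulVecLin
  have hinj : Function.Injective f := by
    rw [← LinearMap.ker_eq_bot, LinearMap.ker_eq_bot']
    intro x hx
    exact Matrix.eq_zero_of_mulVec_eq_zero hA hx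
  let fe : (ι → ℤ) ≃ₗ[ℤ] LinearMap.range f := LinearEquiv.ofInjective f hinj
  let bst : Module.Basis ι ℤ (ι → ℤ) := Pi.basisFun ℤ ι
  obtain ⟨b', a, ab', h⟩ := Submodule.exists_smith_normal_form_of_rank_eq (N := LinearMap.range f) bst fe.finrank_eq.symm
  let b2 : Module.Basis ι ℤ (ι → ℤ) := ab'.map fe.symm
  have hb : ∀ i, A.mulVec (b2 i) = a i • b' i := by
    intro i
    rw [← h i]
    have : fe (b2 i) = ab' i := by simp [b2]
    rw [← this]; rfl
  refine ⟨a, (bst.toMatrix b')⁻¹, bst.toMatrix b2, ?_, ?_, ?_⟩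
  · rw [Matrix.isUnit_nonsing_inv_iff]
    exact IsUnit.of_mul_eq_one _ (bst.toMatrix_mul_toMatrix_flip b')
  · exact IsUnit.of_mul_eq_one _ (bst.toMatrix_mul_toMatrix_flip b2)
  · have hu : IsUnit (bst.toMatrix b').det := by
      rw [← Matrix.isUnit_iff_isUnit_det]
      exact IsUnit.of_mul_eq_one _ (bst.toMatrix_mul_toMatrix_flip b')
    have : A * bst.toMatrix b2 = bst.toMatrix b' * Matrix.diagonal a := by
      ext j i
      rw [Matrix.mul_diagonal]
      have := congrFun (hb i) j
      simp only [Matrix.mulVec, dotProduct, Pi.smul_apply, smul_eq_mul] at this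
      simp only [Matrix.mul_apply, Module.Basis.toMatrix_apply, bst, Pi.basisFun_repr]
      rw [this, mul_comm]
    rw [Matrix.mul_assoc, this, ← Matrix.mul_assoc, Matrix.nonsing_inv_mul _ hu, Matrix.one_mul]

lemma ker_card {R : Type*} [CommRing R] [Fintype R] [DecidableEq R] {A B : Matrix ι ι R} (h : Eqv A B) :
    Fintype.card {x : ι → R // A.mulVec x = 0} = Fintype.card {x : ι → R // B.mulVec x = 0} := by
  obtain ⟨P, V, ⟨P, rfl⟩, ⟨V, rfl⟩, rfl⟩ := h
  refine Fintype.card_congr ⟨fun x => ⟨(V⁻¹).1.mulVec x.1, ?_⟩, fun x => ⟨V.1.mulVec x.1, ?_⟩, ?_, ?_⟩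
  · rw [Matrix.mulVec_mulVec, Matrix.mul_assoc, Units.mul_inv, Matrix.mul_one, ← Matrix.mulVec_mulVec, x.2, Matrix.mulVec_zero]
  · obtain ⟨x, hx⟩ := x
    have h := congrArg (fun y => (P⁻¹).1.mulVec y) hx
    simp only [Matrix.mulVec_mulVec, Matrix.mulVec_zero] at h
    rw [Matrix.mulVec_mulVec]
    rw [Matrix.mul_assoc, ← Matrix.mul_assoc, Units.inv_mul, Matrix.one_mul] at h
    exact h
  · intro x; apply Subtype.ext; simp [Matrix.mulVec_mulVec]
  · intro x; apply Subtype.ext; simp [Matrix.mulVec_mulVec]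

lemma ker_diag {R : Type*} [CommRing R] [Fintype R] [DecidableEq R] (a : ι → R) :
    Fintype.card {x : ι → R // (Matrix.diagonal a).mulVec x = 0} = ∏ i, Fintype.card {x : R // a i * x = 0} := by
  rw [← Fintype.card_pi]
  refine Fintype.card_congr ⟨fun x i => ⟨x.1 i, ?_⟩, fun x => ⟨fun i => (x i).1, ?_⟩, ?_, ?_⟩
  · have := congrFun x.2 i
    rwa [Matrix.mulVec_diagonal] at this
  · ext i
    rw [Matrix.mulVec_diagonal]; exact (x i).2
  · intro x; rfl
  · intro x; rfl

lemma zmod_ker (n : ℕ) [NeZero n] (d : ℕ) : Fintype.card {x : ZMod n // (d : ZMod n) * x = 0} = n.gcd d := by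
  have := IsCyclic.card_powMonoidHom_ker (G := Multiplicative (ZMod n)) d
  rw [Nat.card_eq_fintype_card (α := Multiplicative (ZMod n))] at this
  rw [Fintype.card_multiplicative, ZMod.card] at this
  rw [← this, ← Nat.card_eq_fintype_card]
  refine Nat.card_congr ⟨fun x => ⟨Multiplicative.ofAdd x.1, ?_⟩, fun x => ⟨Multiplicative.toAdd x.1, ?_⟩, ?_, ?_⟩
  · rw [MonoidHom.mem_ker, powMonoidHom_apply, ← ofAdd_nsmul, nsmul_eq_mul, x.2]; rfl
  · have h := x.2
    rw [MonoidHom.mem_ker, powMonoidHom_apply] at h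
    have h2 := congrArg Multiplicative.toAdd h
    rw [toAdd_pow, nsmul_eq_mul] at h2
    exact h2
  · intro x; rfl
  · intro x; rfl

lemma zmod_ker' (p : ℕ) [hpp : Fact p.Prime] (k : ℕ) (d : ℕ) (hd : d ≠ 0) : Nat.card {x : ZMod (p ^ k) // (d : ZMod (p ^ k)) * x = 0} = p ^ min k (padicValNat p d) := by
  have : NeZero (p ^ k) := ⟨pow_ne_zero _ hpp.out.ne_zero⟩
  rw [Nat.card_eq_fintype_card, zmod_ker]
  obtain ⟨j, hj, h⟩ := (Nat.dvd_prime_pow hpp.out).1 (Nat.gcd_dvd_left (p ^ k) d)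
  rw [h]
  congr 1
  have h1 : p ^ j ∣ d := h ▸ Nat.gcd_dvd_right _ _
  have h2 := (padicValNat_dvd_iff_le hd).1 h1
  have h3 : p ^ min k (padicValNat p d) ∣ p ^ j := by
    rw [← h]
    exact Nat.dvd_gcd (pow_dvd_pow _ (min_le_left _ _)) ((padicValNat_dvd_iff_le hd).2 (min_le_right _ _))
  have h4 := (Nat.pow_dvd_pow_iff_le_right hpp.out.one_lt).1 h3
  omega

lemma multiset_match (u v : ι → ℕ) (h : ∀ k, ∑ i, min k (u i) = ∑ i, min k (v i)) : ∃ σ : Equiv.Perm ι, ∀ i, u (σ i) = v i := by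
  have h1 : ∀ (u : ι → ℕ) k, ∑ i, min (k+1) (u i) = ∑ i, min k (u i) + (Finset.univ.filter fun i => k < u i).card := by
    intro u k
    rw [Finset.card_filter, ← Finset.sum_add_distrib]
    refine Finset.sum_congr rfl fun i _ => ?_
    split_ifs <;> omega
  have h2 : ∀ k, (Finset.univ.filter fun i => k < u i).card = (Finset.univ.filter fun i => k < v i).card := by
    intro k
    have := h1 u k
    have := h1 v k
    have := h k
    have := h (k+1)
    omega
  have h3 : ∀ (u : ι → ℕ) k, (Finset.univ.filter fun i => u i = k+1).card + (Finset.univ.filter fun i => k + 1 < u i).card = (Finset.univ.filter fun i => k < u i).card := by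
    intro u k
    rw [Finset.card_filter, Finset.card_filter, Finset.card_filter, ← Finset.sum_add_distrib]
    refine Finset.sum_congr rfl fun i _ => ?_
    split_ifs <;> omega
  have h3' : ∀ (u : ι → ℕ), (Finset.univ.filter fun i => u i = 0).card + (Finset.univ.filter fun i => 0 < u i).card = Fintype.card ι := by
    intro u
    rw [Finset.card_filter, Finset.card_filter, ← Finset.sum_add_distrib, ← Finset.card_univ, Finset.card_eq_sum_ones]
    refine Finset.sum_congr rfl fun i _ => ?_
    split_ifs <;> omega
  have h4 : ∀ k, (Finset.univ.filter fun i => v i = k).card = (Finset.univ.filter fun i => u i = k).card := by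
    intro k
    cases k with
    | zero =>
      have := h3' u; have := h3' v; have := h2 0; omega
    | succ k =>
      have := h3 u k; have := h3 v k; have := h2 k; have := h2 (k+1); omega
  have e : ∀ k, {i // v i = k} ≃ {i // u i = k} := fun k => Fintype.equivOfCardEq (by rw [Fintype.card_subtype, Fintype.card_subtype, h4])
  refine ⟨(Equiv.sigmaFiberEquiv v).symm.trans ((Equiv.sigmaCongrRight e).trans (Equiv.sigmaFiberEquiv u)), fun i => ?_⟩
  have := (e (v i) ⟨i, rfl⟩).2
  simpa [Equiv.sigmaFiberEquiv] using this

lemma two_by_two (g a1 b1 s t : ℤ) (h : s * a1 + t * b1 = 1) :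
    Eqv (Matrix.diagonal ![g * a1, g * b1]) (Matrix.diagonal ![g, g * a1 * b1]) := by
  refine ⟨!![s, t; -b1, a1], !![1, -t * b1; 1, s * a1], ?_, ?_, ?_⟩
  · rw [Matrix.isUnit_iff_isUnit_det, Matrix.det_fin_two_of]
    have : s * a1 - t * -b1 = 1 := by linarith
    rw [this]; exact isUnit_one
  · rw [Matrix.isUnit_iff_isUnit_det, Matrix.det_fin_two_of]
    have : 1 * (s * a1) - -t * b1 * 1 = 1 := by linarith
    rw [this]; exact isUnit_one
  · have hdd : ∀ x y : ℤ, Matrix.diagonal ![x, y] = !![x, 0; 0, y] := by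
      intro x y
      ext i j
      fin_cases i <;> fin_cases j <;> simp
    rw [hdd, hdd, Matrix.mul_fin_two, Matrix.mul_fin_two]
    congr 3
    · linear_combination g * h
    · congr 1; ring
    · congr 1
      · ring
      · congr 1
        linear_combination g * a1 * b1 * h

lemma two_swap (f1 f2 x y : ℕ) (hf1 : f1 ≠ 0) (hx : x ≠ 0) (h11 : Nat.Coprime f1 x) (h12 : Nat.Coprime f1 y) (h21 : Nat.Coprime f2 x) (h22 : Nat.Coprime f2 y) :
    Eqv (Matrix.diagonal ![((f1 * x : ℕ) : ℤ), ((f2 * y : ℕ) : ℤ)]) (Matrix.diagonal ![((f1 * y : ℕ) : ℤ), ((f2 * x : ℕ) : ℤ)]) := by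
  have hg : Nat.gcd (f1 * x) (f2 * y) = Nat.gcd (f1 * y) (f2 * x) := by
    rw [Nat.Coprime.gcd_mul _ h22, Nat.Coprime.gcd_mul _ h21, Nat.Coprime.gcd_mul_right_cancel _ h21.symm, Nat.Coprime.gcd_mul_left_cancel _ h12,
       Nat.Coprime.gcd_mul_right_cancel _ h22.symm, Nat.Coprime.gcd_mul_left_cancel _ h11, Nat.gcd_comm x y]
  have key : ∀ a b : ℕ, a.gcd b ≠ 0 → ∃ q : ℤ, (a.gcd b : ℤ) * q = a * b ∧ Eqv (Matrix.diagonal ![(a : ℤ), (b : ℤ)]) (Matrix.diagonal ![(a.gcd b : ℤ), q]) := by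
    intro a b hab
    have hab' : (a.gcd b : ℤ) ≠ 0 := by exact_mod_cast hab
    obtain ⟨a1, ha⟩ := Nat.gcd_dvd_left a b
    obtain ⟨b1, hb⟩ := Nat.gcd_dvd_right a b
    have hz : (a : ℤ) = (a.gcd b : ℤ) * a1 := by exact_mod_cast ha
    have hz' : (b : ℤ) = (a.gcd b : ℤ) * b1 := by exact_mod_cast hb
    have h2 := Nat.gcd_eq_gcd_ab a b
    have h1 : a.gcdA b * a1 + a.gcdB b * b1 = 1 := by
      apply mul_left_cancel₀ hab'
      linear_combination -h2 - a.gcdA b * hz - a.gcdB b * hz'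
    refine ⟨a.gcd b * a1 * b1, ?_, ?_⟩
    · linear_combination -(b:ℤ) * hz - (a.gcd b : ℤ) * a1 * hz'
    · have := two_by_two (a.gcd b) a1 b1 _ _ h1
      rw [← hz, ← hz'] at this
      rw [← hz]; exact this
  have hg0 : Nat.gcd (f1 * x) (f2 * y) ≠ 0 := by
    rw [Ne, Nat.gcd_eq_zero_iff]; intro h; exact mul_ne_zero hf1 hx h.1
  obtain ⟨q, hq, h⟩ := key _ _ hg0
  obtain ⟨q', hq', h'⟩ := key (f1 * y) (f2 * x) (hg ▸ hg0)
  rw [← hg] at hq' h'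
  have : q = q' := by
    apply mul_left_cancel₀ (a := ((Nat.gcd (f1 * x) (f2 * y) : ℕ) : ℤ)) (by exact_mod_cast hg0)
    rw [hq, hq']; push_cast; ring
  rw [← this] at h'
  exact h.trans h'.symm

lemma diag_two (a b : ι → ℤ) (i j : ι) (hij : i ≠ j) (hab : ∀ k, k ≠ i → k ≠ j → a k = b k)
    (h : Eqv (Matrix.diagonal ![a i, a j]) (Matrix.diagonal ![b i, b j])) : Eqv (Matrix.diagonal a) (Matrix.diagonal b) := by
  let P : ι → Prop := fun k => k = i ∨ k = j
  let e : {k // P k} ⊕ {k // ¬ P k} ≃ ι := Equiv.sumCompl P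
  apply Eqv.of_reindex e
  let e2 : Fin 2 ≃ {k // P k} :=
    { toFun := fun x => if x = 0 then ⟨i, Or.inl rfl⟩ else ⟨j, Or.inr rfl⟩
      invFun := fun k => if k.1 = i then 0 else 1
      left_inv := by intro x; fin_cases x <;> simp [hij.symm]
      right_inv := by
        rintro ⟨k, rfl | rfl⟩
        · simp
        · simp [hij.symm] }
  have hb : ∀ a : ι → ℤ, (Matrix.diagonal a).submatrix e e = Matrix.fromBlocks (Matrix.diagonal fun k : {k // P k} => a k.1) 0 0 (Matrix.diagonal fun k : {k // ¬ P k} => a k.1) := by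
    intro a
    rw [Matrix.submatrix_diagonal_equiv, Matrix.fromBlocks_diagonal]
    congr 1; ext i; cases i <;> rfl
  rw [hb, hb]
  have : (fun k : {k // ¬ P k} => a k.1) = fun k : {k // ¬ P k} => b k.1 := by
    ext k
    have := k.2
    simp only [P, not_or] at this
    exact hab _ this.1 this.2
  rw [this]
  refine Eqv.blocks ?_ (Eqv.refl _)
  apply Eqv.of_reindex e2
  have hc : ∀ a : ι → ℤ, (Matrix.diagonal fun k : {k // P k} => a k.1).submatrix e2 e2 = Matrix.diagonal ![a i, a j] := by
    intro a
    rw [Matrix.submatrix_diagonal_equiv]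
    congr 1; ext x; fin_cases x <;> simp [e2]
  rw [hc, hc]; exact h

lemma diag_perm (f g : ι → ℕ) (hf : ∀ i, f i ≠ 0) (hg : ∀ i, g i ≠ 0) (hfg : ∀ i j, Nat.Coprime (f i) (g j)) (σ : Equiv.Perm ι) :
    Eqv (Matrix.diagonal fun i => ((f i * g i : ℕ) : ℤ)) (Matrix.diagonal fun i => ((f i * g (σ i) : ℕ) : ℤ)) := by
  induction σ using Equiv.Perm.swap_induction_on' with
  | one => exact Eqv.refl _
  | mul_swap σ i j hij ih =>
    refine ih.trans ?_
    apply diag_two _ _ i j hij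
    · intro k hi hj
      simp [Equiv.swap_apply_of_ne_of_ne hi hj]
    · simp only [Equiv.Perm.mul_apply, Equiv.swap_apply_left, Equiv.swap_apply_right]
      exact two_swap _ _ _ _ (hf _) (hg _) (hfg _ _) (hfg _ _) (hfg _ _) (hfg _ _)

lemma diag_primes (S : Finset ℕ) (hS : ∀ p ∈ S, p.Prime) (c c' : ℕ → ι → ℕ) (h : ∀ p ∈ S, ∃ σ : Equiv.Perm ι, ∀ i, c p (σ i) = c' p i) :
   ∀ E : Finset ℕ, (∀ p ∈ E, p.Prime) → Disjoint E S → ∀ x : ℕ → ι → ℕ, Eqv (Matrix.diagonal fun i => (((∏ p ∈ E, p ^ x p i) * (∏ p ∈ S, p ^ c p i) : ℕ) : ℤ)) (Matrix.diagonal fun i => (((∏ p ∈ E, p ^ x p i) * ∏ p ∈ S, p ^ c' p i : ℕ) : ℤ)) := by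
  induction S using Finset.induction_on with
  | empty => intro E _ _ x; simpa using Eqv.refl _
  | insert p S hp' ih =>
    intro E hE hES x
    have hES' := Finset.disjoint_insert_right.1 hES
    obtain ⟨σ, hσ⟩ := h p (Finset.mem_insert_self _ _)
    have h1 := diag_perm (fun i => (∏ q ∈ E, q ^ x q i) * (∏ q ∈ S, q ^ c q i)) (fun i => p ^ c p i) ?_ ?_ ?_ σ
    · have hE2 : ∀ q ∈ insert p E, q.Prime := by
        intro q hq
        rcases Finset.mem_insert.1 hq with rfl | hq
        · exact hS _ (Finset.mem_insert_self _ _)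
        · exact hE _ hq
      have h2 := ih (fun q hq => hS q (Finset.mem_insert_of_mem hq)) (fun q hq => h q (Finset.mem_insert_of_mem hq)) (insert p E) hE2
        (Finset.disjoint_insert_left.2 ⟨hp', hES'.2⟩) (fun q i => if q = p then c' p i else x q i)
      have h3 : ∀ i, ∏ q ∈ insert p E, q ^ (if q = p then c' p i else x q i) = p ^ c' p i * ∏ q ∈ E, q ^ x q i := by
        intro i
        rw [Finset.prod_insert hES'.1]
        congr 1
        · simp
        · refine Finset.prod_congr rfl fun q hq => ?_
          rw [if_neg]; rintro rfl; exact hES'.1 hq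
      have e1 : (fun i => (((∏ q ∈ E, q ^ x q i) * (∏ q ∈ insert p S, q ^ c q i) : ℕ) : ℤ)) = fun i => (((∏ q ∈ E, q ^ x q i) * (∏ q ∈ S, q ^ c q i) * p ^ c p i : ℕ) : ℤ) := by
        ext i; rw [Finset.prod_insert hp']; push_cast; ring
      have e2 : (fun i => (((∏ q ∈ E, q ^ x q i) * (∏ q ∈ insert p S, q ^ c' q i) : ℕ) : ℤ)) = fun i => (((∏ q ∈ insert p E, q ^ (if q = p then c' p i else x q i)) * (∏ q ∈ S, q ^ c' q i) : ℕ) : ℤ) := by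
        ext i; rw [Finset.prod_insert hp', h3]; push_cast; ring
      rw [e1, e2]
      refine h1.trans ?_
      have e3 : (fun i => (((∏ q ∈ E, q ^ x q i) * (∏ q ∈ S, q ^ c q i) * p ^ c p (σ i) : ℕ) : ℤ)) = fun i => (((∏ q ∈ insert p E, q ^ (if q = p then c' p i else x q i)) * (∏ q ∈ S, q ^ c q i) : ℕ) : ℤ) := by
        ext i; rw [h3, hσ]; push_cast; ring
      rw [e3]
      exact h2
    · intro i
      refine mul_ne_zero (Finset.prod_ne_zero_iff.2 fun q hq => pow_ne_zero _ (hE q hq).ne_zero) (Finset.prod_ne_zero_iff.2 fun q hq => pow_ne_zero _ (hS q (Finset.mem_insert_of_mem hq)).ne_zero)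
    · intro i; exact pow_ne_zero _ (hS p (Finset.mem_insert_self _ _)).ne_zero
    · intro i j
      apply Nat.Coprime.pow_right
      apply Nat.Coprime.mul_left
      · apply Nat.Coprime.prod_left
        intro q hq
        apply Nat.Coprime.pow_left
        rw [Nat.coprime_primes (hE q hq) (hS p (Finset.mem_insert_self _ _))]
        rintro rfl; exact hES'.1 hq
      · apply Nat.Coprime.prod_left
        intro q hq
        apply Nat.Coprime.pow_left
        rw [Nat.coprime_primes (hS q (Finset.mem_insert_of_mem hq)) (hS p (Finset.mem_insert_self _ _))]
        rintro rfl; exact hp' hq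

end
end CBI

namespace CBI
section
variable {ι : Type*} [Fintype ι] [DecidableEq ι]

lemma diag_abs (a : ι → ℤ) : Eqv (Matrix.diagonal a) (Matrix.diagonal fun i => ((a i).natAbs : ℤ)) := by
  refine ⟨Matrix.diagonal fun i => if 0 ≤ a i then 1 else -1, 1, ?_, isUnit_one, ?_⟩
  · apply IsUnit.of_mul_eq_one (Matrix.diagonal fun i => if 0 ≤ a i then 1 else -1)
    rw [Matrix.diagonal_mul_diagonal, ← Matrix.diagonal_one]
    congr 1; ext i; split_ifs <;> simp
  · rw [Matrix.mul_one, Matrix.diagonal_mul_diagonal]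
    congr 1; ext i; split_ifs <;> omega

lemma diag_match {p : ℕ} [hpp : Fact p.Prime] (a : ι → ℕ) (ha : ∀ i, a i ≠ 0) (A : Matrix ι ι ℤ) (hA : Eqv A (Matrix.diagonal fun i => (a i : ℤ)))
    (c : ι → ℕ) (h : ∀ k, Eqv (A.map (Int.castRingHom (ZMod (p ^ k)))) (Matrix.diagonal fun i => (p : ZMod (p ^ k)) ^ c i)) :
    ∃ σ : Equiv.Perm ι, ∀ i, padicValNat p (a (σ i)) = c i := by
  apply multiset_match (fun i => padicValNat p (a i)) c
  intro k
  have : NeZero (p ^ k) := ⟨pow_ne_zero _ hpp.out.ne_zero⟩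
  have h1 := (hA.map (Int.castRingHom (ZMod (p ^ k)))).symm.trans (h k)
  have h2 := ker_card h1
  have e1 : (Matrix.diagonal fun i => (a i : ℤ)).map (Int.castRingHom (ZMod (p ^ k))) = Matrix.diagonal fun i => ((a i : ℕ) : ZMod (p ^ k)) := by
    ext i j
    by_cases hij : i = j
    · subst hij; simp
    · simp [hij]
  have e2 : (Matrix.diagonal fun i => (p : ZMod (p ^ k)) ^ c i) = Matrix.diagonal fun i => ((p ^ c i : ℕ) : ZMod (p ^ k)) := by
    congr 1; ext i; push_cast; rfl
  rw [e1, e2, ker_diag, ker_diag] at h2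
  simp only [← Nat.card_eq_fintype_card] at h2
  rw [Finset.prod_congr rfl fun i _ => zmod_ker' p k (a i) (ha i),
    Finset.prod_congr rfl fun i _ => zmod_ker' p k (p ^ c i) (pow_ne_zero _ hpp.out.ne_zero),
    Finset.prod_pow_eq_pow_sum, Finset.prod_pow_eq_pow_sum] at h2
  have h3 := Nat.pow_right_injective hpp.out.two_le h2
  simpa [padicValNat.prime_pow] using h3

end
section
variable {C : Type*} [Fintype C] [DecidableEq C]

theorem Amat_smith (d : C → ℤ) (hd : ∀ c, d c ≠ 0) (w : ℕ) (S : Finset ℕ) (hS : ∀ p ∈ S, p.Prime)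
    (hS2 : ∀ p : ℕ, p.Prime → ∀ c, (p : ℤ) ∣ d c → p ∈ S) :
    Eqv (Amat d w) (Matrix.diagonal fun α : J C w => ((∏ p ∈ S, p ^ (zv p (rv p d) α.1 + av p (rv p d) α.1) : ℕ) : ℤ)) := by
  have hdet : (Amat d w).det ≠ 0 := by
    rw [Amat_det]
    have : Fact (Nat.Prime 2) := ⟨Nat.prime_two⟩
    exact (prod_val 2 Finset.univ _ fun ν : J C w => (dmon_val 2 d hd ν.1).1).1
  obtain ⟨a, ha⟩ := smith _ hdet
  have ha0 : ∀ i, a i ≠ 0 := by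
    obtain ⟨P, V, h1, h2, h3⟩ := ha
    have h4 := congrArg Matrix.det h3
    rw [Matrix.det_mul, Matrix.det_mul, Matrix.det_diagonal] at h4
    rw [Matrix.isUnit_iff_isUnit_det] at h1 h2
    have h5 : ∏ i, a i ≠ 0 := by
      rw [← h4]; exact mul_ne_zero (mul_ne_zero h1.ne_zero hdet) h2.ne_zero
    intro i
    exact Finset.prod_ne_zero_iff.1 h5 i (Finset.mem_univ _)
  have hb := ha.trans (diag_abs a)
  set b : J C w → ℕ := fun i => (a i).natAbs with hbdef
  have hb0 : ∀ i, b i ≠ 0 := fun i => Int.natAbs_ne_zero.2 (ha0 i)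
  let S' := S ∪ Finset.univ.biUnion fun i => (b i).primeFactors
  have hS' : ∀ p ∈ S', p.Prime := by
    intro p hp
    rcases Finset.mem_union.1 hp with h | h
    · exact hS p h
    · obtain ⟨i, _, h⟩ := Finset.mem_biUnion.1 h
      exact Nat.prime_of_mem_primeFactors h
  have hmatch : ∀ p ∈ S', ∃ σ : Equiv.Perm (J C w), ∀ i, padicValNat p (b (σ i)) = zv p (rv p d) i.1 + av p (rv p d) i.1 := by
    intro p hp
    have : Fact p.Prime := ⟨hS' p hp⟩
    exact diag_match b hb0 _ hb _ (loc_A p d hd w)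
  have h1 := diag_primes S' hS' (fun p i => padicValNat p (b i)) (fun p i => zv p (rv p d) i.1 + av p (rv p d) i.1) hmatch ∅ (by simp) (by simp) (fun _ _ => 0)
  refine hb.trans ?_
  have e1 : ∀ i, b i = (∏ p ∈ (∅ : Finset ℕ), p ^ 0) * ∏ p ∈ S', p ^ padicValNat p (b i) := by
    intro i
    rw [Finset.prod_empty, one_mul]
    conv_lhs => rw [← Nat.prod_factorization_pow_eq_self (hb0 i)]
    rw [Finsupp.prod]
    have hsub : (b i).factorization.support ⊆ S' := by
      rw [Nat.support_factorization]
      exact fun q hq => Finset.mem_union_right _ (Finset.mem_biUnion.2 ⟨i, Finset.mem_univ _, hq⟩)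
    rw [Finset.prod_subset hsub]
    · refine Finset.prod_congr rfl fun q hq => ?_
      rw [Nat.factorization_def _ (hS' q hq)]
    · intro q _ hq
      rw [Finsupp.notMem_support_iff] at hq
      rw [hq, pow_zero]
  have e2 : ∀ i : J C w, (∏ p ∈ (∅ : Finset ℕ), p ^ 0) * ∏ p ∈ S', p ^ (zv p (rv p d) i.1 + av p (rv p d) i.1) = ∏ p ∈ S, p ^ (zv p (rv p d) i.1 + av p (rv p d) i.1) := by
    intro i
    rw [Finset.prod_empty, one_mul]
    symm
    apply Finset.prod_subset Finset.subset_union_left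
    intro p hp hpS
    have hr : rv p d = fun _ => 0 := by
      ext c
      unfold rv padicValInt
      apply padicValNat.eq_zero_of_not_dvd
      intro h
      exact hpS (hS2 p (hS' p hp) c (Int.natCast_dvd.2 h))
    rw [hr]
    simp [zv, av, sg]
  have e3 : (fun i : J C w => ((a i).natAbs : ℤ)) = fun i => (((∏ p ∈ (∅ : Finset ℕ), p ^ 0) * ∏ p ∈ S', p ^ padicValNat p (b i) : ℕ) : ℤ) := by
    ext i; rw [← e1]
  rw [e3]
  have e4 : (fun α : J C w => ((∏ p ∈ S, p ^ (zv p (rv p d) α.1 + av p (rv p d) α.1) : ℕ) : ℤ)) = fun α : J C w => (((∏ p ∈ (∅ : Finset ℕ), p ^ 0) * ∏ p ∈ S', p ^ (zv p (rv p d) α.1 + av p (rv p d) α.1) : ℕ) : ℤ) := by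
    ext i; rw [e2]
  rw [e4]
  exact h1

end
end CBI

namespace CBI
section
variable {C : Type*} [Fintype C] [DecidableEq C]

/-- tuples of multisets of positive integers -/
abbrev MM (C : Type*) [Fintype C] (w : ℕ) := {f : C → Multiset ℕ // (∀ c, 0 ∉ f c) ∧ ∑ c, (f c).sum = w}

/-- the multiset of a colour -/
def mul_of (α : C × ℕ →₀ ℕ) (c : C) : Multiset ℕ := ∑ i ∈ α.support.filter (fun i => i.1 = c), Multiset.replicate (α i) (i.2 + 1)

lemma count_mul_of (α : C × ℕ →₀ ℕ) (c : C) (j : ℕ) : (mul_of α c).count (j + 1) = α (c, j) := by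
  unfold mul_of
  rw [Multiset.count_sum']
  simp only [Multiset.count_replicate]
  rw [Finset.sum_eq_single (c, j)]
  · simp
  · rintro ⟨c', j'⟩ h1 h2
    rw [if_neg]
    intro h
    apply h2
    have := (Finset.mem_filter.1 h1).2
    simp only at this h
    ext
    · exact this
    · simp only; omega
  · intro h
    simp at h
    simp [h]

lemma zero_mul_of (α : C × ℕ →₀ ℕ) (c : C) : 0 ∉ mul_of α c := by
  unfold mul_of
  rw [Multiset.mem_sum]
  rintro ⟨i, _, hi⟩
  have := Multiset.eq_of_mem_replicate hi
  omega

lemma sum_mul_of (α : C × ℕ →₀ ℕ) : ∑ c, (mul_of α c).sum = wgt α := by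
  have : ∀ c, (mul_of α c).sum = ∑ i ∈ α.support.filter (fun i => i.1 = c), α i * (i.2 + 1) := by
    intro c
    unfold mul_of
    rw [← Multiset.coe_sumAddMonoidHom, map_sum]
    simp
  simp only [this]
  rw [Finset.sum_fiberwise_of_maps_to (fun _ _ => Finset.mem_univ _)]
  simp [wgt, Finsupp.weight_apply, Finsupp.sum, wt]

/-- the inverse construction -/
def of_mul (f : C → Multiset ℕ) : C × ℕ →₀ ℕ :=
  Finsupp.onFinset (Finset.univ.biUnion fun c => (f c).toFinset.image fun n => (c, n - 1)) (fun i => (f i.1).count (i.2 + 1)) (by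
    rintro ⟨c, j⟩ h
    rw [Finset.mem_biUnion]
    refine ⟨c, Finset.mem_univ _, Finset.mem_image.2 ⟨j + 1, ?_, rfl⟩⟩
    rw [Multiset.mem_toFinset]
    exact Multiset.count_ne_zero.1 h)

lemma mul_of_of_mul (f : C → Multiset ℕ) (h : ∀ c, 0 ∉ f c) (c : C) : mul_of (of_mul f) c = f c := by
  ext j
  cases j with
  | zero => rw [Multiset.count_eq_zero_of_notMem (h c), Multiset.count_eq_zero_of_notMem (zero_mul_of _ _)]
  | succ j => rw [count_mul_of]; rfl

/-- colour partitions -/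
def JM (w : ℕ) : J C w ≃ MM C w where
  toFun α := ⟨mul_of α.1, zero_mul_of α.1, by rw [sum_mul_of, α.2]⟩
  invFun f := ⟨of_mul f.1, by
    rw [← sum_mul_of]
    rw [Finset.sum_congr rfl fun c _ => by rw [mul_of_of_mul _ f.2.1]]
    exact f.2.2⟩
  left_inv := by
    rintro ⟨α, h⟩
    apply Subtype.ext
    ext ⟨c, j⟩
    exact count_mul_of α c j
  right_inv := by
    rintro ⟨f, h⟩
    apply Subtype.ext
    funext c
    exact mul_of_of_mul f h.1 c

lemma le_of_sum (f : C → ℕ) (w : ℕ) (h : ∑ c, f c = w) (c : C) : f c < w + 1 := by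
  have := Finset.single_le_sum (f := f) (fun _ _ => Nat.zero_le _) (Finset.mem_univ c)
  omega

lemma pbp_ext {w : ℕ} (a b : PBP w) (h : a.2.parts = b.2.parts) : a = b := by
  obtain ⟨⟨m, hm⟩, ⟨p, h1, h2⟩⟩ := a
  obtain ⟨⟨m', hm'⟩, ⟨p', h1', h2'⟩⟩ := b
  simp only at h h2 h2'
  subst h h2 h2'
  rfl

/-- comparison with `PMapw` -/
def MP (w : ℕ) : MM C w ≃ PMapw C w where
  toFun f := ⟨fun c => ⟨⟨(f.1 c).sum, le_of_sum _ w f.2.2 c⟩, ⟨f.1 c, fun {i} hi => Nat.pos_of_ne_zero (by rintro rfl; exact f.2.1 c hi), rfl⟩⟩, f.2.2⟩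
  invFun l := ⟨fun c => (l.1 c).2.parts, fun c h => absurd ((l.1 c).2.parts_pos h) (by omega), by
    rw [Finset.sum_congr rfl fun c _ => (l.1 c).2.parts_sum]; exact l.2⟩
  left_inv := by intro f; rfl
  right_inv := by
    intro l
    apply Subtype.ext
    funext c
    apply pbp_ext
    rfl

lemma card_MM (k w : ℕ) : Nonempty (MM (Fin k) w ≃ Fin (kfun k w)) := by
  refine ⟨(MP w).trans (Fintype.equivFin _)⟩

/-- splitting off the distinguished colour -/
def MS (w : ℕ) : MM (Option C) w ≃ ((m : Fin (w + 1)) × (Nat.Partition m × MM C (w - (m : ℕ)))) where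
  toFun f := ⟨⟨(f.1 none).sum, le_of_sum (fun c => (f.1 c).sum) w f.2.2 none⟩, ⟨f.1 none, fun {i} hi => Nat.pos_of_ne_zero (by rintro rfl; exact f.2.1 none hi), rfl⟩,
    ⟨fun c => f.1 (some c), fun c => f.2.1 _, by
      have h := f.2.2
      rw [Fintype.sum_option] at h
      simp only
      omega⟩⟩
  invFun x := ⟨fun c => c.elim x.2.1.parts x.2.2.1, by
    intro c
    cases c with
    | none => exact fun h => absurd (x.2.1.parts_pos h) (by omega)
    | some c => exact x.2.2.2.1 c, by
    rw [Fintype.sum_option]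
    simp only [Option.elim_none, Option.elim_some]
    rw [x.2.1.parts_sum, x.2.2.2.2]
    have := x.1.2
    omega⟩
  left_inv := by
    intro f
    apply Subtype.ext
    funext c
    cases c <;> rfl
  right_inv := by
    rintro ⟨⟨m, hm⟩, ⟨⟨p, h1, h2⟩, f⟩⟩
    simp only at h2
    subst h2
    rfl

lemma av_zv_none (q k : ℕ) (α : Option (Fin k) × ℕ →₀ ℕ) :
    zv q (rv q (dM k)) α + av q (rv q (dM k)) α = cpr q (padicValNat q (k + 2)) (mul_of α none) := by
  have hr0 : ∀ c : Fin k, rv q (dM k) (some c) = 0 := by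
    intro c; simp [rv, dM]
  have hr : rv q (dM k) none = padicValNat q (k + 2) := by
    simp only [rv, dM, if_true, padicValInt]
    congr 1
  unfold zv av cpr Finsupp.sum
  rw [← Finset.sum_add_distrib, Finset.sum_filter]
  symm
  refine Finset.sum_of_injOn (fun j => (none, j - 1)) ?_ ?_ ?_ ?_
  · intro a ha b hb h
    simp only [Finset.mem_coe, Multiset.mem_toFinset] at ha hb
    have ha0 : a ≠ 0 := by rintro rfl; exact zero_mul_of _ _ ha
    have hb0 : b ≠ 0 := by rintro rfl; exact zero_mul_of _ _ hb
    simp only [Prod.mk.injEq, true_and] at h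
    omega
  · intro a ha
    simp only [Finset.mem_coe, Multiset.mem_toFinset] at ha
    have ha0 : a ≠ 0 := by rintro rfl; exact zero_mul_of _ _ ha
    obtain ⟨j, rfl⟩ := Nat.exists_eq_succ_of_ne_zero ha0
    simp only [Finset.mem_coe, Finsupp.mem_support_iff, Nat.succ_sub_one]
    rw [← count_mul_of]
    exact Multiset.count_ne_zero.2 ha
  · rintro ⟨c, j⟩ h1 h2
    cases c with
    | none =>
      exfalso; apply h2
      refine ⟨j + 1, ?_, rfl⟩
      rw [Finsupp.mem_support_iff, ← count_mul_of] at h1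
      simp only [Finset.mem_coe, Multiset.mem_toFinset]
      exact Multiset.count_ne_zero.1 h1
    | some c => simp [hr0, sg]
  · intro a ha
    simp only [Finset.mem_coe, Multiset.mem_toFinset] at ha
    have ha0 : a ≠ 0 := by rintro rfl; exact zero_mul_of _ _ ha
    obtain ⟨j, rfl⟩ := Nat.exists_eq_succ_of_ne_zero ha0
    simp only [Nat.succ_sub_one, hr, Nat.succ_eq_add_one, count_mul_of, sg, Nat.succ_ne_zero, if_false, dval]
    split_ifs with h
    · ring
    · have : padicValNat q (k + 2) - padicValNat q (j + 1) = 0 := by omega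
      simp [this]

theorem index_equiv (k w : ℕ) : ∃ E : J (Option (Fin k)) w ≃ (m : Fin (w + 1)) × (Nat.Partition m × Fin (kfun k (w - (m : ℕ)))),
    ∀ α, (((∏ p ∈ (k + 2).primeFactors, p ^ (zv p (rv p (dM k)) α.1 + av p (rv p (dM k)) α.1) : ℕ) : ℤ) : ℚ) = theta (E α).2.1.parts (k + 2) := by
  refine ⟨(JM w).trans ((MS w).trans (Equiv.sigmaCongrRight fun m => Equiv.prodCongr (Equiv.refl _) (card_MM k (w - (m : ℕ))).some)), ?_⟩
  intro α
  have : ((((JM w).trans ((MS w).trans (Equiv.sigmaCongrRight fun m => Equiv.prodCongr (Equiv.refl _) (card_MM k (w - (m : ℕ))).some))) α).2.1.parts) = mul_of α.1 none := rfl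
  rw [this]
  unfold theta
  rw [if_neg (by omega)]
  push_cast
  refine Finset.prod_congr rfl fun q _ => ?_
  rw [av_zv_none]

end
end CBI

namespace CBI

theorem final_reduce (k w : ℕ) {T : Type*} [Fintype T] (b : T → Q (Option (Option (Fin k))))
    (hb : LinearIndependent ℤ b)
    (hs : (Submodule.span ℤ (Set.range b) : Set (Q (Option (Option (Fin k))))) = KL (Option (Option (Fin k))) w) :
    IntEquiv (Matrix.of fun t q => ip (b t) (b q))
      (Matrix.diagonal
        (fun d : (m : Fin (w + 1)) × (Nat.Partition m × Fin (kfun k (w - (m : ℕ)))) =>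
          theta d.2.1.parts (k + 2))) := by
  obtain ⟨e, U, V, hU, hV, hM⟩ := gram_reduce k w b hb hs
  obtain ⟨P, W, hP, hW, hPW⟩ := Amat_smith (dM k) (by
    intro c; cases c <;> simp [dM]; omega) w (k + 2).primeFactors (fun p h => Nat.prime_of_mem_primeFactors h) (by
    intro p h c hc
    cases c with
    | none =>
      rw [Nat.mem_primeFactors]
      refine ⟨h, ?_, by omega⟩
      have : dM k none = ((k + 2 : ℕ) : ℤ) := by simp [dM]
      rw [this] at hc
      exact_mod_cast hc
    | some c =>
      exfalso
      have : dM k (some c) = 1 := by simp [dM]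
      rw [this] at hc
      have := Int.natCast_dvd_natCast.1 (show ((p : ℕ) : ℤ) ∣ ((1 : ℕ) : ℤ) by simpa using hc)
      exact h.one_lt.ne' (Nat.dvd_one.1 this))
  obtain ⟨E, hE⟩ := index_equiv k w
  refine ⟨e.trans E, P.submatrix e e * hU.unit⁻¹.1, hV.unit⁻¹.1 * W.submatrix e e, (isUnit_submatrix e _ hP).mul (Units.isUnit _), (Units.isUnit _).mul (isUnit_submatrix e _ hW), ?_⟩
  have h1 : (Matrix.of fun t q => ip (b t) (b q)) = (U * (Amat (dM k) w).submatrix e e * V).map (fun x : ℤ => (x : ℚ)) := by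
    ext t q
    rw [Matrix.of_apply, hM]; rfl
  have hc : ∀ A B : Matrix T T ℤ, (A * B).map (fun x : ℤ => (x : ℚ)) = A.map (fun x : ℤ => (x : ℚ)) * B.map (fun x : ℤ => (x : ℚ)) := by
    intro A B
    exact Matrix.map_mul (f := Int.castRingHom ℚ)
  rw [h1, ← hc, ← hc]
  have hu : hU.unit⁻¹.1 * U = 1 := hU.val_inv_mul
  have hv : V * hV.unit⁻¹.1 = 1 := hV.mul_val_inv
  have h2 : P.submatrix e e * hU.unit⁻¹.1 * (U * (Amat (dM k) w).submatrix e e * V) * (hV.unit⁻¹.1 * W.submatrix e e)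
      = (P * Amat (dM k) w * W).submatrix e e := by
    rw [← Matrix.submatrix_mul_equiv _ _ _ e, ← Matrix.submatrix_mul_equiv _ _ _ e]
    calc _ = P.submatrix e e * (hU.unit⁻¹.1 * U) * (Amat (dM k) w).submatrix e e * (V * hV.unit⁻¹.1) * W.submatrix e e := by
          simp only [Matrix.mul_assoc]
      _ = _ := by rw [hu, hv, Matrix.mul_one, Matrix.mul_one]
  rw [h2, hPW]
  ext t q
  simp only [Matrix.map_apply, Matrix.submatrix_apply, Matrix.diagonal_apply, Equiv.trans_apply, EmbeddingLike.apply_eq_iff_eq]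
  split_ifs with h
  · exact hE _
  · simp

end CBI

namespace CBI

/-- power sum product -/
def pm (ν : Multiset ℕ) : Q Unit := (ν.map fun j => (MvPolynomial.X ((), j - 1) : Q Unit)).prod

lemma prod_sort {M : Type*} [CommMonoid M] (m : Multiset ℕ) (f : ℕ → M) :
    ∏ i : Fin (Multiset.card m), f ((m.sort (· ≤ ·)).getD i 0) = (m.map f).prod := by
  have h : (m.sort (· ≤ ·)).length = Multiset.card m := by simp
  have h2 : (m.map f).prod = ((m.sort (· ≤ ·)).map f).prod := by
    conv_lhs => rw [← Multiset.sort_eq m (· ≤ ·)]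
    rw [Multiset.map_coe, Multiset.prod_coe]
  rw [h2, ← List.prod_ofFn, ]
  congr 1
  apply List.ext_getElem
  · simp
  · intro i h1 h2
    simp at h1 h2
    simp [List.getElem_ofFn, h2]

lemma Mcount_eq (lam mu : Multiset ℕ) (h0 : 0 ∉ mu) :
    (Mcount lam mu : ℚ) = ip (pm mu) ((lam.map fun a : ℕ => hz () (a : ℤ)).prod) := by
  rw [← prod_sort]
  have e := ip_prod_hz (fun _ : Fin (Multiset.card lam) => ()) (pm mu)
    (Finsupp.equivFunOnFinite.symm fun i : Fin (Multiset.card lam) => (lam.sort (· ≤ ·)).getD i 0)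
  simp only [Finsupp.equivFunOnFinite_symm_apply_apply] at e
  rw [e]
  have e2 : ev (fun _ : Fin (Multiset.card lam) => ()) (pm mu) =
      (mu.map fun j => ∑ b : Fin (Multiset.card lam), (MvPolynomial.X b : MvPolynomial _ ℚ) ^ j).prod := by
    rw [pm, map_multiset_prod, Multiset.map_map]
    congr 1
    refine Multiset.map_congr rfl fun j hj => ?_
    have : j ≠ 0 := by rintro rfl; exact h0 hj
    simp only [Function.comp, ev, MvPolynomial.aeval_X, Finset.filter_true]
    rw [show j - 1 + 1 = j by omega]
  rw [e2, ← prod_sort, Finset.prod_univ_sum, MvPolynomial.coeff_sum, Mcount, Fintype.card_subtype, Finset.card_filter]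
  push_cast
  rw [Fintype.piFinset_univ]
  refine Finset.sum_congr rfl fun f _ => ?_
  have e3 : ∏ i, (MvPolynomial.X (f i) : MvPolynomial (Fin (Multiset.card lam)) ℚ) ^ (mu.sort (· ≤ ·)).getD i 0
     = MvPolynomial.monomial (∑ i, Finsupp.single (f i) ((mu.sort (· ≤ ·)).getD i 0)) 1 := by
    rw [MvPolynomial.monomial_sum_one]
    exact Finset.prod_congr rfl fun i _ => MvPolynomial.X_pow_eq_monomial
  rw [e3, MvPolynomial.coeff_monomial]
  congr 1
  rw [Finsupp.ext_iff]
  apply propext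
  refine forall_congr' fun i => ?_
  rw [Finsupp.finsetSum_apply, Finset.sum_filter]
  simp only [Finsupp.single_apply, Finsupp.equivFunOnFinite_symm_apply_apply]

lemma Mcount_filter {N : ℕ} (α : Fin N → ℕ) (nu : Multiset ℕ) (h0 : 0 ∉ nu) :
    (Mcount ((Multiset.map α (Finset.univ.val : Multiset (Fin N))).filter (fun x => x ≠ 0)) nu : ℚ)
      = ip (pm nu) (∏ i, hz () (α i : ℤ)) := by
  rw [Mcount_eq _ _ h0]
  congr 1
  have h : ∀ m : Multiset ℕ, ((m.filter (fun x => x ≠ 0)).map fun a : ℕ => hz () (a : ℤ)).prod = (m.map fun a : ℕ => hz () (a : ℤ)).prod := by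
    intro m
    induction m using Multiset.induction_on with
    | empty => rfl
    | cons a m ih =>
      by_cases ha : a = 0
      · subst ha
        rw [Multiset.filter_cons_of_neg _ (by simp), ih]; simp [hz_zero]
      · rw [Multiset.filter_cons_of_pos (p := fun x => x ≠ 0) _ ha]; simp only [Multiset.map_cons, Multiset.prod_cons, ih]
  rw [h, Multiset.map_map]; rfl

/-- one-coloured Schur function of a sequence -/
def sc (N : ℕ) (L : ℕ → ℕ) : Q Unit :=
  sch (fun _ : Fin N => ()) (fun i => N - 1 - (i : ℕ)) (fun i => (L i : ℤ) + ((N - 1 - (i : ℕ) : ℕ) : ℤ))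

/-- the parts of a partition in decreasing order -/
def LL (lam : Multiset ℕ) : ℕ → ℕ := fun i => ((lam.sort (· ≤ ·)).reverse).getD i 0

lemma sval_eq (lam nu : Multiset ℕ) (h0 : 0 ∉ nu) :
    sval lam nu = ip (pm nu) (sc (Multiset.card lam) (LL lam)) := by
  unfold sval sc
  rw [sch_eq, map_sum]
  rw [← Equiv.sum_comp (Equiv.inv (Equiv.Perm (Fin (Multiset.card lam))))]
  refine Finset.sum_congr rfl fun σ _ => ?_
  rw [map_zsmul, zsmul_eq_mul]
  simp only [Equiv.inv_apply, Equiv.Perm.sign_inv]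
  congr 1
  rw [if_pos (fun _ => trivial)]
  have hre : ∏ i : Fin (Multiset.card lam), hz () ((LL lam (σ i) : ℤ) + ((Multiset.card lam - 1 - (σ i : ℕ) : ℕ) : ℤ) - ((Multiset.card lam - 1 - (i : ℕ) : ℕ) : ℤ))
      = ∏ i : Fin (Multiset.card lam), hz () ((LL lam i : ℤ) + ((σ⁻¹ i : Fin _) : ℕ) - (i : ℕ)) := by
    refine Fintype.prod_equiv σ _ _ fun i => ?_
    congr 1
    have h1 := i.2
    have h2 := (σ i).2
    rw [show σ⁻¹ (σ i) = i from σ.symm_apply_apply i]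
    omega
  rw [hre]
  split_ifs with h
  · rw [Mcount_filter _ _ h0]
    congr 1
    refine Finset.prod_congr rfl fun i _ => ?_
    have := h i
    congr 1
    simp only [LL]
    omega
  · push Not at h
    obtain ⟨i, hi⟩ := h
    rw [Finset.prod_eq_zero (Finset.mem_univ i), map_zero]
    apply hz_neg
    simp only [LL]
    omega

lemma sc_succ (N : ℕ) (L : ℕ → ℕ) (h : L N = 0) : sc (N + 1) L = sc N L := by
  unfold sc sch
  rw [Matrix.det_succ_row _ (Fin.last N), Finset.sum_eq_single (Fin.last N)]
  · rw [show smat (fun _ : Fin (N + 1) => ()) (fun i => N + 1 - 1 - (i : ℕ)) (fun i => (L i : ℤ) + ((N + 1 - 1 - (i : ℕ) : ℕ) : ℤ)) (Fin.last N) (Fin.last N) = 1 by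
      simp [smat, h, hz_zero]]
    rw [mul_one, ← two_mul, pow_mul]
    simp only [neg_one_sq, one_pow, one_mul]
    congr 1
    ext1 i j
    simp only [smat, Matrix.submatrix_apply, Matrix.of_apply, if_true, Fin.succAbove_last, Fin.val_castSucc]
    congr 1
    have h1 := i.2
    have h2 := j.2
    omega
  · intro j _ hj
    have : (j : ℕ) < N := by
      have := j.2
      have h3 : (j : ℕ) ≠ N := fun h => hj (Fin.ext h)
      omega
    rw [show smat (fun _ : Fin (N + 1) => ()) (fun i => N + 1 - 1 - (i : ℕ)) (fun i => (L i : ℤ) + ((N + 1 - 1 - (i : ℕ) : ℕ) : ℤ)) (Fin.last N) j = 0 by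
      simp only [smat, Matrix.of_apply, if_true, Fin.val_last, h]
      apply hz_neg; omega]
    simp
  · simp

lemma sc_stable (lam : Multiset ℕ) (N : ℕ) (h : Multiset.card lam ≤ N) : sc N (LL lam) = sc (Multiset.card lam) (LL lam) := by
  induction N, h using Nat.le_induction with
  | base => rfl
  | succ N hN ih =>
    rw [sc_succ _ _ _, ih]
    unfold LL
    apply List.getD_eq_default
    simpa using hN

end CBI

namespace CBI

lemma zz_eq (ν : Unit × ℕ →₀ ℕ) (M : Multiset ℕ) (hM : mul_of ν () = M) :
    zz ν = ((M.prod * ∏ a ∈ M.toFinset, (M.count a).factorial : ℕ) : ℚ) := by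
  subst hM
  rw [Finset.prod_multiset_count, ← Finset.prod_mul_distrib]
  unfold zz Finsupp.prod
  push_cast
  refine Finset.prod_nbij' (fun i => i.2 + 1) (fun a => ((), a - 1)) ?_ ?_ ?_ ?_ ?_
  · rintro ⟨⟨⟩, j⟩ h
    rw [Finsupp.mem_support_iff, ← count_mul_of] at h
    rw [Multiset.mem_toFinset]
    exact Multiset.count_ne_zero.1 h
  · intro a ha
    rw [Multiset.mem_toFinset] at ha
    have ha0 : a ≠ 0 := by rintro rfl; exact zero_mul_of _ _ ha
    obtain ⟨j, rfl⟩ := Nat.exists_eq_succ_of_ne_zero ha0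
    rw [Finsupp.mem_support_iff, Nat.succ_sub_one, ← count_mul_of]
    exact Multiset.count_ne_zero.2 ha
  · rintro ⟨⟨⟩, j⟩ h; rfl
  · intro a ha
    rw [Multiset.mem_toFinset] at ha
    have ha0 : a ≠ 0 := by rintro rfl; exact zero_mul_of _ _ ha
    simp only; omega
  · rintro ⟨⟨⟩, j⟩ h
    rw [count_mul_of]; push_cast; rfl

lemma fac_count (m : Multiset ℕ) (r : ℕ) (h1 : 1 ∉ m) :
    (m + Multiset.replicate r 1).prod * ∏ a ∈ (m + Multiset.replicate r 1).toFinset, ((m + Multiset.replicate r 1).count a).factorial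
     = r.factorial * m.prod * ∏ a ∈ m.toFinset, (m.count a).factorial := by
  have hS : ∏ a ∈ (m + Multiset.replicate r 1).toFinset, ((m + Multiset.replicate r 1).count a).factorial
      = ∏ a ∈ insert 1 m.toFinset, ((m + Multiset.replicate r 1).count a).factorial := by
    apply Finset.prod_subset
    · intro a ha
      rw [Multiset.mem_toFinset, Multiset.mem_add] at ha
      rcases ha with ha | ha
      · exact Finset.mem_insert_of_mem (Multiset.mem_toFinset.2 ha)
      · rw [Multiset.eq_of_mem_replicate ha]; exact Finset.mem_insert_self _ _
    · intro a _ ha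
      rw [Multiset.mem_toFinset] at ha
      rw [Multiset.count_eq_zero_of_notMem ha]; rfl
  rw [hS, Finset.prod_insert (by rwa [Multiset.mem_toFinset])]
  rw [Multiset.count_add, Multiset.count_eq_zero_of_notMem h1, Multiset.count_replicate_self, Multiset.prod_add, Multiset.prod_replicate, one_pow]
  have : ∏ a ∈ m.toFinset, ((m + Multiset.replicate r 1).count a).factorial = ∏ a ∈ m.toFinset, (m.count a).factorial := by
    refine Finset.prod_congr rfl fun a ha => ?_
    rw [Multiset.mem_toFinset] at ha
    rw [Multiset.count_add, Multiset.count_replicate, if_neg (by rintro rfl; exact h1 ha), add_zero]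
  rw [this]; ring

variable {n : ℕ}

lemma two_le_ct (g : Equiv.Perm (Fin n)) : ∀ a ∈ g.cycleType, 2 ≤ a := fun _ h => Equiv.Perm.two_le_of_mem_cycleType h

lemma sum_cycM (g : Equiv.Perm (Fin n)) : (cycM g).sum = n := by
  unfold cycM
  have := Finset.card_le_univ g.support
  rw [Fintype.card_fin] at this
  rw [Multiset.sum_add, Multiset.sum_replicate, Equiv.Perm.sum_cycleType]; simp; omega

lemma zero_cycM (g : Equiv.Perm (Fin n)) : 0 ∉ cycM g := by
  unfold cycM
  rw [Multiset.mem_add]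
  rintro (h | h)
  · have := two_le_ct g 0 h; omega
  · have := Multiset.eq_of_mem_replicate h; omega

/-- cycle type as an exponent -/
def cyc (g : Equiv.Perm (Fin n)) : J Unit n := ⟨of_mul fun _ => cycM g, by
  rw [← sum_mul_of, Finset.sum_congr rfl fun c _ => by rw [mul_of_of_mul _ (fun _ => zero_cycM g)]]
  simp [sum_cycM]⟩

lemma mul_of_cyc (g : Equiv.Perm (Fin n)) : mul_of (cyc g).1 () = cycM g := mul_of_of_mul _ (fun _ => zero_cycM g) ()

lemma mul_of_add_single (α : Unit × ℕ →₀ ℕ) (i : Unit × ℕ) : mul_of (α + Finsupp.single i 1) () = (i.2 + 1) ::ₘ mul_of α () := by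
  obtain ⟨⟨⟩, k⟩ := i
  ext a
  rcases Nat.eq_zero_or_pos a with rfl | ha
  · rw [Multiset.count_eq_zero_of_notMem (zero_mul_of _ _), Multiset.count_cons_of_ne (by omega), Multiset.count_eq_zero_of_notMem (zero_mul_of _ _)]
  · obtain ⟨j, rfl⟩ := Nat.exists_eq_succ_of_ne_zero ha.ne'
    rw [Nat.succ_eq_add_one, count_mul_of, Multiset.count_cons, count_mul_of, Finsupp.add_apply, Finsupp.single_apply]
    simp [eq_comm]

lemma pm_mul_of (ν : Unit × ℕ →₀ ℕ) : pm (mul_of ν ()) = MvPolynomial.monomial ν 1 := by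
  refine fs_ind (P := fun ν => pm (mul_of ν ()) = MvPolynomial.monomial ν 1) ?_ ?_ ν
  · simp [pm, mul_of]
  · rintro α ⟨⟨⟩, k⟩ ih
    rw [mul_of_add_single, pm, Multiset.map_cons, Multiset.prod_cons, ← pm, ih, add_tsub_cancel_right, MvPolynomial.X,
      MvPolynomial.monomial_mul, one_mul, add_comm]

lemma mul_of_inj (α β : Unit × ℕ →₀ ℕ) (h : mul_of α () = mul_of β ()) : α = β := by
  ext ⟨⟨⟩, j⟩
  rw [← count_mul_of, h, count_mul_of]

lemma cyc_eq_iff (g : Equiv.Perm (Fin n)) (α : J Unit n) : cyc g = α ↔ g.cycleType = (mul_of α.1 ()).filter (fun a => a ≠ 1) := by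
  have hs : (mul_of α.1 ()).sum = n := by
    have := sum_mul_of α.1
    rw [α.2] at this; simpa using this
  have hsplit : (mul_of α.1 ()) = (mul_of α.1 ()).filter (fun a => a ≠ 1) + Multiset.replicate ((mul_of α.1 ()).count 1) 1 := by
    conv_lhs => rw [← Multiset.filter_add_not (fun a => a ≠ 1) (mul_of α.1 ())]
    congr 1
    simp only [not_not]
    rw [Multiset.filter_eq']
  constructor
  · rintro rfl
    rw [mul_of_cyc, cycM, Multiset.filter_add]
    rw [Multiset.filter_eq_self.2, Multiset.filter_eq_nil.2]
    · simp
    · intro a ha; rw [Multiset.eq_of_mem_replicate ha]; simp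
    · intro a ha; have := two_le_ct g a ha; omega
  · intro h
    apply Subtype.ext
    apply mul_of_inj
    rw [mul_of_cyc, hsplit, ← h, cycM]
    congr 2
    have h2 := congrArg Multiset.sum hsplit
    rw [← h, hs, Multiset.sum_add, Multiset.sum_replicate, Equiv.Perm.sum_cycleType, smul_eq_mul, mul_one] at h2
    omega

lemma card_class (α : J Unit n) : ((Finset.univ.filter fun g : Equiv.Perm (Fin n) => cyc g = α).card : ℚ) * zz α.1 = (n.factorial : ℚ) := by
  have hs : (mul_of α.1 ()).sum = n := by
    have := sum_mul_of α.1
    rw [α.2] at this; simpa using this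
  have hsplit : (mul_of α.1 ()) = (mul_of α.1 ()).filter (fun a => a ≠ 1) + Multiset.replicate ((mul_of α.1 ()).count 1) 1 := by
    conv_lhs => rw [← Multiset.filter_add_not (fun a => a ≠ 1) (mul_of α.1 ())]
    congr 1
    simp only [not_not]
    rw [Multiset.filter_eq']
  set m := (mul_of α.1 ()).filter (fun a => a ≠ 1) with hm
  set r := (mul_of α.1 ()).count 1 with hr
  have hsum : m.sum + r = n := by
    have h2 := congrArg Multiset.sum hsplit
    rw [hs, Multiset.sum_add, Multiset.sum_replicate, smul_eq_mul, mul_one] at h2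
    omega
  have h1 : 1 ∉ m := by rw [hm, Multiset.mem_filter]; simp
  rw [zz_eq α.1 _ hsplit, fac_count m r h1]
  have hc := Equiv.Perm.card_of_cycleType_mul_eq (Fin n) m
  rw [if_pos, Fintype.card_fin, show n - m.sum = r by omega] at hc
  · rw [← hc]
    simp only [cyc_eq_iff]
    push_cast
    rfl
  · refine ⟨by rw [Fintype.card_fin]; omega, fun a ha => ?_⟩
    have ha1 : a ≠ 1 := by rintro rfl; exact h1 ha
    have ha0 : a ≠ 0 := by
      rintro rfl
      exact zero_mul_of α.1 () (Multiset.mem_of_mem_filter ha)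
    omega

lemma cyc_surj (α : J Unit n) : ∃ g : Equiv.Perm (Fin n), cyc g = α := by
  have h := card_class α
  by_contra hc
  push Not at hc
  rw [Finset.filter_eq_empty_iff.2 (fun g _ => hc g)] at h
  simp at h
  exact Nat.factorial_ne_zero n (by exact_mod_cast h.symm)

/-- class function of a symmetric function -/
def vl (F : Q Unit) (g : Equiv.Perm (Fin n)) : ℚ := ip F (pm (cycM g))

lemma vl_eq (F : Q Unit) (g : Equiv.Perm (Fin n)) : vl F g = zz (cyc g).1 * MvPolynomial.coeff (cyc g).1 F := by
  rw [vl, ← mul_of_cyc, pm_mul_of, ip_symm, ip_monomial, one_mul]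

lemma cycM_inv (g : Equiv.Perm (Fin n)) : cycM g⁻¹ = cycM g := by
  unfold cycM
  rw [Equiv.Perm.cycleType_inv, Equiv.Perm.support_inv]

lemma sp_vl (F G : Q Unit) (hF : Hom F n) : sp (vl F : Equiv.Perm (Fin n) → ℚ) (vl G) = ip F G := by
  unfold sp
  have h1 : ∀ g : Equiv.Perm (Fin n), vl G g⁻¹ = vl G g := fun g => by rw [vl, cycM_inv, vl]
  simp only [h1]
  rw [ip_eq_sum n F G hF]
  have h2 : ∑ g : Equiv.Perm (Fin n), vl F g * vl G g = ∑ α : J Unit n, ∑ g : Equiv.Perm (Fin n) with cyc g = α, vl F g * vl G g :=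
    (Finset.sum_fiberwise_of_maps_to (fun _ _ => Finset.mem_univ _) _).symm
  rw [h2, Finset.mul_sum]
  refine Finset.sum_congr rfl fun α _ => ?_
  have h3 : ∑ g : Equiv.Perm (Fin n) with cyc g = α, vl F g * vl G g =
      ((Finset.univ.filter fun g : Equiv.Perm (Fin n) => cyc g = α).card : ℚ) * (zz α.1 * MvPolynomial.coeff α.1 F * (zz α.1 * MvPolynomial.coeff α.1 G)) := by
    rw [← nsmul_eq_mul]
    apply Finset.sum_eq_card_nsmul
    intro g hg
    rw [vl_eq, vl_eq, (Finset.mem_filter.1 hg).2]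
  rw [h3, Fintype.card_perm, Fintype.card_fin, ← card_class α]
  have h4 : (n.factorial : ℚ) ≠ 0 := by exact_mod_cast Nat.factorial_ne_zero n
  rw [← card_class α] at h4
  have h5 := left_ne_zero_of_mul h4
  have h6 := right_ne_zero_of_mul h4
  field_simp

lemma vl_inj (F : Q Unit) (hF : Hom F n) (h : (vl F : Equiv.Perm (Fin n) → ℚ) = 0) : F = 0 := by
  apply (ip_self_nonneg F).2
  rw [← sp_vl F F hF, h]
  simp [sp]

lemma vl_vanish (l : ℕ) (hl : 2 ≤ l) (F : Q Unit) (hF : Hom F n) :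
    (∀ g : Equiv.Perm (Fin n), IsSingular l g → vl F g = 0) ↔ ∀ j : ℕ, DD ((), l * (j + 1) - 1) F = 0 := by
  constructor
  · intro h j
    have hj : l * (j + 1) - 1 + 1 = l * (j + 1) := by
      have : 0 < l * (j + 1) := by positivity
      omega
    apply ip_nondeg
    intro f
    rw [← ip_X_mul]
    induction f using MvPolynomial.induction_on' with
    | add p q h1 h2 => rw [mul_add, map_add, LinearMap.add_apply, h1, h2, add_zero]
    | monomial μ a =>
      rw [MvPolynomial.X, MvPolynomial.monomial_mul, ip_monomial]
      by_cases hw : wgt (Finsupp.single ((), l * (j + 1) - 1) 1 + μ) = n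
      · obtain ⟨g, hg⟩ := cyc_surj ⟨_, hw⟩
        have h2 := h g ⟨l * (j + 1), ?_, Dvd.intro _ rfl⟩
        · rw [vl_eq, hg] at h2
          rcases mul_eq_zero.1 h2 with h3 | h3
          · exact absurd h3 (zz_pos _).ne'
          · rw [h3, mul_zero]
        · rw [← mul_of_cyc, hg]
          change _ ∈ mul_of (Finsupp.single ((), l * (j + 1) - 1) 1 + μ) ()
          rw [add_comm, mul_of_add_single]
          simp only [hj]
          exact Multiset.mem_cons_self _ _
      · have : MvPolynomial.coeff (Finsupp.single ((), l * (j + 1) - 1) 1 + μ) F = 0 := by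
          by_contra hc; exact hw (hF hc)
        rw [this, mul_zero]
  · rintro h g ⟨j, hj, hd⟩
    obtain ⟨q, rfl⟩ := hd
    have hq : q ≠ 0 := by rintro rfl; rw [mul_zero] at hj; exact zero_cycM g hj
    obtain ⟨j, rfl⟩ := Nat.exists_eq_succ_of_ne_zero hq
    rw [vl, ← Multiset.cons_erase hj, pm, Multiset.map_cons, Multiset.prod_cons, ip_symm, ip_X_mul]
    have := h j
    rw [Nat.succ_eq_add_one, this, map_zero]

lemma sFun_eq (lam : Nat.Partition n) (N : ℕ) (h : Multiset.card lam.parts ≤ N) : sFun lam = vl (sc N (LL lam.parts)) := by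
  funext g
  rw [sFun, sval_eq _ _ (zero_cycM g), sc_stable _ _ h, vl, ip_symm]

end CBI

namespace CBI

section
variable {B C : Type*} [Fintype B] [DecidableEq B] [Fintype C] [DecidableEq C]

lemma sch_neg (κ : B → C) (δ : B → ℕ) (γ : B → ℤ) (h : ∑ i, γ i < ∑ i, (δ i : ℤ)) : sch κ δ γ = 0 := by
  rw [sch_eq]
  refine Finset.sum_eq_zero fun σ _ => ?_
  split_ifs
  · have : ∃ i ∈ Finset.univ, γ (σ i) - δ i < 0 := by
      by_contra hc
      push Not at hc
      have := Finset.sum_nonneg hc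
      rw [Finset.sum_sub_distrib, Equiv.sum_comp σ] at this
      linarith
    obtain ⟨i, hi, h0⟩ := this
    rw [Finset.prod_eq_zero hi (hz_neg _ h0), smul_zero]
  · simp

/-- data linking one coloured and several coloured Schur functions -/
structure Link (κ : B → C) (δ : B → ℕ) (l e : ℕ) (r : B → ℕ) (δ1 : B → ℕ) : Prop where
  lpos : 0 < l
  rlt : ∀ i, r i < l
  rκ : ∀ s t, κ s = κ t ↔ r s = r t
  v2 : Vac κ δ
  v1 : Vac (fun _ : B => ()) δ1
  sum : (l : ℤ) * ∑ i, (δ i : ℤ) + ∑ i, (r i : ℤ) = ∑ i, (δ1 i : ℤ) + e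

/-- the combined exponent -/
def GG (l : ℕ) (r : B → ℕ) (γ : B → ℤ) : B → ℤ := fun i => l * γ i + r i

variable {κ : B → C} {δ : B → ℕ} {l e : ℕ} {r δ1 : B → ℕ}

lemma sum_GG (hL : Link κ δ l e r δ1) (γ : B → ℤ) (w : ℤ) : (∑ i, γ i = ∑ i, (δ i : ℤ) + w) ↔
    ∑ i, GG l r γ i = ∑ i, (δ1 i : ℤ) + (e + l * w) := by
  have h := hL.sum
  unfold GG
  rw [Finset.sum_add_distrib, ← Finset.mul_sum]
  have hl : (0 : ℤ) < l := by exact_mod_cast hL.lpos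
  constructor
  · intro h1; rw [h1]; linarith
  · intro h1
    apply mul_left_cancel₀ hl.ne'
    linarith

/-- one coloured function -/
def S1 (l : ℕ) (r δ1 : B → ℕ) (γ : B → ℤ) : Q Unit := sch (fun _ : B => ()) δ1 (GG l r γ)

lemma GG_inj (hL : Link κ δ l e r δ1) (a b : ℤ) (s t : B) : ((l : ℤ) * a + r s = l * b + r t) ↔ (a = b ∧ r s = r t) := by
  have hl : (0 : ℤ) < l := by exact_mod_cast hL.lpos
  constructor
  · intro h
    have h1 : (r s : ℤ) < l := by exact_mod_cast hL.rlt s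
    have h2 : (r t : ℤ) < l := by exact_mod_cast hL.rlt t
    have e1 : ((l : ℤ) * a + r s) / l = a := by
      rw [add_comm, Int.add_mul_ediv_left _ _ hl.ne', Int.ediv_eq_zero_of_lt (by positivity) h1, zero_add]
    have e2 : ((l : ℤ) * b + r t) / l = b := by
      rw [add_comm, Int.add_mul_ediv_left _ _ hl.ne', Int.ediv_eq_zero_of_lt (by positivity) h2, zero_add]
    have : a = b := by rw [← e1, h, e2]
    refine ⟨this, ?_⟩
    subst this
    have : (r s : ℤ) = r t := by linarith
    exact_mod_cast this
  · rintro ⟨rfl, h⟩; rw [h]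

lemma eps_link (hL : Link κ δ l e r δ1) (γ γ' : B → ℤ) :
    eps (fun _ : B => ()) (GG l r γ) (GG l r γ') = eps κ γ γ' := by
  have hl : (0 : ℤ) < l := by exact_mod_cast hL.lpos
  unfold eps
  have h1 : (∀ i, 0 ≤ GG l r γ i) ↔ ∀ i, 0 ≤ γ i := by
    refine forall_congr' fun i => ?_
    have h1 : (r i : ℤ) < l := by exact_mod_cast hL.rlt i
    unfold GG
    constructor
    · intro h
      by_contra hc
      push Not at hc
      have : (l : ℤ) * γ i ≤ l * (-1) := mul_le_mul_of_nonneg_left (by omega) hl.le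
      linarith
    · intro h; positivity
  have h2 : FF (fun _ : B => ()) (GG l r γ') (GG l r γ) = FF κ γ' γ := by
    unfold FF
    refine Finset.sum_congr rfl fun σ _ => ?_
    have : ((∀ i : B, (fun _ : B => ()) (σ i) = (fun _ : B => ()) i) ∧ GG l r γ = GG l r γ' ∘ σ) ↔ ((∀ i, κ (σ i) = κ i) ∧ γ = γ' ∘ σ) := by
      constructor
      · rintro ⟨_, h⟩
        have h3 := fun i => (GG_inj hL _ _ _ _).1 (congrFun h i)
        exact ⟨fun i => (hL.rκ _ _).2 (h3 i).2.symm, funext fun i => (h3 i).1⟩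
      · rintro ⟨h3, h4⟩
        exact ⟨fun _ => rfl, funext fun i => (GG_inj hL _ _ _ _).2 ⟨congrFun h4 i, ((hL.rκ _ _).1 (h3 i)).symm⟩⟩
    exact if_congr this rfl rfl
  rw [h2]; exact if_congr h1 rfl rfl

lemma ip_sch_all (hv : Vac κ δ) (γ γ' : B → ℤ) (h : ∑ i, γ i = ∑ i, γ' i) :
    ip (sch κ δ γ) (sch κ δ γ') = eps κ γ γ' := by
  by_cases hw : ∑ i, γ i < ∑ i, (δ i : ℤ)
  · rw [sch_neg κ δ γ hw, map_zero, LinearMap.zero_apply, eps]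
    split_ifs with h0
    · exact (FF_small hv _ _ h0 hw).symm
    · rfl
  · push Not at hw
    obtain ⟨w, hw⟩ := Int.le.dest hw
    exact ip_sch hv w γ γ' hw.symm (by rw [← h, hw])

lemma ip_link (hL : Link κ δ l e r δ1) (γ γ' : B → ℤ) (h : ∑ i, γ i = ∑ i, γ' i) :
    ip (S1 l r δ1 γ) (S1 l r δ1 γ') = ip (sch κ δ γ) (sch κ δ γ') := by
  rw [ip_sch_all hL.v2 _ _ h, S1, S1, ip_sch_all hL.v1, eps_link hL]
  unfold GG
  rw [Finset.sum_add_distrib, Finset.sum_add_distrib, ← Finset.mul_sum, ← Finset.mul_sum, h]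

/-- realisation in one colour -/
def L1 (l : ℕ) (r δ1 : B → ℕ) : ((B → ℤ) →₀ ℤ) →ₗ[ℤ] Q Unit := Finsupp.linearCombination ℤ (S1 l r δ1)

/-- realisation in several colours -/
def L2 (κ : B → C) (δ : B → ℕ) : ((B → ℤ) →₀ ℤ) →ₗ[ℤ] Q C := Finsupp.linearCombination ℤ (sch κ δ)

/-- formal combinations of given total weight -/
def FS (B : Type*) [Fintype B] (s : ℤ) : Submodule ℤ ((B → ℤ) →₀ ℤ) := Finsupp.supported ℤ ℤ {γ : B → ℤ | ∑ i, γ i = s}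

lemma ip_zsum {X D : Type*} (f g : X → Q D) (x y : X →₀ ℤ) :
    ip (Finsupp.linearCombination ℤ f x) (Finsupp.linearCombination ℤ g y) =
      ∑ a ∈ x.support, ∑ b ∈ y.support, ((x a * y b : ℤ) : ℚ) * ip (f a) (g b) := by
  rw [Finsupp.linearCombination_apply, Finsupp.linearCombination_apply, Finsupp.sum, Finsupp.sum, map_sum, Finset.sum_comm]
  refine Finset.sum_congr rfl fun b _ => ?_
  rw [map_sum, LinearMap.sum_apply]
  refine Finset.sum_congr rfl fun a _ => ?_
  rw [map_zsmul, map_zsmul, LinearMap.smul_apply, zsmul_eq_mul, zsmul_eq_mul]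
  push_cast; ring

lemma ip_L (hL : Link κ δ l e r δ1) (s : ℤ) (x y : (B → ℤ) →₀ ℤ) (hx : x ∈ FS B s) (hy : y ∈ FS B s) :
    ip (L1 l r δ1 x) (L1 l r δ1 y) = ip (L2 κ δ x) (L2 κ δ y) := by
  rw [L1, L2, ip_zsum, ip_zsum]
  refine Finset.sum_congr rfl fun a ha => Finset.sum_congr rfl fun b hb => ?_
  have h1 : ∑ i, a i = s := (Finsupp.mem_supported _ _).1 hx ha
  have h2 : ∑ i, b i = s := (Finsupp.mem_supported _ _).1 hy hb
  rw [ip_link hL a b (h1.trans h2.symm)]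

lemma L_zero (hL : Link κ δ l e r δ1) (s : ℤ) (x : (B → ℤ) →₀ ℤ) (hx : x ∈ FS B s) :
    L1 l r δ1 x = 0 ↔ L2 κ δ x = 0 := by
  have h := ip_L hL s x x hx hx
  constructor
  · intro h0; rw [h0] at h
    exact (ip_self_nonneg _).2 (by rw [← h]; simp)
  · intro h0; rw [h0] at h
    exact (ip_self_nonneg _).2 (by rw [h]; simp)

/-- formal derivative -/
def FD (j : ℕ) : ((B → ℤ) →₀ ℤ) →ₗ[ℤ] ((B → ℤ) →₀ ℤ) :=
  Finsupp.linearCombination ℤ fun γ => ∑ t, Finsupp.single (Function.update γ t (γ t - ((j : ℤ) + 1))) 1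

lemma FD_mem (s : ℤ) (j : ℕ) (x : (B → ℤ) →₀ ℤ) (hx : x ∈ FS B s) : FD j x ∈ FS B (s - (j + 1)) := by
  rw [FD, Finsupp.linearCombination_apply]
  refine Submodule.sum_mem _ fun γ hγ => Submodule.smul_mem _ _ (Submodule.sum_mem _ fun t _ => ?_)
  apply Finsupp.single_mem_supported
  have h1 : ∑ i, γ i = s := (Finsupp.mem_supported _ _).1 hx hγ
  change ∑ i, _ = _
  rw [update_eq]
  simp only [Pi.sub_apply]
  rw [Finset.sum_sub_distrib, h1, Finset.sum_pi_single']
  simp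

lemma zsum_map {X D : Type*} (D' : Q D →ₗ[ℤ] Q D) (f : X → Q D) (F : X → (X →₀ ℤ))
    (h : ∀ a, D' (f a) = Finsupp.linearCombination ℤ f (F a)) (x : X →₀ ℤ) :
    D' (Finsupp.linearCombination ℤ f x) = Finsupp.linearCombination ℤ f (Finsupp.linearCombination ℤ F x) := by
  induction x using Finsupp.induction_linear with
  | zero => simp
  | add x y h1 h2 => simp only [map_add, h1, h2]
  | single a b => simp only [Finsupp.linearCombination_single, map_smul, h]

lemma DT_L2 (j : ℕ) (x : (B → ℤ) →₀ ℤ) : DT j (L2 κ δ x) = L2 κ δ (FD j x) := by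
  have := zsum_map ((∑ c : C, (DD (c, j) : Q C →ₗ[ℚ] Q C)).restrictScalars ℤ) (sch κ δ)
    (fun γ => ∑ t, Finsupp.single (Function.update γ t (γ t - ((j : ℤ) + 1))) 1) (by
      intro γ
      rw [map_sum, LinearMap.restrictScalars_apply, LinearMap.sum_apply]
      have h : ∀ c : C, (DD (c, j) : Q C →ₗ[ℚ] Q C) (sch κ δ γ) = DD (c, j) (sch κ δ γ) := fun _ => rfl
      simp only [h, DD_sch, Finsupp.linearCombination_single, one_smul]
      rw [Finset.sum_comm]
      simp) x
  rw [L2, FD, ← this, DT, LinearMap.restrictScalars_apply, LinearMap.sum_apply]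
  rfl

lemma DD_L1 (hl : 0 < l) (j : ℕ) (x : (B → ℤ) →₀ ℤ) : DD ((), l * (j + 1) - 1) (L1 l r δ1 x) = L1 l r δ1 (FD j x) := by
  have hj : ((l * (j + 1) - 1 : ℕ) : ℤ) + 1 = l * (j + 1) := by
    have : 0 < l * (j + 1) := by positivity
    zify [this]
    ring_nf
  exact zsum_map ((DD ((), l * (j + 1) - 1) : Q Unit →ₗ[ℚ] Q Unit).restrictScalars ℤ) (S1 l r δ1)
    (fun γ => ∑ t, Finsupp.single (Function.update γ t (γ t - ((j : ℤ) + 1))) 1) (by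
      intro γ
      rw [map_sum, LinearMap.restrictScalars_apply]
      change DD ((), l * (j + 1) - 1) (sch (fun _ : B => ()) δ1 (GG l r γ)) = _
      rw [DD_sch]
      refine Finset.sum_congr rfl fun t _ => ?_
      rw [if_pos rfl, Finsupp.linearCombination_single, one_smul, S1]
      congr 1
      funext i
      by_cases hi : i = t
      · subst hi
        simp only [GG, Function.update_self, hj]; ring
      · simp only [GG, Function.update_of_ne hi]) x

lemma L1_hom (hL : Link κ δ l e r δ1) (w : ℕ) (x : (B → ℤ) →₀ ℤ) (hx : x ∈ FS B (∑ i, (δ i : ℤ) + w)) :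
    Hom (L1 l r δ1 x) (e + l * w) := by
  rw [L1, Finsupp.linearCombination_apply]
  refine Submodule.sum_mem (MvPolynomial.weightedHomogeneousSubmodule ℚ (wt Unit) (e + l * w)) fun γ hγ => ?_
  refine zsmul_mem ?_ _
  have h1 : ∑ i, γ i = _ := (Finsupp.mem_supported _ _).1 hx hγ
  apply Hom_sch
  rw [(sum_GG hL γ w).1 h1]
  push_cast; ring

lemma vanish_link (hL : Link κ δ l e r δ1) (hl : 2 ≤ l) (w : ℕ) (x : (B → ℤ) →₀ ℤ) (hx : x ∈ FS B (∑ i, (δ i : ℤ) + w)) :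
    (∀ g : Equiv.Perm (Fin (e + l * w)), IsSingular l g → vl (L1 l r δ1 x) g = 0) ↔ ∀ j, DT j (L2 κ δ x) = 0 := by
  rw [vl_vanish l hl _ (L1_hom hL w x hx)]
  refine forall_congr' fun j => ?_
  rw [DD_L1 hL.lpos, DT_L2, L_zero hL _ _ (FD_mem _ j x hx)]

/-- the class function as a linear map -/
def vlL (n : ℕ) : Q Unit →ₗ[ℤ] (Equiv.Perm (Fin n) → ℚ) where
  toFun F := vl F
  map_add' F G := by funext g; simp [vl]
  map_smul' a F := by
    funext g
    change ip (a • F) _ = a • ip F _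
    rw [map_zsmul, LinearMap.smul_apply]

lemma L2_range (w : ℕ) (g : Q C) (hg : g ∈ SL κ δ w) : ∃ x ∈ FS B (∑ i, (δ i : ℤ) + w), L2 κ δ x = g := by
  unfold SL at hg
  induction hg using Submodule.span_induction with
  | mem g h =>
    obtain ⟨γ, h1, rfl⟩ := h
    exact ⟨Finsupp.single γ 1, Finsupp.single_mem_supported _ _ h1, by simp [L2]⟩
  | zero => exact ⟨0, Submodule.zero_mem _, map_zero _⟩
  | add a b _ _ h1 h2 =>
    obtain ⟨x, hx, rfl⟩ := h1
    obtain ⟨y, hy, rfl⟩ := h2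
    exact ⟨x + y, Submodule.add_mem _ hx hy, map_add _ _ _⟩
  | smul a b _ h1 =>
    obtain ⟨x, hx, rfl⟩ := h1
    exact ⟨a • x, Submodule.smul_mem _ _ hx, map_smul _ _ _⟩

lemma L2_mem (w : ℕ) (x : (B → ℤ) →₀ ℤ) (hx : x ∈ FS B (∑ i, (δ i : ℤ) + w)) : L2 κ δ x ∈ SL κ δ w := by
  rw [L2, Finsupp.linearCombination_apply]
  refine Submodule.sum_mem _ fun γ hγ => Submodule.smul_mem _ _ (Submodule.subset_span ?_)
  exact ⟨γ, (Finsupp.mem_supported _ _).1 hx hγ, rfl⟩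

end

theorem block_reduce {B : Type*} [Fintype B] [DecidableEq B] (k e w : ℕ) {κ : B → Option (Option (Fin k))} {δ r δ1 : B → ℕ}
    (hL : Link κ δ (k + 2) e r δ1) (hN : ∀ c, w ≤ (Finset.univ.filter fun t => κ t = c).card)
    (CB : Submodule ℤ (Equiv.Perm (Fin (e + (k + 2) * w)) → ℚ))
    (hCB : CB = ((FS B (∑ i, (δ i : ℤ) + w)).map (L1 (k + 2) r δ1)).map (vlL _))
    {T : Type*} [Fintype T] (bs : T → (Equiv.Perm (Fin (e + (k + 2) * w)) → ℚ))
    (hb1 : LinearIndependent ℤ bs)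
    (hb2 : Submodule.span ℤ (Set.range bs) = VanishSub (k + 2) _ ⊓ CB) :
    IntEquiv (Matrix.of fun t q => sp (bs t) (bs q))
      (Matrix.diagonal
        (fun d : (m : Fin (w + 1)) × (Nat.Partition m × Fin (kfun k (w - (m : ℕ)))) =>
          theta d.2.1.parts (k + 2))) := by
  have hmem : ∀ t, ∃ x ∈ FS B (∑ i, (δ i : ℤ) + w), vl (L1 (k + 2) r δ1 x) = bs t := by
    intro t
    have : bs t ∈ VanishSub (k + 2) _ ⊓ CB := by rw [← hb2]; exact Submodule.subset_span ⟨t, rfl⟩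
    have h2 := this.2
    rw [hCB] at h2
    obtain ⟨_, ⟨x, hx, rfl⟩, h3⟩ := h2
    exact ⟨x, hx, h3⟩
  choose x hx hxb using hmem
  have hgram : ∀ t q, sp (bs t) (bs q) = ip (L2 κ δ (x t)) (L2 κ δ (x q)) := by
    intro t q
    rw [← hxb t, ← hxb q, sp_vl _ _ (L1_hom hL w _ (hx t)), ip_L hL _ _ _ (hx t) (hx q)]
  have hcomb : ∀ c : T → ℤ, vl (L1 (k + 2) r δ1 (∑ t, c t • x t)) = ∑ t, c t • bs t := by
    intro c
    change vlL _ _ = _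
    simp only [map_sum, map_smul]
    refine Finset.sum_congr rfl fun t _ => ?_
    rw [← hxb t]; rfl
  have hcm : ∀ c : T → ℤ, ∑ t, c t • x t ∈ FS B (∑ i, (δ i : ℤ) + w) :=
    fun c => Submodule.sum_mem _ fun t _ => Submodule.smul_mem _ _ (hx t)
  have key := final_reduce k w (fun t => L2 κ δ (x t)) ?_ ?_
  · simp only [hgram]; exact key
  · rw [Fintype.linearIndependent_iff] at hb1 ⊢
    intro c hc
    apply hb1 c
    rw [← hcomb]
    have : L2 κ δ (∑ t, c t • x t) = 0 := by simpa only [map_sum, map_smul] using hc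
    rw [(L_zero hL _ _ (hcm c)).2 this]
    funext g; simp [vl]
  · ext g
    constructor
    · intro hg
      obtain ⟨c, rfl⟩ := (Submodule.mem_span_range_iff_exists_fun ℤ).1 hg
      have e1 : ∑ t, c t • L2 κ δ (x t) = L2 κ δ (∑ t, c t • x t) := by simp only [map_sum, map_smul]
      rw [e1]
      refine ⟨?_, ?_⟩
      · rw [← SL_eq_HML hL.v2 w hN]; exact L2_mem w _ (hcm c)
      · apply (vanish_link hL (by omega) w _ (hcm c)).1
        rw [hcomb]
        have : ∑ t, c t • bs t ∈ VanishSub (k + 2) _ ⊓ CB := by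
          rw [← hb2]
          exact Submodule.sum_mem _ fun t _ => Submodule.smul_mem _ _ (Submodule.subset_span ⟨t, rfl⟩)
        exact this.1
    · rintro ⟨h1, h2⟩
      rw [← SL_eq_HML hL.v2 w hN] at h1
      obtain ⟨y, hy, rfl⟩ := L2_range w g h1
      have h3 := (vanish_link hL (by omega) w y hy).2 h2
      have h4 : vl (L1 (k + 2) r δ1 y) ∈ Submodule.span ℤ (Set.range bs) := by
        rw [hb2, hCB]
        exact ⟨h3, ⟨_, ⟨y, hy, rfl⟩, rfl⟩⟩
      obtain ⟨c, hc⟩ := (Submodule.mem_span_range_iff_exists_fun ℤ).1 h4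
      rw [← hcomb] at hc
      have h5 : L1 (k + 2) r δ1 (∑ t, c t • x t - y) = 0 := by
        apply vl_inj (n := e + (k + 2) * w) _ (L1_hom hL w _ (Submodule.sub_mem _ (hcm c) hy))
        have e3 := map_sub (vlL (e + (k + 2) * w)) (L1 (k + 2) r δ1 (∑ t, c t • x t)) (L1 (k + 2) r δ1 y)
        rw [← map_sub] at e3
        change vlL _ _ = _
        rw [e3]
        exact sub_eq_zero.2 hc
      have h6 := (L_zero hL _ _ (Submodule.sub_mem _ (hcm c) hy)).1 h5
      rw [map_sub, sub_eq_zero] at h6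
      change L2 κ δ y ∈ Submodule.span ℤ _
      rw [← h6]
      simp only [map_sum, map_smul]
      exact Submodule.sum_mem _ fun t _ => Submodule.smul_mem _ _ (Submodule.subset_span ⟨t, rfl⟩)

end CBI

namespace CBI

/-- beta numbers -/
def bt (L : ℕ → ℕ) (N : ℕ) (i : Fin N) : ℕ := L i + (N - 1 - (i : ℕ))

lemma betaSet_eq (lam : Multiset ℕ) (N : ℕ) :
    betaSet lam N = (Finset.univ.val : Multiset (Fin N)).map (bt (LL lam) N) := by
  have : (Finset.univ.val : Multiset (Fin N)) = ((List.finRange N : List (Fin N)) : Multiset (Fin N)) := rfl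
  rw [this, betaSet, Multiset.map_coe, ← List.map_coe_finRange_eq_range, List.map_map]
  congr 1
  apply List.map_congr_left
  intro i _
  have := i.2
  simp only [Function.comp, bt, LL]
  omega

lemma LL_antitone (lam : Multiset ℕ) : Antitone (LL lam) := by
  intro i j hij
  have hs : (lam.sort (· ≤ ·)).reverse.Pairwise (· ≥ ·) := by
    rw [List.pairwise_reverse]
    exact Multiset.pairwise_sort _ _
  unfold LL
  by_cases hj : j < (lam.sort (· ≤ ·)).reverse.length
  · rw [List.getD_eq_getElem _ _ hj, List.getD_eq_getElem _ _ (lt_of_le_of_lt hij hj)]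
    rcases hij.eq_or_lt with h | h
    · subst h; exact le_rfl
    · exact List.pairwise_iff_getElem.1 hs i j _ hj h
  · rw [List.getD_eq_default _ _ (by omega)]; exact Nat.zero_le _

lemma LL_zero (lam : Multiset ℕ) (i : ℕ) (h : Multiset.card lam ≤ i) : LL lam i = 0 := by
  unfold LL
  rw [List.getD_eq_default]
  simpa using h

lemma map_LL (lam : Multiset ℕ) : (Multiset.range (Multiset.card lam)).map (LL lam) = lam := by
  have h1 : ((lam.sort (· ≤ ·)).reverse : Multiset ℕ) = lam := by
    rw [Multiset.coe_reverse, Multiset.sort_eq]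
  have h2 : (lam.sort (· ≤ ·)).reverse.length = Multiset.card lam := by simp
  conv_rhs => rw [← h1]
  rw [← Multiset.coe_range, Multiset.map_coe, ← h2]
  congr 1
  apply List.ext_getElem
  · simp
  · intro i h3 h4
    simp only [List.getElem_map, List.getElem_range, LL]
    rw [List.getD_eq_getElem]

lemma sum_LL (lam : Multiset ℕ) (N : ℕ) (h : Multiset.card lam ≤ N) : ∑ i : Fin N, LL lam i = lam.sum := by
  rw [Fin.sum_univ_eq_sum_range (LL lam) N]
  rw [← Finset.sum_subset (Finset.range_mono h) (fun i _ hi => LL_zero lam i (by simpa using hi))]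
  conv_rhs => rw [← map_LL lam]
  rfl

lemma bt_anti {L : ℕ → ℕ} (hL : Antitone L) (N : ℕ) : StrictAnti (bt L N) := by
  intro i j hij
  unfold bt
  have h1 := hL (show (i : ℕ) ≤ j from hij.le)
  have h2 : (i : ℕ) < j := hij
  have := j.2
  omega

lemma bt_shift (lam : Multiset ℕ) (n : ℕ) (b : ℕ) :
    (∃ i, bt (LL lam) (n + Multiset.card lam) i = b) ↔ b < n ∨ ∃ i, bt (LL lam) (Multiset.card lam) i + n = b := by
  constructor
  · rintro ⟨i, rfl⟩
    by_cases hi : (i : ℕ) < Multiset.card lam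
    · right
      refine ⟨⟨i, hi⟩, ?_⟩
      simp only [bt]; omega
    · left
      simp only [bt, LL_zero lam i (by omega)]
      have := i.2
      omega
  · rintro (h | ⟨i, rfl⟩)
    · refine ⟨⟨n + Multiset.card lam - 1 - b, by omega⟩, ?_⟩
      simp only [bt]
      rw [LL_zero lam _ (by omega)]; omega
    · refine ⟨⟨i, by have := i.2; omega⟩, ?_⟩
      have := i.2
      simp only [bt]; omega

lemma core_closed (l n : ℕ) (rho : Multiset ℕ) (h : IsCore l rho) (i : Fin (n + Multiset.card rho))
    (hi : l ≤ bt (LL rho) _ i) : ∃ j, bt (LL rho) (n + Multiset.card rho) j = bt (LL rho) _ i - l := by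
  rw [bt_shift]
  rcases (bt_shift rho n _).1 ⟨i, rfl⟩ with h1 | ⟨j, h1⟩
  · left; omega
  · by_cases hb : l ≤ bt (LL rho) _ j
    · right
      have h2 := h (bt (LL rho) _ j) (by rw [betaSet_eq]; exact Multiset.mem_map_of_mem _ (Finset.mem_univ_val j)) hb
      rw [betaSet_eq] at h2
      obtain ⟨j', _, h3⟩ := Multiset.mem_map.1 h2
      exact ⟨j', by omega⟩
    · left; omega

lemma vac_core {N : ℕ} (l : ℕ) (hl : 0 < l) (β : Fin N → ℕ) (hβ : Function.Injective β)
    (hc : ∀ i, l ≤ β i → ∃ j, β j = β i - l) {C : Type*} [DecidableEq C] (κ : Fin N → C)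
    (hκ : ∀ s t, κ s = κ t ↔ β s % l = β t % l) : Vac κ (fun i => β i / l) where
  inj := by
    intro s t h1 h2
    apply hβ
    rw [← Nat.div_add_mod (β s) l, ← Nat.div_add_mod (β t) l, (hκ s t).1 h1]
    rw [show β s / l = β t / l from h2]
  cnt := by
    intro t
    have hex : ∀ j, j ≤ β t / l → ∃ s, β s = β t - l * j := by
      intro j
      induction j with
      | zero => intro _; exact ⟨t, by simp⟩
      | succ j ih =>
        intro hj
        obtain ⟨s, hs⟩ := ih (by omega)
        have h1 : l * (j + 1) ≤ β t := le_trans (Nat.mul_le_mul_left _ hj) (Nat.mul_div_le _ _)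
        rw [Nat.mul_succ] at h1
        obtain ⟨s', hs'⟩ := hc s (by omega)
        refine ⟨s', ?_⟩
        rw [hs', hs, Nat.mul_succ]; omega
    symm
    refine Eq.trans ?_ (Finset.card_range (β t / l))
    refine Finset.card_bij (fun s _ => β s / l) ?_ ?_ ?_
    · intro s hs
      rw [Finset.mem_filter] at hs
      exact Finset.mem_range.2 hs.2.2
    · intro s hs s' hs' h
      rw [Finset.mem_filter] at hs hs'
      have h1 := (hκ _ _).1 hs.2.1
      have h2 := (hκ _ _).1 hs'.2.1
      apply hβ
      rw [← Nat.div_add_mod (β s) l, ← Nat.div_add_mod (β s') l, h1, h2, h]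
    · intro j hj
      rw [Finset.mem_range] at hj
      obtain ⟨s, hs⟩ := hex (β t / l - j) (by omega)
      have h1 : β s = l * j + β t % l := by
        rw [hs]
        have h2 := Nat.div_add_mod (β t) l
        have h3 : l * (β t / l) = l * (β t / l - j) + l * j := by
          rw [← Nat.mul_add]; congr 1; omega
        omega
      have h4 : β s / l = j := by
        rw [h1, add_comm, Nat.add_mul_div_left _ _ hl, Nat.div_eq_of_lt (Nat.mod_lt _ hl), zero_add]
      refine ⟨s, ?_, h4⟩
      rw [Finset.mem_filter]
      refine ⟨Finset.mem_univ _, (hκ _ _).2 ?_, by rw [h4]; exact hj⟩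
      rw [h1, Nat.mul_add_mod, Nat.mod_mod]

lemma vac_one (N : ℕ) : Vac (fun _ : Fin N => ()) (fun i => N - 1 - (i : ℕ)) where
  inj := by
    intro s t _ h
    have h1 := s.2
    have h2 := t.2
    apply Fin.ext
    have h : N - 1 - (s : ℕ) = N - 1 - (t : ℕ) := h
    omega
  cnt := by
    intro t
    have : (Finset.univ.filter fun s : Fin N => (fun _ : Fin N => ()) s = (fun _ : Fin N => ()) t ∧ N - 1 - (s : ℕ) < N - 1 - (t : ℕ)) = Finset.Ioi t := by
      ext s
      have h1 := s.2
      have h2 := t.2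
      rw [Finset.mem_filter, Finset.mem_Ioi, Fin.lt_def]
      constructor
      · rintro ⟨_, _, h⟩; omega
      · intro h; exact ⟨Finset.mem_univ _, rfl, by omega⟩
    rw [this, Fin.card_Ioi]

lemma link_core (l n e : ℕ) (hl : 0 < l) (rho : Nat.Partition e) (hrho : IsCore l rho.parts) {C : Type*} [Fintype C] [DecidableEq C]
    (c : Fin l ≃ C) :
    Link (fun i : Fin (n + Multiset.card rho.parts) => c ⟨bt (LL rho.parts) _ i % l, Nat.mod_lt _ hl⟩)
      (fun i => bt (LL rho.parts) _ i / l) l e (fun i => bt (LL rho.parts) _ i % l)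
      (fun i => n + Multiset.card rho.parts - 1 - (i : ℕ)) where
  lpos := hl
  rlt i := Nat.mod_lt _ hl
  rκ s t := by
    rw [c.injective.eq_iff, Fin.mk.injEq]
  v2 := by
    apply vac_core l hl _ (bt_anti (LL_antitone _) _).injective (fun i hi => core_closed l n _ hrho i hi)
    intro s t
    rw [c.injective.eq_iff, Fin.mk.injEq]
  v1 := vac_one _
  sum := by
    have h1 := sum_LL rho.parts (n + Multiset.card rho.parts) (by omega)
    rw [rho.parts_sum] at h1
    have h2 : (e : ℤ) = ∑ i : Fin (n + Multiset.card rho.parts), (LL rho.parts i : ℤ) := by exact_mod_cast h1.symm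
    refine Eq.trans ?_ (congrArg (fun z : ℤ => _ + z) h2.symm)
    rw [Finset.mul_sum, ← Finset.sum_add_distrib, ← Finset.sum_add_distrib]
    push_cast
    refine Finset.sum_congr rfl fun i _ => ?_
    rw [Int.mul_ediv_add_emod]
    simp only [bt]
    push_cast
    ring

lemma count_core (l w n e : ℕ) (hl : 0 < l) (rho : Nat.Partition e) (hn : l * w ≤ n) {C : Type*} [Fintype C] [DecidableEq C]
    (c : Fin l ≃ C) (d : C) :
    w ≤ (Finset.univ.filter fun i : Fin (n + Multiset.card rho.parts) => c ⟨bt (LL rho.parts) _ i % l, Nat.mod_lt _ hl⟩ = d).card := by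
  have hex : ∀ j : Fin w, ∃ i, bt (LL rho.parts) (n + Multiset.card rho.parts) i = l * j + (c.symm d : Fin l) := by
    intro j
    rw [bt_shift]
    left
    have h1 := (c.symm d).2
    have h2 : l * ((j : ℕ) + 1) ≤ l * w := Nat.mul_le_mul_left _ j.2
    rw [Nat.mul_succ] at h2
    omega
  choose f hf using hex
  have : (Finset.univ : Finset (Fin w)).card ≤ _ := Finset.card_le_card_of_injOn (t := Finset.univ.filter fun i : Fin (n + Multiset.card rho.parts) => c ⟨bt (LL rho.parts) _ i % l, Nat.mod_lt _ hl⟩ = d) f ?_ ?_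
  · simpa using this
  · intro j _
    simp only [Finset.coe_filter, Finset.mem_univ, true_and]
    change c _ = d
    rw [← Equiv.eq_symm_apply]
    apply Fin.ext
    simp only [hf]
    rw [Nat.mul_add_mod, Nat.mod_eq_of_lt (c.symm d).2]
  · intro j _ j' _ h
    have h1 := hf j
    rw [h, hf j'] at h1
    apply Fin.ext
    exact Nat.eq_of_mul_eq_mul_left hl (by omega)

end CBI

namespace CBI

lemma exists_perm_map {N : ℕ} {X : Type*} (f g : Fin N → X)
    (h : (Finset.univ.val : Multiset (Fin N)).map f = (Finset.univ.val : Multiset (Fin N)).map g) :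
    ∃ σ : Equiv.Perm (Fin N), ∀ i, f (σ i) = g i := by
  have hc : ∀ y, Fintype.card {x // g x = y} = Fintype.card {x // f x = y} := by
    intro y
    have := congrArg (Multiset.count y) h
    rw [Multiset.count_map, Multiset.count_map] at this
    rw [Fintype.card_subtype, Fintype.card_subtype, Finset.card_def, Finset.card_def]
    simp only [Finset.filter_val, eq_comm (a := y)] at this ⊢
    exact this.symm
  exact ⟨Equiv.ofFiberEquiv fun y => Fintype.equivOfCardEq (hc y), fun i => Equiv.ofFiberEquiv_map _ i⟩

/-- residues of the beta numbers -/
def RR (l : ℕ) (lam : Multiset ℕ) (N : ℕ) : Multiset ℕ := (betaSet lam N).map (· % l)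

lemma RR_range (l : ℕ) (lam : Multiset ℕ) (N : ℕ) :
    RR l lam N = (Multiset.range N).map fun i => (LL lam i + N - 1 - i) % l := by
  rw [RR]
  change Multiset.map _ ((Multiset.range N).map _) = _
  rw [Multiset.map_map]
  rfl

lemma RR_succ (l : ℕ) (lam : Multiset ℕ) (N : ℕ) (h : Multiset.card lam ≤ N) :
    RR l lam (N + 1) = 0 ::ₘ (RR l lam N).map (fun r => (r + 1) % l) := by
  rw [RR_range, RR_range, Multiset.range_succ, Multiset.map_cons, LL_zero lam N h, Multiset.map_map]
  congr 1
  · simp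
  · refine Multiset.map_congr rfl fun i hi => ?_
    rw [Multiset.mem_range] at hi
    simp only [Function.comp]
    rw [Nat.mod_add_mod]
    congr 1
    omega

lemma RR_step (l : ℕ) (hl : 0 < l) (lam rho : Multiset ℕ) (N : ℕ) (h1 : Multiset.card lam ≤ N) (h2 : Multiset.card rho ≤ N) :
    RR l lam N = RR l rho N ↔ RR l lam (N + 1) = RR l rho (N + 1) := by
  rw [RR_succ l lam N h1, RR_succ l rho N h2, Multiset.cons_inj_right]
  constructor
  · intro h; rw [h]
  · intro h
    have key : ∀ mu : Multiset ℕ, ((RR l mu N).map (fun r => (r + 1) % l)).map (fun r => (r + (l - 1)) % l) = RR l mu N := by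
      intro mu
      rw [Multiset.map_map]
      conv_rhs => rw [← Multiset.map_id (RR l mu N)]
      refine Multiset.map_congr rfl fun r hr => ?_
      have hr : r < l := by
        rw [RR] at hr
        obtain ⟨a, _, rfl⟩ := Multiset.mem_map.1 hr
        exact Nat.mod_lt _ hl
      simp only [Function.comp, id]
      rw [Nat.mod_add_mod, show r + 1 + (l - 1) = r + l by omega, Nat.add_mod_right, Nat.mod_eq_of_lt hr]
    rw [← key lam, h, key rho]

lemma RR_max (l : ℕ) (hl : 0 < l) (lam rho : Multiset ℕ) (N : ℕ) (h : max (Multiset.card lam) (Multiset.card rho) ≤ N) :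
    RR l lam (max (Multiset.card lam) (Multiset.card rho)) = RR l rho (max (Multiset.card lam) (Multiset.card rho)) ↔
      RR l lam N = RR l rho N := by
  induction N, h using Nat.le_induction with
  | base => rfl
  | succ N hN ih =>
    rw [ih, RR_step l hl _ _ N (le_trans (le_max_left _ _) hN) (le_trans (le_max_right _ _) hN)]

lemma sameCore_iff (l : ℕ) (hl : 0 < l) (lam rho : Multiset ℕ) (N : ℕ) (h1 : Multiset.card lam ≤ N) (h2 : Multiset.card rho ≤ N) :
    sameCore l lam rho ↔ (Finset.univ.val : Multiset (Fin N)).map (fun i => bt (LL lam) N i % l) =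
      (Finset.univ.val : Multiset (Fin N)).map (fun i => bt (LL rho) N i % l) := by
  have e : ∀ mu, RR l mu N = (Finset.univ.val : Multiset (Fin N)).map (fun i => bt (LL mu) N i % l) := by
    intro mu
    rw [RR, betaSet_eq, Multiset.map_map]; rfl
  rw [← e, ← e, ← RR_max l hl lam rho N (max_le h1 h2),
    RR_max l hl lam rho (Multiset.card lam + Multiset.card rho) (by omega)]
  rfl

lemma map_LL_range (lam : Multiset ℕ) (N : ℕ) (h : Multiset.card lam ≤ N) :
    (Multiset.range N).map (LL lam) = lam + Multiset.replicate (N - Multiset.card lam) 0 := by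
  induction N, h using Nat.le_induction with
  | base => rw [map_LL]; simp
  | succ N hN ih =>
    rw [Multiset.range_succ, Multiset.map_cons, ih, LL_zero lam N hN, show N + 1 - Multiset.card lam = (N - Multiset.card lam) + 1 by omega,
      Multiset.replicate_succ, Multiset.add_cons]

lemma LL_filter (L : ℕ → ℕ) (hL : Antitone L) (N : ℕ) (i : ℕ) (hi : i < N) :
    LL (((Multiset.range N).map L).filter (fun x => x ≠ 0)) i = L i := by
  set lam := ((Multiset.range N).map L).filter (fun x => x ≠ 0) with hlam
  have hsplit : (Multiset.range N).map L = lam + Multiset.replicate (Multiset.count 0 ((Multiset.range N).map L)) 0 := by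
    rw [← Multiset.filter_eq', hlam]
    conv_lhs => rw [← Multiset.filter_add_not (fun x => x ≠ 0) ((Multiset.range N).map L)]
    simp
  have hcard := congrArg Multiset.card hsplit
  rw [Multiset.card_map, Multiset.card_range, Multiset.card_add, Multiset.card_replicate] at hcard
  have hm : (Multiset.range N).map (LL lam) = (Multiset.range N).map L := by
    rw [map_LL_range lam N (by omega), hsplit]
    congr 2
    omega
  have hp : ((List.range N).map (LL lam)).Perm ((List.range N).map L) := Multiset.coe_eq_coe.1 hm
  have hs : ∀ M : ℕ → ℕ, Antitone M → ((List.range N).map M).Pairwise (· ≥ ·) := by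
    intro M hM
    rw [List.pairwise_map]
    exact (List.pairwise_lt_range (n := N)).imp fun h => hM h.le
  have heq := hp.eq_of_pairwise (fun a b _ _ h1 h2 => le_antisymm h2 h1) (hs _ (LL_antitone _)) (hs _ hL)
  have := congrArg (fun l => l.getD i 0) heq
  simpa [List.getD_eq_getElem, hi] using this

lemma card_parts_le {n : ℕ} (lam : Nat.Partition n) : Multiset.card lam.parts ≤ n := by
  have := Multiset.card_nsmul_le_sum (s := lam.parts) (a := 1) (fun x hx => lam.parts_pos hx)
  rw [lam.parts_sum] at this
  simpa using this

lemma sc_eq (N : ℕ) (L : ℕ → ℕ) : sc N L = sch (fun _ : Fin N => ()) (fun i => N - 1 - (i : ℕ)) (fun i => (bt L N i : ℤ)) := by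
  unfold sc bt
  simp only [Nat.cast_add]

/-- sorting an exponent -/
lemma sort_exp {N : ℕ} (n : ℕ) (G : Fin N → ℕ) (hG : Function.Injective G) (hs : ∑ i, G i = ∑ i : Fin N, (N - 1 - (i : ℕ)) + n) :
    ∃ (lam : Nat.Partition n) (σ : Equiv.Perm (Fin N)), Multiset.card lam.parts ≤ N ∧ ∀ i, bt (LL lam.parts) N i = G (σ i) := by
  set σ := Tuple.sort (fun i => -(G i : ℤ)) with hσ
  have hm : Monotone ((fun i => -(G i : ℤ)) ∘ σ) := Tuple.monotone_sort _
  have hst : ∀ i j : Fin N, i < j → G (σ j) < G (σ i) := by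
    intro i j hij
    have h1 := hm hij.le
    simp only [Function.comp] at h1
    have h2 : G (σ j) ≠ G (σ i) := fun h => hij.ne (σ.injective (hG h)).symm
    omega
  have hge : ∀ d : ℕ, ∀ i : Fin N, N - 1 - (i : ℕ) = d → d ≤ G (σ i) := by
    intro d
    induction d with
    | zero => intro i _; exact Nat.zero_le _
    | succ d ih =>
      intro i hi
      have h1 := ih ⟨i + 1, by omega⟩ (by simp only; omega)
      have h2 := hst i ⟨i + 1, by omega⟩ (Fin.lt_def.2 (by simp))
      omega
  let L : ℕ → ℕ := fun i => if h : i < N then G (σ ⟨i, h⟩) - (N - 1 - i) else 0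
  have hLi : ∀ i : Fin N, L i + (N - 1 - (i : ℕ)) = G (σ i) := by
    intro i
    simp only [L, i.2, dif_pos, Fin.eta]
    have := hge _ i rfl
    omega
  have hL : Antitone L := by
    apply antitone_nat_of_succ_le
    intro i
    by_cases h : i + 1 < N
    · have h1 := hLi ⟨i + 1, h⟩
      have h2 := hLi ⟨i, by omega⟩
      have h3 := hst ⟨i, by omega⟩ ⟨i + 1, h⟩ (Fin.lt_def.2 (by simp))
      simp only at h1 h2
      omega
    · simp [L, h]
  have hsum : ((Multiset.range N).map L).sum = n := by
    have h1 : ((Multiset.range N).map L).sum = ∑ i : Fin N, L i := (Fin.sum_univ_eq_sum_range L N).symm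
    have h2 : ∑ i : Fin N, (L i + (N - 1 - (i : ℕ))) = ∑ i, G i := by
      rw [← Equiv.sum_comp σ G]
      exact Finset.sum_congr rfl fun i _ => hLi i
    rw [Finset.sum_add_distrib, hs] at h2
    rw [h1]; omega
  refine ⟨⟨((Multiset.range N).map L).filter (fun x => x ≠ 0), ?_, ?_⟩, σ, ?_, ?_⟩
  · intro i hi
    exact Nat.pos_of_ne_zero (Multiset.mem_filter.1 hi).2
  · rw [← hsum]
    conv_rhs => rw [← Multiset.filter_add_not (fun x => x ≠ 0) ((Multiset.range N).map L)]
    rw [Multiset.sum_add]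
    have : (Multiset.filter (fun a => ¬ a ≠ 0) ((Multiset.range N).map L)).sum = 0 := by
      apply Multiset.sum_eq_zero
      intro x hx
      simpa using (Multiset.mem_filter.1 hx).2
    omega
  · change Multiset.card (((Multiset.range N).map L).filter (fun x => x ≠ 0)) ≤ N
    refine le_trans (Multiset.card_le_card (Multiset.filter_le _ _)) ?_
    simp
  · intro i
    rw [bt, LL_filter L hL N i i.2, hLi]

end CBI

namespace CBI

lemma block_eq (l w e : ℕ) (hl : 0 < l) (rho : Nat.Partition e) (hrho : IsCore l rho.parts) {C : Type*} [Fintype C] [DecidableEq C]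
    (c : Fin l ≃ C) :
    CBlock l (e + l * w) rho.parts =
      ((FS (Fin ((e + l * w) + Multiset.card rho.parts)) (∑ i, ((bt (LL rho.parts) ((e + l * w) + Multiset.card rho.parts) i / l : ℕ) : ℤ) + w)).map
        (L1 l (fun i => bt (LL rho.parts) _ i % l) (fun i => (e + l * w) + Multiset.card rho.parts - 1 - (i : ℕ)))).map (vlL _) := by
  have hK := link_core l (e + l * w) e hl rho hrho c
  set n := e + l * w with hn
  set N := n + Multiset.card rho.parts with hN
  set r : Fin N → ℕ := fun i => bt (LL rho.parts) N i % l with hr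
  set δ : Fin N → ℕ := fun i => bt (LL rho.parts) N i / l with hδ
  set δ1 : Fin N → ℕ := fun i => N - 1 - (i : ℕ) with hδ1
  have hl' : (0 : ℤ) < l := by exact_mod_cast hl
  apply le_antisymm
  · rw [CBlock, Submodule.span_le]
    rintro _ ⟨lam, ⟨_, hlam⟩, rfl⟩
    have hcard : Multiset.card lam.parts ≤ N := le_trans (card_parts_le lam) (by omega)
    rw [sameCore_iff l hl _ _ N hcard (by omega)] at hlam
    obtain ⟨σ, hσ⟩ := exists_perm_map _ _ hlam
    let γ : Fin N → ℤ := fun i => ((bt (LL lam.parts) N (σ i) / l : ℕ) : ℤ)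
    have hG : GG l r γ = (fun i => (bt (LL lam.parts) N i : ℤ)) ∘ σ := by
      funext i
      simp only [GG, γ, Function.comp, hr]
      rw [← hσ i]
      exact_mod_cast Nat.div_add_mod _ _
    have hS : S1 l r δ1 γ = (Equiv.Perm.sign σ : ℤ) • sc N (LL lam.parts) := by
      rw [S1, hG, sch_comp _ _ _ _ (fun _ => rfl), sc_eq]
    refine ⟨(Equiv.Perm.sign σ : ℤ) • S1 l r δ1 γ, ⟨Finsupp.single γ (Equiv.Perm.sign σ : ℤ), ?_, ?_⟩, ?_⟩
    · apply Finsupp.single_mem_supported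
      change ∑ i, γ i = _
      rw [sum_GG hK, hG]
      simp only [Function.comp]
      rw [Equiv.sum_comp σ (fun i => (bt (LL lam.parts) N i : ℤ))]
      have h1 := sum_LL lam.parts N hcard
      rw [lam.parts_sum] at h1
      simp only [bt, Nat.cast_add]
      rw [Finset.sum_add_distrib]
      have h2 : (∑ i : Fin N, (LL lam.parts i : ℤ)) = e + l * w := by
        rw [← Nat.cast_sum, h1, hn]; push_cast; ring
      rw [h2]; ring
    · rw [L1, Finsupp.linearCombination_single]
    · rw [hS, smul_smul]
      have : (Equiv.Perm.sign σ : ℤ) * (Equiv.Perm.sign σ : ℤ) = 1 := by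
        rw [← Units.val_mul, Int.units_mul_self]; rfl
      rw [this, one_smul]
      exact (sFun_eq lam N hcard).symm
  · rw [Submodule.map_le_iff_le_comap, Submodule.map_le_iff_le_comap]
    intro x hx
    change vlL n (L1 l r δ1 x) ∈ CBlock l n rho.parts
    rw [L1, Finsupp.linearCombination_apply, Finsupp.sum, map_sum]
    refine Submodule.sum_mem _ fun γ hγ => ?_
    rw [map_smul]
    refine Submodule.smul_mem _ _ ?_
    have hs : ∑ i, γ i = ∑ i, (δ i : ℤ) + w := (Finsupp.mem_supported _ _).1 hx hγ
    have hs2 := (sum_GG hK γ w).1 hs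
    have hcast : (e : ℤ) + l * w = (n : ℕ) := by rw [hn]; push_cast; ring
    rw [hcast] at hs2
    by_cases hv : (∀ i, 0 ≤ GG l r γ i) ∧ ∀ s t, (fun _ : Fin N => ()) s = (fun _ : Fin N => ()) t → GG l r γ s = GG l r γ t → s = t
    · let G : Fin N → ℕ := fun i => (GG l r γ i).toNat
      have hGc : ∀ i, (G i : ℤ) = GG l r γ i := fun i => Int.toNat_of_nonneg (hv.1 i)
      have hGi : Function.Injective G := by
        intro s t h
        apply hv.2 s t rfl
        rw [← hGc, ← hGc, h]
      obtain ⟨lam, σ, hcard, hlam⟩ := sort_exp n G hGi (by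
        simp only [← hGc] at hs2
        exact_mod_cast hs2)
      have hsc : sc N (LL lam.parts) = (Equiv.Perm.sign σ : ℤ) • S1 l r δ1 γ := by
        rw [sc_eq, S1, ← sch_comp _ _ _ σ (fun _ => rfl)]
        congr 1
        funext i
        rw [hlam, hGc]; rfl
      have hS : S1 l r δ1 γ = (Equiv.Perm.sign σ : ℤ) • sc N (LL lam.parts) := by
        rw [hsc, smul_smul]
        have : (Equiv.Perm.sign σ : ℤ) * (Equiv.Perm.sign σ : ℤ) = 1 := by
          rw [← Units.val_mul, Int.units_mul_self]; rfl
        rw [this, one_smul]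
      rw [hS, map_smul]
      refine Submodule.smul_mem _ _ ?_
      have : vlL n (sc N (LL lam.parts)) = sFun lam := (sFun_eq lam N hcard).symm
      rw [this]
      refine Submodule.subset_span ⟨lam, ⟨hrho, ?_⟩, rfl⟩
      rw [sameCore_iff l hl _ _ N hcard (by omega)]
      have hres : ∀ i, bt (LL lam.parts) N i % l = r (σ i) := by
        intro i
        rw [hlam]
        have h1 : ((G (σ i) % l : ℕ) : ℤ) = (r (σ i) : ℤ) := by
          push_cast
          rw [hGc, GG, Int.mul_add_emod_self_left]
          exact Int.emod_eq_of_lt (by positivity) (by exact_mod_cast hK.rlt (σ i))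
        exact_mod_cast h1
      simp only [hres]
      have h3 : (Finset.univ.val : Multiset (Fin N)).map (fun i => r (σ i)) = ((Finset.univ.val : Multiset (Fin N)).map σ).map r := by
        rw [Multiset.map_map]; rfl
      rw [h3, Multiset.map_univ_val_equiv]
    · have : S1 l r δ1 γ = 0 := sch_zero hK.v1 n _ hs2 hv
      rw [this, map_zero]
      exact Submodule.zero_mem _

end CBI

/-- **Theorem (Bessenrodt–Hill conjecture; Theorem 1.1).**
Let `ℓ ≥ 2`, `w ≥ 0`, let `ρ` be an `ℓ`-core partition and `n = |ρ| + ℓw`. Then the Cartan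
matrix `Cart_ℓ(n, ρ)` — the Gram matrix of any `ℤ`-basis of
`𝒫(S_n, ρ) = 𝒫(S_n) ∩ ℤ[Irr(S_n, ρ)]` — is equivalent over `ℤ` to the diagonal matrix with
diagonal entries `ϑ_λ(ℓ)`, each repeated `k(ℓ-2, w-|λ|)` times, for `λ` running over the
partitions with `|λ| ≤ w`. -/
theorem cartan_block_invariant_factors (l w : ℕ) (hl : 2 ≤ l) (e : ℕ)
    (rho : Nat.Partition e) (hrho : IsCore l rho.parts)
    {T : Type*} [Fintype T]
    (bs : T → (Equiv.Perm (Fin (e + l * w)) → ℚ))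
    (hb1 : LinearIndependent ℤ bs)
    (hb2 : Submodule.span ℤ (Set.range bs)
        = (VirtCharS (e + l * w) ⊓ VanishSub l (e + l * w))
            ⊓ CBlock l (e + l * w) rho.parts) :
    IntEquiv (Matrix.of fun t q => sp (bs t) (bs q))
      (Matrix.diagonal
        (fun d : (m : Fin (w + 1)) × (Nat.Partition m × Fin (kfun (l - 2) (w - (m : ℕ)))) =>
          theta d.2.1.parts l)) := by
  obtain ⟨k, rfl⟩ : ∃ k, l = k + 2 := ⟨l - 2, by omega⟩
  let c : Fin (k + 2) ≃ Option (Option (Fin k)) := Fintype.equivOfCardEq (by simp)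
  have hsub : CBlock (k + 2) (e + (k + 2) * w) rho.parts ≤ VirtCharS (e + (k + 2) * w) := by
    apply Submodule.span_mono
    rintro _ ⟨lam, _, rfl⟩
    exact ⟨lam, rfl⟩
  have hb3 : Submodule.span ℤ (Set.range bs) = VanishSub (k + 2) (e + (k + 2) * w) ⊓ CBlock (k + 2) (e + (k + 2) * w) rho.parts := by
    rw [hb2, inf_comm (VirtCharS _), inf_assoc, inf_eq_right.2 hsub]
  exact CBI.block_reduce k e w (CBI.link_core (k + 2) (e + (k + 2) * w) e (by omega) rho hrho c)
    (CBI.count_core (k + 2) w (e + (k + 2) * w) e (by omega) rho (by omega) c) _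
    (CBI.block_eq (k + 2) w e (by omega) rho hrho c) bs hb1 hb3

end
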